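/- (Hyperbolic-type metrics.) In the wrapped product setting take d(r)=e^{r/2}, assume R_β(x²,x³) ≥ 0 for all (x²,x³)∈Ω, and assume m² > 3/32. Then for every η₁, η₂ > 0 there is a constant C = C(η₁,η₂) > 0 such that for every solution u of the Dirac equation with initial datum u₀ one has ‖⟨r⟩^{−(1+η₁)} u‖²_{L²(M_g)} + ‖⟨r⟩^{−(1/2+η₂)} |∇_h u|‖²_{L²(M_g)} ≤ C ‖Hu₀‖²_{L²(M_h)}, where ⟨r⟩=(1+r²)^{1/2}. -/

import Mathlib

noncomputable section
open MeasureTheory Real Set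

abbrev Eu (n : ℕ) : Type := EuclideanSpace ℝ (Fin n)

def pd {n : ℕ} {F : Type*} [NormedAddCommGroup F] [NormedSpace ℝ F]
    (j : Fin n) (f : Eu n → F) (x : Eu n) : F :=
  fderiv ℝ f x (EuclideanSpace.single j 1)

def Chr {n : ℕ} (h : Eu n → Matrix (Fin n) (Fin n) ℝ) (i j k : Fin n) (x : Eu n) : ℝ :=
  (1/2) * ∑ l, (h x)⁻¹ i l *
    (pd j (fun y => h y l k) x + pd k (fun y => h y j l) x - pd l (fun y => h y j k) x)

def Rscal {n : ℕ} (h : Eu n → Matrix (Fin n) (Fin n) ℝ) (x : Eu n) : ℝ :=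
  ∑ j, ∑ k, (h x)⁻¹ j k *
    ((∑ i, pd i (fun y => Chr h i j k y) x) - (∑ i, pd k (fun y => Chr h i j i y) x)
      + (∑ i, ∑ l, Chr h l j k x * Chr h i i l x) - (∑ i, ∑ l, Chr h l j i x * Chr h i k l x))

def sdet {n : ℕ} (h : Eu n → Matrix (Fin n) (Fin n) ℝ) (x : Eu n) : ℝ := Real.sqrt (h x).det

def lapR {n : ℕ} (h : Eu n → Matrix (Fin n) (Fin n) ℝ) (f : Eu n → ℝ) (x : Eu n) : ℝ :=
  (sdet h x)⁻¹ * ∑ j, pd j (fun y => sdet h y * ∑ k, (h y)⁻¹ j k * pd k f y) x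

def lapC {n : ℕ} (h : Eu n → Matrix (Fin n) (Fin n) ℝ) (f : Eu n → ℂ) (x : Eu n) : ℂ :=
  ((sdet h x : ℝ) : ℂ)⁻¹ *
    ∑ j, pd j (fun y => ((sdet h y : ℝ) : ℂ) * ∑ k, (((h y)⁻¹ j k : ℝ) : ℂ) * pd k f y) x

def jap {n : ℕ} (x : Eu n) : ℝ := Real.sqrt (1 + ‖x‖ ^ 2)

def Hop (A : Fin 3 → Eu 3 → Fin 4 → Fin 4 → ℂ) (B : Eu 3 → Fin 4 → Fin 4 → ℂ)
    (f : Eu 3 → Fin 4 → ℂ) (x : Eu 3) : Fin 4 → ℂ :=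
  fun i => (∑ j, ∑ k, A j x i k * pd j f x k) + ∑ k, B x i k * f x k

def Elliptic (h : Eu 3 → Matrix (Fin 3) (Fin 3) ℝ) (ν N : ℝ) : Prop :=
  ∀ x : Eu 3, ∀ ξ : Fin 3 → ℝ,
    ν * (∑ j, ξ j ^ 2) ≤ (∑ j, ∑ k, (h x)⁻¹ j k * ξ j * ξ k) ∧
      (∑ j, ∑ k, (h x)⁻¹ j k * ξ j * ξ k) ≤ N * (∑ j, ξ j ^ 2)

def opNorm {n : ℕ} (A : Matrix (Fin n) (Fin n) ℝ) : ℝ :=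
  ‖LinearMap.toContinuousLinearMap (Matrix.toEuclideanLin A)‖

def pdM {n : ℕ} (j : Fin n) (H : Eu n → Matrix (Fin n) (Fin n) ℝ) (x : Eu n) :
    Matrix (Fin n) (Fin n) ℝ :=
  Matrix.of fun a b => pd j (fun y => H y a b) x

def AFlat (h : Eu 3 → Matrix (Fin 3) (Fin 3) ℝ) (σ CI Ch : ℝ) : Prop :=
  (∀ x : Eu 3, opNorm ((h x)⁻¹ - 1) ≤ CI * jap x ^ (-σ)) ∧
  (∀ x : Eu 3,
    (∑ j, opNorm (pdM j (fun y => (h y)⁻¹) x))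
      + ‖x‖ * (∑ j, ∑ k, opNorm (pdM j (pdM k (fun y => (h y)⁻¹)) x))
      + ‖x‖ ^ 2 * (∑ j, ∑ k, ∑ l, opNorm (pdM j (pdM k (pdM l (fun y => (h y)⁻¹))) x))
    ≤ Ch * jap x ^ (-(1 + σ)))

def sphInt (f : Eu 3 → ℝ) (R : ℝ) : ℝ :=
  R ^ 2 * ∫ ω : Metric.sphere (0 : Eu 3) 1, f (R • (ω : Eu 3)) ∂(volume.toSphere)

def innC4 (h : Eu 3 → Matrix (Fin 3) (Fin 3) ℝ) (f g : Eu 3 → Fin 4 → ℂ) : ℂ :=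
  ∫ x : Eu 3, (∑ i, (starRingEnd ℂ) (f x i) * g x i) * ((sdet h x : ℝ) : ℂ)

/-- Projection of `ℝ³ = ℝ × ℝ²` onto the last two coordinates. -/
def pr32 (x : Eu 3) : Eu 2 := (EuclideanSpace.equiv (Fin 2) ℝ).symm fun i => x i.succ

/-- The wrapped-product manifold `M = (0,∞) × Ω` as a subset of `ℝ³`. -/
def Mset (Ω : Set (Eu 2)) : Set (Eu 3) := {x : Eu 3 | 0 < x 0 ∧ pr32 x ∈ Ω}

/-- `h` is the wrapped-product metric `dr² + d(r) β` on `M = (0,∞) × Ω`. -/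
def WrapMetric (Ω : Set (Eu 2)) (β : Eu 2 → Matrix (Fin 2) (Fin 2) ℝ) (d : ℝ → ℝ)
    (h : Eu 3 → Matrix (Fin 3) (Fin 3) ℝ) : Prop :=
  ∀ x ∈ Mset Ω, h x 0 0 = 1 ∧ (∀ i : Fin 2, h x 0 i.succ = 0 ∧ h x i.succ 0 = 0) ∧
    ∀ i j : Fin 2, h x i.succ j.succ = d (x 0) * β (pr32 x) i j

/-- `Λ^{k,ij} = ½( h^{kl}∂_l h^{ij} − h^{il}∂_l h^{kj} − h^{jl}∂_l h^{ki} )`. -/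
def LamUp (h : Eu 3 → Matrix (Fin 3) (Fin 3) ℝ) (k i j : Fin 3) (x : Eu 3) : ℝ :=
  (1 / 2) * ∑ l, ((h x)⁻¹ k l * pd l (fun y => (h y)⁻¹ i j) x
      - (h x)⁻¹ i l * pd l (fun y => (h y)⁻¹ k j) x
      - (h x)⁻¹ j l * pd l (fun y => (h y)⁻¹ k i) x)

/-- The inner product `⟨f,g⟩_h = ∫_M (∑ᵢ conj fᵢ gᵢ) √det h` on the wrapped product `M`. -/
def innM (Ω : Set (Eu 2)) (h : Eu 3 → Matrix (Fin 3) (Fin 3) ℝ)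
    (f g : Eu 3 → Fin 4 → ℂ) : ℂ :=
  ∫ x in Mset Ω, (∑ i, (starRingEnd ℂ) (f x i) * g x i) * ((sdet h x : ℝ) : ℂ)

/-- `|∇_h u|² = h^{ij} ∂_i ū ∂_j u` (summed over the `ℂ⁴` components). -/
def gradhSq (h : Eu 3 → Matrix (Fin 3) (Fin 3) ℝ) (u : Eu 3 → Fin 4 → ℂ) (x : Eu 3) : ℝ :=
  ∑ i, ∑ j, (h x)⁻¹ i j *
    ∑ c, ((starRingEnd ℂ) (pd i (fun y => u y c) x) * pd j (fun y => u y c) x).re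

open scoped ContDiff Topology ComplexConjugate

/-- `f` is smooth with compact support contained in `U`. -/
def IsTest {n : ℕ} {F : Type*} [NormedAddCommGroup F] [NormedSpace ℝ F]
    (U : Set (Eu n)) (f : Eu n → F) : Prop :=
  ContDiff ℝ ∞ f ∧ HasCompactSupport f ∧ tsupport f ⊆ U

section Calculus

variable {n : ℕ} {F : Type*} [NormedAddCommGroup F] [NormedSpace ℝ F]

theorem tsupport_subset_of_eq_zero {X : Type*} [TopologicalSpace X] {G : Type*} [Zero G]
    {K : Set X} (hK : IsClosed K) {f : X → G} (hf : ∀ x, x ∉ K → f x = 0) : tsupport f ⊆ K := by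
  refine closure_minimal (fun x hx => ?_) hK
  by_contra h
  exact hx (hf x h)

theorem IsTest.of_eq_zero {U K : Set (Eu n)} (hU : IsOpen U) (hK : IsCompact K) (hKU : K ⊆ U)
    {f : Eu n → F} (hf : ContDiffOn ℝ ∞ f U) (h0 : ∀ x, x ∉ K → f x = 0) : IsTest U f := by
  have hs := tsupport_subset_of_eq_zero hK.isClosed h0
  refine ⟨contDiff_iff_contDiffAt.2 fun x => ?_,
    HasCompactSupport.intro hK h0, hs.trans hKU⟩
  by_cases hx : x ∈ K
  · exact hf.contDiffAt (hU.mem_nhds (hKU hx))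
  · have : f =ᶠ[𝓝 x] fun _ => 0 := by
      filter_upwards [hK.isClosed.isOpen_compl.mem_nhds hx] with y hy using h0 y hy
    exact contDiffAt_const.congr_of_eventuallyEq this

theorem pd_eq_zero {K : Set (Eu n)} (hK : IsClosed K) {f : Eu n → F}
    (h0 : ∀ x, x ∉ K → f x = 0) (j : Fin n) {x : Eu n} (hx : x ∉ K) : pd j f x = 0 := by
  have : f =ᶠ[𝓝 x] fun _ => 0 := by
    filter_upwards [hK.isOpen_compl.mem_nhds hx] with y hy using h0 y hy
  simp [pd, this.fderiv_eq]

theorem contDiffOn_pd {U : Set (Eu n)} (hU : IsOpen U) {f : Eu n → F}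
    (hf : ContDiffOn ℝ ∞ f U) (j : Fin n) : ContDiffOn ℝ ∞ (pd j f) U := by
  have := hf.fderiv_of_isOpen (m := ∞) hU (by simp)
  exact this.clm_apply contDiffOn_const

theorem IsTest.pd {U : Set (Eu n)} (hU : IsOpen U) {f : Eu n → F} (hf : IsTest U f) (j : Fin n) :
    IsTest U (pd j f) :=
  IsTest.of_eq_zero hU hf.2.1 hf.2.2 (contDiffOn_pd hU hf.1.contDiffOn j)
    fun _ hx => pd_eq_zero (isClosed_tsupport f) (fun _ h => image_eq_zero_of_notMem_tsupport h)
      j hx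

theorem pd_congr {f g : Eu n → F} {x : Eu n} (h : f =ᶠ[𝓝 x] g) (j : Fin n) :
    pd j f x = pd j g x := by
  simp [pd, h.fderiv_eq]

theorem pd_congr_of_isOpen {U : Set (Eu n)} (hU : IsOpen U) {f g : Eu n → F}
    (h : ∀ x ∈ U, f x = g x) (j : Fin n) {x : Eu n} (hx : x ∈ U) :
    pd j f x = pd j g x :=
  pd_congr (by filter_upwards [hU.mem_nhds hx] with y hy using h y hy) j

theorem pd_mul {𝔸 : Type*} [NormedCommRing 𝔸] [NormedAlgebra ℝ 𝔸] {f g : Eu n → 𝔸} {x : Eu n}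
    (hf : DifferentiableAt ℝ f x) (hg : DifferentiableAt ℝ g x) (j : Fin n) :
    pd j (fun y => f y * g y) x = pd j f x * g x + f x * pd j g x := by
  simp only [pd]
  rw [fderiv_fun_mul hf hg]
  simp only [add_apply, smul_apply, smul_eq_mul]
  ring

theorem pd_conj {f : Eu n → ℂ} {x : Eu n} (hf : DifferentiableAt ℝ f x) (j : Fin n) :
    pd j (fun y => conj (f y)) x = conj (pd j f x) := by
  have := (Complex.conjCLE.toContinuousLinearMap.hasFDerivAt (x := f x)).comp x hf.hasFDerivAt
  simp only [pd]
  rw [show (fun y => conj (f y)) = Complex.conjCLE.toContinuousLinearMap ∘ f from rfl, this.fderiv]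
  rfl

theorem pd_ofReal {f : Eu n → ℝ} {x : Eu n} (hf : DifferentiableAt ℝ f x) (j : Fin n) :
    pd j (fun y => ((f y : ℝ) : ℂ)) x = ((pd j f x : ℝ) : ℂ) := by
  have := (Complex.ofRealCLM.hasFDerivAt (x := f x)).comp x hf.hasFDerivAt
  simp only [pd]
  rw [show (fun y => ((f y : ℝ) : ℂ)) = Complex.ofRealCLM ∘ f from rfl, this.fderiv]
  rfl

theorem pd_add {f g : Eu n → F} {x : Eu n}
    (hf : DifferentiableAt ℝ f x) (hg : DifferentiableAt ℝ g x) (j : Fin n) :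
    pd j (fun y => f y + g y) x = pd j f x + pd j g x := by
  simp only [pd]
  rw [fderiv_fun_add hf hg]
  rfl

theorem integral_pd_eq_zero {f : Eu n → ℂ} {U : Set (Eu n)} (hU : IsOpen U) (hf : IsTest U f)
    (j : Fin n) : ∫ x, pd j f x = 0 := by
  have h := integral_smul_fderiv_eq_neg_fderiv_smul_of_integrable (𝕜 := ℝ)
    (μ := (volume : Measure (Eu n)))
    (f := fun _ => (1 : ℝ)) (g := f) (v := EuclideanSpace.single j 1) (by simp) ?_ ?_
    (by fun_prop) (fun x _ => (hf.1.differentiable (by simp)).differentiableAt)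
  · simpa [pd] using h
  · have h2 := (hf.pd hU j).1.continuous.integrable_of_hasCompactSupport (μ := volume)
      (hf.pd hU j).2.1
    simp only [one_smul]
    exact h2
  · simpa using (hf.1.continuous.integrable_of_hasCompactSupport hf.2.1)

theorem integrableOn_of_compact {G : Type*} [NormedAddCommGroup G] {U K : Set (Eu n)}
    {f : Eu n → G} (hU : IsOpen U)
    (hK : IsCompact K) (hKU : K ⊆ U) (hf : ContinuousOn f U) (h0 : ∀ x ∈ U, x ∉ K → f x = 0) :
    IntegrableOn f U :=
  ((hf.mono hKU).integrableOn_compact hK).of_forall_sdiff_eq_zero hU.measurableSet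
    fun x hx => h0 x hx.1 hx.2

theorem setIntegral_eq_compact {U K : Set (Eu n)} {f : Eu n → F} (hU : IsOpen U)
    (hKU : K ⊆ U) (h0 : ∀ x ∈ U, x ∉ K → f x = 0) :
    ∫ x in U, f x = ∫ x in K, f x :=
  setIntegral_eq_of_subset_of_forall_sdiff_eq_zero hU.measurableSet hKU
    fun x hx => h0 x hx.1 hx.2

/-- A continuous nonnegative function on an open set with vanishing integral vanishes. -/
theorem eq_zero_of_setIntegral_eq_zero {U : Set (Eu n)} {f : Eu n → ℝ} (hU : IsOpen U)
    (hf : ContinuousOn f U) (h0 : ∀ x ∈ U, 0 ≤ f x) (hi : IntegrableOn f U)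
    (h : ∫ x in U, f x = 0) : ∀ x ∈ U, f x = 0 := by
  have h1 : 0 ≤ᵐ[volume.restrict U] f :=
    (ae_restrict_iff' hU.measurableSet).2 (Filter.Eventually.of_forall h0)
  have h2 := (setIntegral_eq_zero_iff_of_nonneg_ae h1 hi).1 h
  exact Measure.eqOn_open_of_ae_eq h2 hU hf continuousOn_const

/-- Differentiation under the integral sign over a compact set. -/
theorem hasDerivAt_setIntegral_compact {𝕜 : Type*} [RCLike 𝕜] {K : Set (Eu n)} (hK : IsCompact K)
    {w : Eu n → 𝕜} (hw : IntegrableOn w K) {f f' : ℝ → Eu n → 𝕜} {t₀ δ : ℝ} (hδ : 0 < δ)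
    (hd : ∀ t ∈ Icc (t₀ - δ) (t₀ + δ), ∀ x ∈ K, HasDerivAt (fun s => f s x) (f' t x) t)
    (hc : ∀ t ∈ Icc (t₀ - δ) (t₀ + δ), ContinuousOn (f t) K)
    (hc' : ContinuousOn (fun p : ℝ × Eu n => f' p.1 p.2) (Icc (t₀ - δ) (t₀ + δ) ×ˢ K)) :
    HasDerivAt (fun t => ∫ x in K, f t x * w x) (∫ x in K, f' t₀ x * w x) t₀ := by
  obtain ⟨C, hC⟩ := (isCompact_Icc.prod hK).exists_bound_of_continuousOn hc'
  have h0 : t₀ ∈ Icc (t₀ - δ) (t₀ + δ) := ⟨by linarith, by linarith⟩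
  have hm := hK.measurableSet
  refine (hasDerivAt_integral_of_dominated_loc_of_deriv_le (𝕜 := ℝ)
    (F' := fun t x => f' t x * w x) (bound := fun x => C * ‖w x‖)
    (Icc_mem_nhds (by linarith : t₀ - δ < t₀) (by linarith : t₀ < t₀ + δ)) ?_ ?_ ?_ ?_ ?_ ?_).2
  · filter_upwards [Icc_mem_nhds (by linarith : t₀ - δ < t₀) (by linarith : t₀ < t₀ + δ)] with t ht
    exact ((hc t ht).aestronglyMeasurable hm).mul hw.aestronglyMeasurable
  · obtain ⟨D, hD⟩ := hK.exists_bound_of_continuousOn (hc t₀ h0)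
    exact hw.bdd_mul (c := D) ((hc t₀ h0).aestronglyMeasurable hm)
      ((ae_restrict_iff' hm).2 (Filter.Eventually.of_forall hD))
  · have : ContinuousOn (f' t₀) K :=
      hc'.comp (f := fun x => (t₀, x)) (by fun_prop) (fun x hx => ⟨h0, hx⟩)
    exact (this.aestronglyMeasurable hm).mul hw.aestronglyMeasurable
  · refine (ae_restrict_iff' hm).2 (Filter.Eventually.of_forall fun x hx t ht => ?_)
    rw [norm_mul]
    exact mul_le_mul_of_nonneg_right (hC (t, x) ⟨ht, hx⟩) (norm_nonneg _)
  · exact (hw.norm.const_mul C)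
  · refine (ae_restrict_iff' hm).2 (Filter.Eventually.of_forall fun x hx t ht => ?_)
    exact (hd t ht x hx).mul_const (w x)

theorem continuousWithinAt_setIntegral_compact {K : Set (Eu n)} (hK : IsCompact K)
    {w : Eu n → ℝ} (hw : IntegrableOn w K) {f : ℝ → Eu n → ℝ} {J : Set ℝ}
    (hJ : IsCompact J) {t₀ : ℝ}
    (ht₀ : t₀ ∈ J)
    (hc : ContinuousOn (fun p : ℝ × Eu n => f p.1 p.2) (J ×ˢ K)) :
    ContinuousWithinAt (fun t => ∫ x in K, f t x * w x) J t₀ := by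
  obtain ⟨C, hC⟩ := (hJ.prod hK).exists_bound_of_continuousOn hc
  have hm := hK.measurableSet
  refine continuousWithinAt_of_dominated (bound := fun x => C * ‖w x‖) ?_ ?_ ?_ ?_
  · filter_upwards [self_mem_nhdsWithin] with t ht
    have : ContinuousOn (f t) K :=
      hc.comp (f := fun x => (t, x)) (by fun_prop) (fun x hx => ⟨ht, hx⟩)
    exact (this.aestronglyMeasurable hm).mul hw.aestronglyMeasurable
  · filter_upwards [self_mem_nhdsWithin] with t ht
    refine (ae_restrict_iff' hm).2 (Filter.Eventually.of_forall fun x hx => ?_)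
    rw [norm_mul]
    exact mul_le_mul_of_nonneg_right (hC (t, x) ⟨ht, hx⟩) (norm_nonneg _)
  · exact hw.norm.const_mul C
  · refine (ae_restrict_iff' hm).2 (Filter.Eventually.of_forall fun x hx => ?_)
    have : ContinuousOn (fun t => f t x) J :=
      hc.comp (f := fun t => (t, x)) (by fun_prop) (fun t ht => ⟨ht, hx⟩)
    exact (this t₀ ht₀).mul continuousWithinAt_const

end Calculus

section Laplacian

variable {n : ℕ} {U : Set (Eu n)} {h : Eu n → Matrix (Fin n) (Fin n) ℝ}

theorem contDiffOn_det (hs : ∀ i j, ContDiffOn ℝ ∞ (fun x => h x i j) U) :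
    ContDiffOn ℝ ∞ (fun x => (h x).det) U := by
  simp only [Matrix.det_apply']
  exact ContDiffOn.sum fun σ _ => contDiffOn_const.mul (contDiffOn_prod fun i _ => hs _ _)

theorem contDiffOn_inv_entry (hs : ∀ i j, ContDiffOn ℝ ∞ (fun x => h x i j) U)
    (hp : ∀ x ∈ U, (h x).PosDef) (i j : Fin n) : ContDiffOn ℝ ∞ (fun x => (h x)⁻¹ i j) U := by
  have h1 : ContDiffOn ℝ ∞ (fun x => (h x).adjugate i j) U := by
    simp only [Matrix.adjugate_apply]
    refine contDiffOn_det fun a b => ?_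
    by_cases hab : a = j
    · subst hab
      simp only [Matrix.updateRow_self]
      exact contDiffOn_const
    · simp only [Matrix.updateRow_ne hab]
      exact hs a b
  have h2 := ((contDiffOn_det hs).inv fun x hx => (hp x hx).det_pos.ne').mul h1
  refine h2.congr fun x _ => ?_
  simp [Matrix.inv_def]

theorem contDiffOn_sdet (hs : ∀ i j, ContDiffOn ℝ ∞ (fun x => h x i j) U)
    (hp : ∀ x ∈ U, (h x).PosDef) : ContDiffOn ℝ ∞ (sdet h) U :=
  (contDiffOn_det hs).sqrt fun x hx => (hp x hx).det_pos.ne'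

theorem sdet_pos {x : Eu n} (hp : (h x).PosDef) : 0 < sdet h x := Real.sqrt_pos.2 hp.det_pos

theorem contDiffOn_ofReal {f : Eu n → ℝ} (hf : ContDiffOn ℝ ∞ f U) :
    ContDiffOn ℝ ∞ (fun x => ((f x : ℝ) : ℂ)) U := Complex.ofRealCLM.contDiff.comp_contDiffOn hf

theorem contDiffOn_conj {f : Eu n → ℂ} (hf : ContDiffOn ℝ ∞ f U) :
    ContDiffOn ℝ ∞ (fun x => conj (f x)) U :=
  Complex.conjCLE.contDiff.comp_contDiffOn hf

theorem differentiableAt_conj {f : Eu n → ℂ} {x : Eu n} (hf : DifferentiableAt ℝ f x) :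
    DifferentiableAt ℝ (fun y => conj (f y)) x := Complex.conjCLE.differentiableAt.comp x hf

theorem contDiffOn_flux (hU : IsOpen U) (hs : ∀ i j, ContDiffOn ℝ ∞ (fun x => h x i j) U)
    (hp : ∀ x ∈ U, (h x).PosDef) {ψ : Eu n → ℂ} (hψ : ContDiffOn ℝ ∞ ψ U) (j : Fin n) :
    ContDiffOn ℝ ∞ (fun y => ((sdet h y : ℝ) : ℂ) *
      ∑ k, (((h y)⁻¹ j k : ℝ) : ℂ) * pd k ψ y) U :=
  (contDiffOn_ofReal (contDiffOn_sdet hs hp)).mul (ContDiffOn.sum fun k _ =>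
    (contDiffOn_ofReal (contDiffOn_inv_entry hs hp j k)).mul (contDiffOn_pd hU hψ k))

theorem contDiffOn_lapC (hU : IsOpen U) (hs : ∀ i j, ContDiffOn ℝ ∞ (fun x => h x i j) U)
    (hp : ∀ x ∈ U, (h x).PosDef) {ψ : Eu n → ℂ} (hψ : ContDiffOn ℝ ∞ ψ U) :
    ContDiffOn ℝ ∞ (lapC h ψ) U := by
  refine ContDiffOn.mul ((contDiffOn_ofReal (contDiffOn_sdet hs hp)).inv fun x hx => ?_)
    (ContDiffOn.sum fun j _ => contDiffOn_pd hU (contDiffOn_flux hU hs hp hψ j) j)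
  exact_mod_cast (sdet_pos (hp x hx)).ne.symm

/-- Green's formula for the Laplace–Beltrami operator. -/
theorem integral_conj_mul_lapC (hU : IsOpen U)
    (hs : ∀ i j, ContDiffOn ℝ ∞ (fun x => h x i j) U)
    (hp : ∀ x ∈ U, (h x).PosDef) {χ ψ : Eu n → ℂ} (hχ : IsTest U χ) (hψ : IsTest U ψ) :
    ∫ x in U, conj (χ x) * lapC h ψ x * ((sdet h x : ℝ) : ℂ) =
      -∫ x in U, (∑ j, ∑ k, (((h x)⁻¹ j k : ℝ) : ℂ) * (conj (pd j χ x) * pd k ψ x))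
        * ((sdet h x : ℝ) : ℂ) := by
  set V : Fin n → Eu n → ℂ := fun j y => ((sdet h y : ℝ) : ℂ) *
      ∑ k, (((h y)⁻¹ j k : ℝ) : ℂ) * pd k ψ y with hV
  have hVs : ∀ j, ContDiffOn ℝ ∞ (V j) U := contDiffOn_flux hU hs hp hψ.1.contDiffOn
  have hχ0 : ∀ x, x ∉ tsupport χ → χ x = 0 := fun x hx => image_eq_zero_of_notMem_tsupport hx
  have hdχ0 : ∀ j x, x ∉ tsupport χ → pd j χ x = 0 :=
    fun j x hx => pd_eq_zero (isClosed_tsupport χ) hχ0 j hx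
  have hG : ∀ j, IsTest U (fun y => conj (χ y) * V j y) := fun j =>
    IsTest.of_eq_zero hU hχ.2.1 hχ.2.2
      ((contDiffOn_conj hχ.1.contDiffOn).mul (hVs j)) fun x hx => by simp [hχ0 x hx]
  have hGU : ∀ j, ∫ x in U, pd j (fun y => conj (χ y) * V j y) x = 0 := fun j => by
    rw [setIntegral_eq_integral_of_forall_compl_eq_zero, integral_pd_eq_zero hU (hG j)]
    intro x hx
    exact image_eq_zero_of_notMem_tsupport fun h' => hx (((hG j).pd hU j).2.2 h')
  have hint : ∀ j, IntegrableOn (pd j (fun y => conj (χ y) * V j y)) U := fun j =>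
    (((hG j).pd hU j).1.continuous.integrable_of_hasCompactSupport
      ((hG j).pd hU j).2.1).integrableOn
  have hsum : ∫ x in U, ∑ j, pd j (fun y => conj (χ y) * V j y) x = 0 := by
    rw [integral_finsetSum _ fun j _ => hint j]
    simp [hGU]
  rw [eq_neg_iff_add_eq_zero, ← integral_add, ← hsum]
  · refine setIntegral_congr_fun hU.measurableSet fun x hx => ?_
    have hne : ((sdet h x : ℝ) : ℂ) ≠ 0 := by exact_mod_cast (sdet_pos (hp x hx)).ne'
    have hdiff : ∀ j, DifferentiableAt ℝ (V j) x := fun j =>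
      ((hVs j).contDiffAt (hU.mem_nhds hx)).differentiableAt (by simp)
    have hdχ : DifferentiableAt ℝ χ x := hχ.1.contDiffAt.differentiableAt (by simp)
    have e : ∀ j, pd j (fun y => conj (χ y) * V j y) x =
        conj (pd j χ x) * V j x + conj (χ x) * pd j (V j) x := fun j => by
      rw [pd_mul (differentiableAt_conj hdχ) (hdiff j), pd_conj hdχ]
    simp only [e, Finset.sum_add_distrib]
    rw [add_comm]
    congr 1
    · simp only [hV, Finset.sum_mul, Finset.mul_sum]
      refine Finset.sum_congr rfl fun j _ => Finset.sum_congr rfl fun k _ => ?_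
      ring
    · simp only [lapC]
      rw [← Finset.mul_sum]
      field_simp
      rfl
  · refine integrableOn_of_compact hU hχ.2.1 hχ.2.2 ?_ (fun x _ hx => by simp [hχ0 x hx])
    exact (((contDiffOn_conj hχ.1.contDiffOn).mul
      (contDiffOn_lapC hU hs hp hψ.1.contDiffOn)).mul
      (contDiffOn_ofReal (contDiffOn_sdet hs hp))).continuousOn
  · refine integrableOn_of_compact hU hχ.2.1 hχ.2.2 ?_ (fun x _ hx => by simp [hdχ0 _ x hx])
    refine ContDiffOn.continuousOn (𝕜 := ℝ) (n := ∞)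
      (ContDiffOn.mul (ContDiffOn.sum fun j _ => ContDiffOn.sum fun k _ =>
      (contDiffOn_ofReal (contDiffOn_inv_entry hs hp j k)).mul ?_)
      (contDiffOn_ofReal (contDiffOn_sdet hs hp)))
    exact (contDiffOn_conj (contDiffOn_pd hU hχ.1.contDiffOn j)).mul
      (contDiffOn_pd hU hψ.1.contDiffOn k)

end Laplacian

section WrappedGeometry

/-- `pr32` as a continuous linear map. -/
def prL : Eu 3 →L[ℝ] Eu 2 :=
  ((EuclideanSpace.equiv (Fin 2) ℝ).symm : (Fin 2 → ℝ) →L[ℝ] Eu 2).comp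
    (ContinuousLinearMap.pi fun i : Fin 2 => (EuclideanSpace.proj i.succ : Eu 3 →L[ℝ] ℝ))

theorem prL_apply (x : Eu 3) : prL x = pr32 x := rfl

theorem pr32_apply (x : Eu 3) (i : Fin 2) : pr32 x i = x i.succ := rfl

theorem continuous_pr32 : Continuous pr32 := prL.continuous

theorem prL_single_zero : prL (EuclideanSpace.single 0 1) = 0 := by
  ext i
  simp [prL_apply, pr32_apply]

theorem prL_single_succ (i : Fin 2) :
    prL (EuclideanSpace.single i.succ 1) = EuclideanSpace.single i 1 := by
  ext j
  simp [prL_apply, pr32_apply]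

theorem isOpen_Mset {Ω : Set (Eu 2)} (hΩ : IsOpen Ω) : IsOpen (Mset Ω) :=
  (isOpen_lt continuous_const (EuclideanSpace.proj 0 : Eu 3 →L[ℝ] ℝ).continuous).inter
    (hΩ.preimage continuous_pr32)

section

variable {F : Type*} [NormedAddCommGroup F] [NormedSpace ℝ F]

theorem pd_zero_comp_pr32 {f : Eu 2 → F} {x : Eu 3} (hf : DifferentiableAt ℝ f (pr32 x)) :
    pd 0 (fun y => f (pr32 y)) x = 0 := by
  have : HasFDerivAt (fun y => f (pr32 y)) ((fderiv ℝ f (pr32 x)).comp prL) x :=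
    HasFDerivAt.comp x hf.hasFDerivAt prL.hasFDerivAt
  simp [pd, this.fderiv, prL_single_zero]

theorem pd_succ_comp_pr32 {f : Eu 2 → F} {x : Eu 3} (hf : DifferentiableAt ℝ f (pr32 x))
    (i : Fin 2) : pd i.succ (fun y => f (pr32 y)) x = pd i f (pr32 x) := by
  have : HasFDerivAt (fun y => f (pr32 y)) ((fderiv ℝ f (pr32 x)).comp prL) x :=
    HasFDerivAt.comp x hf.hasFDerivAt prL.hasFDerivAt
  simp only [pd, this.fderiv, ContinuousLinearMap.comp_apply]
  exact congrArg _ (prL_single_succ i)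

theorem differentiableAt_comp_pr32 {f : Eu 2 → F} {x : Eu 3}
    (hf : DifferentiableAt ℝ f (pr32 x)) : DifferentiableAt ℝ (fun y => f (pr32 y)) x :=
  DifferentiableAt.comp x hf prL.differentiableAt

theorem contDiffOn_comp_pr32 {Ω : Set (Eu 2)} {f : Eu 2 → F} (hf : ContDiffOn ℝ ∞ f Ω) :
    ContDiffOn ℝ ∞ (fun y => f (pr32 y)) (Mset Ω) :=
  hf.comp (prL.contDiff.contDiffOn) fun _ hx => hx.2

end

theorem hasFDerivAt_comp_coord {f : ℝ → ℝ} {f' : ℝ} {x : Eu 3} (hf : HasDerivAt f f' (x 0)) :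
    HasFDerivAt (fun y : Eu 3 => f (y 0))
      (f' • (EuclideanSpace.proj 0 : Eu 3 →L[ℝ] ℝ)) x :=
  hf.comp_hasFDerivAt x (EuclideanSpace.proj 0 : Eu 3 →L[ℝ] ℝ).hasFDerivAt

theorem pd_zero_comp_coord {f : ℝ → ℝ} {f' : ℝ} {x : Eu 3} (hf : HasDerivAt f f' (x 0)) :
    pd 0 (fun y : Eu 3 => f (y 0)) x = f' := by
  simp [pd, (hasFDerivAt_comp_coord hf).fderiv]

theorem pd_succ_comp_coord {f : ℝ → ℝ} {f' : ℝ} {x : Eu 3} (hf : HasDerivAt f f' (x 0))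
    (i : Fin 2) : pd i.succ (fun y : Eu 3 => f (y 0)) x = 0 := by
  simp [pd, (hasFDerivAt_comp_coord hf).fderiv]

theorem hasDerivAt_exp_mul (c r : ℝ) :
    HasDerivAt (fun s => Real.exp (c * s)) (c * Real.exp (c * r)) r := by
  simpa [mul_comm] using ((hasDerivAt_id r).const_mul c).exp

/-- The block matrix `diag(1, d b)`. -/
def wrapM (d : ℝ) (b : Matrix (Fin 2) (Fin 2) ℝ) : Matrix (Fin 3) (Fin 3) ℝ :=
  Matrix.of fun i j => Fin.cases (Fin.cases 1 (fun _ => 0) j)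
    (fun i' => Fin.cases 0 (fun j' => d * b i' j') j) i

@[simp] theorem wrapM_zero_zero (d b) : wrapM d b 0 0 = 1 := rfl
@[simp] theorem wrapM_zero_succ (d b) (j : Fin 2) : wrapM d b 0 j.succ = 0 := rfl
@[simp] theorem wrapM_succ_zero (d b) (i : Fin 2) : wrapM d b i.succ 0 = 0 := rfl
@[simp] theorem wrapM_succ_succ (d b) (i j : Fin 2) : wrapM d b i.succ j.succ = d * b i j := rfl

theorem wrapM_inv {d : ℝ} (hd : d ≠ 0) {b : Matrix (Fin 2) (Fin 2) ℝ} (hb : b.det ≠ 0) :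
    (wrapM d b)⁻¹ = wrapM d⁻¹ b⁻¹ := by
  refine Matrix.inv_eq_left_inv ?_
  have hbb := Matrix.nonsing_inv_mul b (isUnit_iff_ne_zero.2 hb)
  ext i j
  rw [Matrix.mul_apply, Fin.sum_univ_succ]
  refine Fin.cases ?_ (fun i => ?_) i <;> refine Fin.cases ?_ (fun j => ?_) j
  · simp
  · simp [(Fin.succ_ne_zero j).symm]
  · simp
  · have := congrFun (congrFun hbb i) j
    rw [Matrix.mul_apply] at this
    simp only [wrapM_succ_zero, wrapM_succ_succ, zero_mul, zero_add, Matrix.one_apply,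
      Fin.succ_inj] at this ⊢
    rw [← this]
    refine Finset.sum_congr rfl fun k _ => ?_
    field_simp

theorem wrapM_det (d : ℝ) (b : Matrix (Fin 2) (Fin 2) ℝ) :
    (wrapM d b).det = d ^ 2 * b.det := by
  rw [Matrix.det_succ_row_zero, Fin.sum_univ_succ]
  have : (wrapM d b).submatrix Fin.succ Fin.succ = d • b := by
    ext i j
    simp [Matrix.smul_apply]
  simp [this]

/-- The point of `ℝ³` with first coordinate `r` and remaining coordinates `y`. -/
def emb (r : ℝ) (y : Eu 2) : Eu 3 := (EuclideanSpace.equiv (Fin 3) ℝ).symm (Fin.cons r y)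

@[simp] theorem emb_zero (r : ℝ) (y : Eu 2) : emb r y 0 = r := rfl
@[simp] theorem emb_succ (r : ℝ) (y : Eu 2) (i : Fin 2) : emb r y i.succ = y i := rfl

@[simp] theorem pr32_emb (r : ℝ) (y : Eu 2) : pr32 (emb r y) = y := by
  ext i
  rw [pr32_apply, emb_succ]

@[simp] theorem emb_pr32 (x : Eu 3) : emb (x 0) (pr32 x) = x := by
  ext i
  refine Fin.cases rfl (fun i => rfl) i

theorem emb_mem_Mset {Ω : Set (Eu 2)} {r : ℝ} {y : Eu 2} :
    emb r y ∈ Mset Ω ↔ 0 < r ∧ y ∈ Ω := by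
  simp [Mset]

theorem contDiff_emb : ContDiff ℝ ∞ (fun p : ℝ × Eu 2 => emb p.1 p.2) := by
  rw [contDiff_euclidean]
  intro i
  refine Fin.cases ?_ (fun i => ?_) i
  · exact contDiff_fst
  · exact (EuclideanSpace.proj i : Eu 2 →L[ℝ] ℝ).contDiff.comp contDiff_snd

theorem hasFDerivAt_emb (r : ℝ) (y : Eu 2) :
    ∃ L : Eu 2 →L[ℝ] Eu 3, HasFDerivAt (emb r) L y ∧
      ∀ i, L (EuclideanSpace.single i 1) = EuclideanSpace.single i.succ 1 := by
  refine ⟨((EuclideanSpace.equiv (Fin 3) ℝ).symm : (Fin 3 → ℝ) →L[ℝ] Eu 3).comp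
    (ContinuousLinearMap.pi (Fin.cons 0 fun i : Fin 2 =>
      (EuclideanSpace.proj i : Eu 2 →L[ℝ] ℝ))), ?_, fun i => ?_⟩
  · rw [← hasFDerivWithinAt_univ, hasFDerivWithinAt_euclidean]
    intro i
    refine Fin.cases ?_ (fun i => ?_) i
    · exact (hasFDerivAt_const r y).hasFDerivWithinAt
    · exact (EuclideanSpace.proj i : Eu 2 →L[ℝ] ℝ).hasFDerivWithinAt
  · ext j
    refine Fin.cases ?_ (fun j => ?_) j
    · simp
    · simp

section

variable {F : Type*} [NormedAddCommGroup F] [NormedSpace ℝ F]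

theorem pd_comp_emb {f : Eu 3 → F} {r : ℝ} {y : Eu 2} (hf : DifferentiableAt ℝ f (emb r y))
    (i : Fin 2) : pd i (fun z => f (emb r z)) y = pd i.succ f (emb r y) := by
  obtain ⟨L, hL, hL'⟩ := hasFDerivAt_emb r y
  have : HasFDerivAt (fun z => f (emb r z)) ((fderiv ℝ f (emb r y)).comp L) y :=
    HasFDerivAt.comp y hf.hasFDerivAt hL
  simp only [pd, this.fderiv, ContinuousLinearMap.comp_apply, hL']

theorem hasDerivAt_comp_emb {f : Eu 3 → F} {r : ℝ} {y : Eu 2}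
    (hf : DifferentiableAt ℝ f (emb r y)) :
    HasDerivAt (fun s => f (emb s y)) (pd 0 f (emb r y)) r := by
  have h1 : HasDerivAt (fun s => emb s y) (EuclideanSpace.single 0 1) r := by
    have h2 : ∀ s, emb s y = emb 0 y + s • (EuclideanSpace.single 0 1 : Eu 3) := fun s => by
      ext i
      refine Fin.cases ?_ (fun i => ?_) i <;> simp
    rw [funext h2]
    simpa using ((hasDerivAt_id r).smul_const (EuclideanSpace.single 0 1 : Eu 3)).const_add
      (emb 0 y)
  exact hf.hasFDerivAt.comp_hasDerivAt r h1

end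

variable {Ω : Set (Eu 2)} {β : Eu 2 → Matrix (Fin 2) (Fin 2) ℝ}
  {h : Eu 3 → Matrix (Fin 3) (Fin 3) ℝ}

theorem WrapMetric.eq_wrapM (hw : WrapMetric Ω β (fun r => Real.exp (r / 2)) h) {x : Eu 3}
    (hx : x ∈ Mset Ω) : h x = wrapM (Real.exp (x 0 / 2)) (β (pr32 x)) := by
  obtain ⟨h0, h1, h2⟩ := hw x hx
  ext i j
  refine Fin.cases ?_ (fun i => ?_) i <;> refine Fin.cases ?_ (fun j => ?_) j
  · exact h0
  · exact (h1 j).1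
  · exact (h1 i).2
  · exact h2 i j

theorem WrapMetric.inv_eq (hw : WrapMetric Ω β (fun r => Real.exp (r / 2)) h)
    (hβp : ∀ y ∈ Ω, (β y).PosDef) {x : Eu 3} (hx : x ∈ Mset Ω) :
    (h x)⁻¹ = wrapM (Real.exp (x 0 / 2))⁻¹ (β (pr32 x))⁻¹ := by
  rw [hw.eq_wrapM hx, wrapM_inv (Real.exp_pos _).ne' (hβp _ hx.2).det_pos.ne']

theorem WrapMetric.sdet_eq (hw : WrapMetric Ω β (fun r => Real.exp (r / 2)) h) {x : Eu 3}
    (hx : x ∈ Mset Ω) : sdet h x = Real.exp (x 0 / 2) * sdet β (pr32 x) := by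
  rw [sdet, sdet, hw.eq_wrapM hx, wrapM_det, Real.sqrt_mul (by positivity),
    Real.sqrt_sq (by positivity)]

theorem contDiff_coord : ContDiff ℝ ∞ fun x : Eu 3 => x 0 :=
  (EuclideanSpace.proj 0 : Eu 3 →L[ℝ] ℝ).contDiff

theorem contDiff_exp_coord : ContDiff ℝ ∞ fun x : Eu 3 => Real.exp (x 0 / 2) :=
  (contDiff_coord.div_const 2).exp

theorem WrapMetric.contDiffOn (hw : WrapMetric Ω β (fun r => Real.exp (r / 2)) h)
    (hβs : ∀ i j, ContDiffOn ℝ ∞ (fun y => β y i j) Ω) (i j : Fin 3) :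
    ContDiffOn ℝ ∞ (fun x => h x i j) (Mset Ω) := by
  have key : ContDiffOn ℝ ∞ (fun x => wrapM (Real.exp (x 0 / 2)) (β (pr32 x)) i j) (Mset Ω) := by
    refine Fin.cases ?_ (fun i => ?_) i <;> refine Fin.cases ?_ (fun j => ?_) j
    · exact contDiffOn_const
    · exact contDiffOn_const
    · exact contDiffOn_const
    · exact contDiff_exp_coord.contDiffOn.mul (contDiffOn_comp_pr32 (hβs i j))
  exact key.congr fun x hx => by rw [hw.eq_wrapM hx]

theorem hasDerivAt_exp_half (r : ℝ) :
    HasDerivAt (fun s => Real.exp (s / 2)) (1 / 2 * Real.exp (r / 2)) r := by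
  simpa [mul_comm, div_eq_mul_inv] using ((hasDerivAt_id r).div_const 2).exp

/-- The Laplacian of the wrapped metric. -/
theorem WrapMetric.lapC_eq (hw : WrapMetric Ω β (fun r => Real.exp (r / 2)) h) (hΩ : IsOpen Ω)
    (hβs : ∀ i j, ContDiffOn ℝ ∞ (fun y => β y i j) Ω) (hβp : ∀ y ∈ Ω, (β y).PosDef)
    (hp : ∀ x, (h x).PosDef) {f : Eu 3 → ℂ} (hf : ContDiffOn ℝ ∞ f (Mset Ω)) {x : Eu 3}
    (hx : x ∈ Mset Ω) :
    lapC h f x = pd 0 (pd 0 f) x + 1 / 2 * pd 0 f x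
      + ((Real.exp (x 0 / 2) : ℝ) : ℂ)⁻¹ * lapC β (fun y => f (emb (x 0) y)) (pr32 x) := by
  have hM := isOpen_Mset hΩ
  have hd : ∀ {g : Eu 3 → ℂ}, ContDiffOn ℝ ∞ g (Mset Ω) → ∀ z ∈ Mset Ω, DifferentiableAt ℝ g z :=
    fun hg z hz => (hg.contDiffAt (hM.mem_nhds hz)).differentiableAt (by simp)
  have hsβ := contDiffOn_sdet hβs hβp
  have h0 : pd 0 (fun y => ((sdet h y : ℝ) : ℂ) *
        ∑ k, (((h y)⁻¹ 0 k : ℝ) : ℂ) * pd k f y) x =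
      ((Real.exp (x 0 / 2) * sdet β (pr32 x) : ℝ) : ℂ) *
        (pd 0 (pd 0 f) x + 1 / 2 * pd 0 f x) := by
    have e1 : ∀ y ∈ Mset Ω, ((sdet h y : ℝ) : ℂ) * ∑ k, (((h y)⁻¹ 0 k : ℝ) : ℂ) * pd k f y =
        ((Real.exp (y 0 / 2) * sdet β (pr32 y) : ℝ) : ℂ) * pd 0 f y := fun y hy => by
      rw [hw.sdet_eq hy, hw.inv_eq hβp hy, Fin.sum_univ_succ]
      simp
    have hr : DifferentiableAt ℝ (fun y : Eu 3 => sdet β (pr32 y)) x :=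
      differentiableAt_comp_pr32
        ((hsβ.contDiffAt (hΩ.mem_nhds hx.2)).differentiableAt (by simp))
    have he : DifferentiableAt ℝ (fun y : Eu 3 => Real.exp (y 0 / 2)) x :=
      contDiff_exp_coord.contDiffAt.differentiableAt (by simp)
    have hm : DifferentiableAt ℝ (fun y : Eu 3 => Real.exp (y 0 / 2) * sdet β (pr32 y)) x :=
      he.mul hr
    rw [pd_congr_of_isOpen hM e1 0 hx, pd_mul (f := fun y : Eu 3 =>
      ((Real.exp (y 0 / 2) * sdet β (pr32 y) : ℝ) : ℂ))
      (Complex.ofRealCLM.differentiableAt.comp x hm)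
      (hd (contDiffOn_pd hM hf 0) x hx), pd_ofReal hm, pd_mul he hr,
      pd_zero_comp_pr32 ((hsβ.contDiffAt (hΩ.mem_nhds hx.2)).differentiableAt (by simp)),
      pd_zero_comp_coord (hasDerivAt_exp_half (x 0))]
    push_cast
    ring
  have h1 : ∀ j : Fin 2, pd j.succ (fun y => ((sdet h y : ℝ) : ℂ) *
        ∑ k, (((h y)⁻¹ j.succ k : ℝ) : ℂ) * pd k f y) x =
      pd j (fun y => ((sdet β y : ℝ) : ℂ) *
        ∑ k, (((β y)⁻¹ j k : ℝ) : ℂ) * pd k (fun y => f (emb (x 0) y)) y) (pr32 x) := fun j => by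
    have hfl := contDiffOn_flux hM (hw.contDiffOn hβs)
      (fun x _ => hp x) hf j.succ
    have := pd_comp_emb (r := x 0) (y := pr32 x) (hd hfl _ (by simpa using hx)) j
    rw [emb_pr32] at this
    rw [← this]
    refine pd_congr_of_isOpen hΩ (fun y hy => ?_) j hx.2
    have hy' : emb (x 0) y ∈ Mset Ω := emb_mem_Mset.2 ⟨hx.1, hy⟩
    rw [hw.sdet_eq hy', hw.inv_eq hβp hy', Fin.sum_univ_succ, Finset.mul_sum]
    simp only [wrapM_succ_zero, wrapM_succ_succ, emb_zero, pr32_emb]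
    simp only [Complex.ofReal_zero, zero_mul, zero_add, Finset.mul_sum]
    refine Finset.sum_congr rfl fun k _ => ?_
    rw [pd_comp_emb (hd hf _ hy')]
    have : ((Real.exp (x 0 / 2) : ℝ) : ℂ) ≠ 0 := by exact_mod_cast (Real.exp_pos _).ne'
    push_cast at this ⊢
    field_simp
  rw [lapC, Fin.sum_univ_succ, h0, hw.sdet_eq hx, lapC]
  simp only [h1]
  have a1 : ((Real.exp (x 0 / 2) : ℝ) : ℂ) ≠ 0 := by exact_mod_cast (Real.exp_pos _).ne'
  have a2 : ((sdet β (pr32 x) : ℝ) : ℂ) ≠ 0 := by exact_mod_cast (sdet_pos (hβp _ hx.2)).ne'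
  rw [Complex.ofReal_mul]
  field_simp

end WrappedGeometry

section WrappedCurvature

variable {Ω : Set (Eu 2)} {β : Eu 2 → Matrix (Fin 2) (Fin 2) ℝ}
  {h : Eu 3 → Matrix (Fin 3) (Fin 3) ℝ}

theorem pd_const {n : ℕ} {F : Type*} [NormedAddCommGroup F] [NormedSpace ℝ F] (j : Fin n) (c : F)
    (x : Eu n) : pd j (fun _ => c) x = 0 := by
  simp [pd]

theorem contDiffOn_Chr {n : ℕ} {U : Set (Eu n)} {b : Eu n → Matrix (Fin n) (Fin n) ℝ}
    (hU : IsOpen U) (hs : ∀ i j, ContDiffOn ℝ ∞ (fun x => b x i j) U)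
    (hp : ∀ x ∈ U, (b x).PosDef) (i j k : Fin n) : ContDiffOn ℝ ∞ (Chr b i j k) U :=
  contDiffOn_const.mul (ContDiffOn.sum fun l _ => (contDiffOn_inv_entry hs hp i l).mul
    (((contDiffOn_pd hU (hs _ _) _).add (contDiffOn_pd hU (hs _ _) _)).sub
      (contDiffOn_pd hU (hs _ _) _)))

/-- The Christoffel symbols of the wrapped metric. -/
theorem WrapMetric.chr_eq (hw : WrapMetric Ω β (fun r => Real.exp (r / 2)) h) (hΩ : IsOpen Ω)
    (hβs : ∀ i j, ContDiffOn ℝ ∞ (fun y => β y i j) Ω) (hβp : ∀ y ∈ Ω, (β y).PosDef)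
    (hβt : ∀ y ∈ Ω, (β y).IsSymm) {x : Eu 3} (hx : x ∈ Mset Ω) :
    (∀ j, Chr h 0 0 j x = 0) ∧ (∀ j, Chr h 0 j 0 x = 0) ∧ (∀ i, Chr h i 0 0 x = 0) ∧
    (∀ j k : Fin 2, Chr h 0 j.succ k.succ x =
      -(1 / 4) * (Real.exp (x 0 / 2) * β (pr32 x) j k)) ∧
    (∀ i k : Fin 2, Chr h i.succ 0 k.succ x = if i = k then 1 / 4 else 0) ∧
    (∀ i j : Fin 2, Chr h i.succ j.succ 0 x = if i = j then 1 / 4 else 0) ∧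
    (∀ i j k : Fin 2, Chr h i.succ j.succ k.succ x = Chr β i j k (pr32 x)) := by
  have hM := isOpen_Mset hΩ
  have p00 : ∀ l, pd l (fun y => h y 0 0) x = 0 := fun l => by
    rw [pd_congr_of_isOpen hM (fun y hy => (hw y hy).1) l hx, pd_const]
  have p0j : ∀ l (j : Fin 2), pd l (fun y => h y 0 j.succ) x = 0 := fun l j => by
    rw [pd_congr_of_isOpen hM (fun y hy => ((hw y hy).2.1 j).1) l hx, pd_const]
  have pj0 : ∀ l (j : Fin 2), pd l (fun y => h y j.succ 0) x = 0 := fun l j => by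
    rw [pd_congr_of_isOpen hM (fun y hy => ((hw y hy).2.1 j).2) l hx, pd_const]
  have hb : ∀ j k, DifferentiableAt ℝ (fun y => β y j k) (pr32 x) := fun j k =>
    ((hβs j k).contDiffAt (hΩ.mem_nhds hx.2)).differentiableAt (by simp)
  have he : DifferentiableAt ℝ (fun y : Eu 3 => Real.exp (y 0 / 2)) x :=
    contDiff_exp_coord.contDiffAt.differentiableAt (by simp)
  have pz : ∀ j k : Fin 2, pd 0 (fun y => h y j.succ k.succ) x =
      1 / 2 * (Real.exp (x 0 / 2) * β (pr32 x) j k) := fun j k => by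
    rw [pd_congr_of_isOpen hM (fun y hy => (hw y hy).2.2 j k) 0 hx,
      pd_mul he (differentiableAt_comp_pr32 (hb j k)), pd_zero_comp_pr32 (hb j k),
      pd_zero_comp_coord (hasDerivAt_exp_half (x 0))]
    ring
  have ps : ∀ l j k : Fin 2, pd l.succ (fun y => h y j.succ k.succ) x =
      Real.exp (x 0 / 2) * pd l (fun y => β y j k) (pr32 x) := fun l j k => by
    rw [pd_congr_of_isOpen hM (fun y hy => (hw y hy).2.2 j k) l.succ hx,
      pd_mul he (differentiableAt_comp_pr32 (hb j k)), pd_succ_comp_pr32 (hb j k),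
      pd_succ_comp_coord (hasDerivAt_exp_half (x 0))]
    ring
  have hinv := hw.inv_eq hβp hx
  have hne : Real.exp (x 0 / 2) ≠ 0 := (Real.exp_pos _).ne'
  have hmul := Matrix.nonsing_inv_mul (β (pr32 x))
    (isUnit_iff_ne_zero.2 (hβp _ hx.2).det_pos.ne')
  have hmul' : ∀ i k, ∑ l, (β (pr32 x))⁻¹ i l * β (pr32 x) l k = if i = k then 1 else 0 :=
    fun i k => by rw [← Matrix.mul_apply, hmul, Matrix.one_apply]
  refine ⟨fun j => ?_, fun j => ?_, fun i => ?_, fun j k => ?_, fun i k => ?_, fun i j => ?_,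
    fun i j k => ?_⟩
  · refine Fin.cases ?_ (fun j => ?_) j <;>
      simp [Chr, hinv, Fin.sum_univ_succ (n := 2), p00, p0j]
  · refine Fin.cases ?_ (fun j => ?_) j <;>
      simp [Chr, hinv, Fin.sum_univ_succ (n := 2), p00, pj0]
  · refine Fin.cases ?_ (fun i => ?_) i <;>
      simp [Chr, hinv, Fin.sum_univ_succ (n := 2), p00, p0j, pj0]
  · simp only [Chr, hinv, Fin.sum_univ_succ (n := 2), wrapM_zero_zero, wrapM_zero_succ, p0j, pj0,
      pz]
    simp only [zero_mul, Finset.sum_const_zero]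
    ring
  · simp only [Chr, hinv, Fin.sum_univ_succ (n := 2), wrapM_succ_zero, wrapM_succ_succ, p0j, pz]
    have : ∀ l, (Real.exp (x 0 / 2))⁻¹ * (β (pr32 x))⁻¹ i l *
        (1 / 2 * (Real.exp (x 0 / 2) * β (pr32 x) l k) + 0 - 0) =
        1 / 2 * ((β (pr32 x))⁻¹ i l * β (pr32 x) l k) := fun l => by
      field_simp
      ring
    simp only [this, ← Finset.mul_sum, hmul']
    split_ifs <;> norm_num
  · simp only [Chr, hinv, Fin.sum_univ_succ (n := 2), wrapM_succ_zero, wrapM_succ_succ, pj0, pz]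
    have : ∀ l, (Real.exp (x 0 / 2))⁻¹ * (β (pr32 x))⁻¹ i l *
        (0 + 1 / 2 * (Real.exp (x 0 / 2) * β (pr32 x) j l) - 0) =
        1 / 2 * ((β (pr32 x))⁻¹ i l * β (pr32 x) l j) := fun l => by
      rw [(hβt _ hx.2).apply l j]
      field_simp
      ring
    simp only [this, ← Finset.mul_sum, hmul']
    split_ifs <;> norm_num
  · simp only [Chr, hinv, Fin.sum_univ_succ (n := 2), wrapM_succ_zero,
      wrapM_succ_succ, ps, zero_mul,
      zero_add]
    congr 1
    refine Finset.sum_congr rfl fun l _ => ?_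
    field_simp

/-- The scalar curvature of the wrapped metric. -/
theorem WrapMetric.rscal_eq (hw : WrapMetric Ω β (fun r => Real.exp (r / 2)) h) (hΩ : IsOpen Ω)
    (hβs : ∀ i j, ContDiffOn ℝ ∞ (fun y => β y i j) Ω) (hβp : ∀ y ∈ Ω, (β y).PosDef)
    (hβt : ∀ y ∈ Ω, (β y).IsSymm) {x : Eu 3} (hx : x ∈ Mset Ω) :
    Rscal h x = (Real.exp (x 0 / 2))⁻¹ * Rscal β (pr32 x) - 3 / 8 := by
  have hM := isOpen_Mset hΩ
  have chr := fun {y : Eu 3} (hy : y ∈ Mset Ω) => hw.chr_eq hΩ hβs hβp hβt hy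
  obtain ⟨c00, c0, c1, c2, c3, c4, c5⟩ := chr hx
  have hb : ∀ j k, DifferentiableAt ℝ (fun y => β y j k) (pr32 x) := fun j k =>
    ((hβs j k).contDiffAt (hΩ.mem_nhds hx.2)).differentiableAt (by simp)
  have hc : ∀ i j k, DifferentiableAt ℝ (fun y => Chr β i j k y) (pr32 x) := fun i j k =>
    ((contDiffOn_Chr hΩ hβs hβp i j k).contDiffAt (hΩ.mem_nhds hx.2)).differentiableAt (by simp)
  have he : DifferentiableAt ℝ (fun y : Eu 3 => Real.exp (y 0 / 2)) x :=
    contDiff_exp_coord.contDiffAt.differentiableAt (by simp)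
  have d1 : ∀ l j, pd l (fun y => Chr h 0 0 j y) x = 0 := fun l j => by
    rw [pd_congr_of_isOpen hM (fun y hy => (chr hy).1 j) l hx, pd_const]
  have d2 : ∀ l j, pd l (fun y => Chr h 0 j 0 y) x = 0 := fun l j => by
    rw [pd_congr_of_isOpen hM (fun y hy => (chr hy).2.1 j) l hx, pd_const]
  have d3 : ∀ l i, pd l (fun y => Chr h i 0 0 y) x = 0 := fun l j => by
    rw [pd_congr_of_isOpen hM (fun y hy => (chr hy).2.2.1 j) l hx, pd_const]
  have d4 : ∀ j k : Fin 2, pd 0 (fun y => Chr h 0 j.succ k.succ y) x =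
      -(1 / 8) * (Real.exp (x 0 / 2) * β (pr32 x) j k) := fun j k => by
    have hm : DifferentiableAt ℝ (fun y : Eu 3 => Real.exp (y 0 / 2) * β (pr32 y) j k) x :=
      he.mul (differentiableAt_comp_pr32 (hb j k))
    rw [pd_congr_of_isOpen hM (fun y hy => (chr hy).2.2.2.1 j k) 0 hx,
      pd_mul (differentiableAt_const _) hm,
      pd_mul he (differentiableAt_comp_pr32 (hb j k)), pd_zero_comp_pr32 (hb j k),
      pd_zero_comp_coord (hasDerivAt_exp_half (x 0)), pd_const]
    ring
  have d5 : ∀ l (i k : Fin 2), pd l (fun y => Chr h i.succ 0 k.succ y) x = 0 := fun l i k => by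
    rw [pd_congr_of_isOpen hM (fun y hy => (chr hy).2.2.2.2.1 i k) l hx, pd_const]
  have d6 : ∀ l (i k : Fin 2), pd l (fun y => Chr h i.succ k.succ 0 y) x = 0 := fun l i k => by
    rw [pd_congr_of_isOpen hM (fun y hy => (chr hy).2.2.2.2.2.1 i k) l hx, pd_const]
  have d7 : ∀ l i j k : Fin 2, pd l.succ (fun y => Chr h i.succ j.succ k.succ y) x =
      pd l (fun y => Chr β i j k y) (pr32 x) := fun l i j k => by
    rw [pd_congr_of_isOpen hM (fun y hy => (chr hy).2.2.2.2.2.2 i j k) l.succ hx,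
      pd_succ_comp_pr32 (hc i j k)]
  have hne : Real.exp (x 0 / 2) ≠ 0 := (Real.exp_pos _).ne'
  have hmul := Matrix.nonsing_inv_mul (β (pr32 x))
    (isUnit_iff_ne_zero.2 (hβp _ hx.2).det_pos.ne')
  have hmul' : ∀ i k, ∑ l, (β (pr32 x))⁻¹ i l * β (pr32 x) l k = if i = k then 1 else 0 :=
    fun i k => by rw [← Matrix.mul_apply, hmul, Matrix.one_apply]
  have hs := fun j k => (hβt _ hx.2).apply j k
  have htr : ∑ j, ∑ k, (β (pr32 x))⁻¹ j k * β (pr32 x) j k = 2 := by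
    have : ∀ j, ∑ k, (β (pr32 x))⁻¹ j k * β (pr32 x) j k = 1 := fun j => by
      have := hmul' j j
      rw [if_pos rfl] at this
      rw [← this]
      exact Finset.sum_congr rfl fun k _ => by rw [hs k j]
    simp [this]
  set R : Fin 2 → Fin 2 → ℝ := fun j k =>
    (∑ i, pd i (fun y => Chr β i j k y) (pr32 x)) - (∑ i, pd k (fun y => Chr β i j i y) (pr32 x))
      + (∑ i, ∑ l, Chr β l j k (pr32 x) * Chr β i i l (pr32 x))
      - (∑ i, ∑ l, Chr β l j i (pr32 x) * Chr β i k l (pr32 x)) with hR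
  have r00 : (∑ i, pd i (fun y => Chr h i 0 0 y) x) - (∑ i, pd 0 (fun y => Chr h i 0 i y) x)
      + (∑ i, ∑ l, Chr h l 0 0 x * Chr h i i l x) - (∑ i, ∑ l, Chr h l 0 i x * Chr h i 0 l x)
      = -(1 / 8) := by
    simp only [Fin.sum_univ_succ (n := 2), d3, d5, c00, c1, c3]
    simp
    norm_num
  have rjk : ∀ j k : Fin 2, (∑ i, pd i (fun y => Chr h i j.succ k.succ y) x)
      - (∑ i, pd k.succ (fun y => Chr h i j.succ i y) x)
      + (∑ i, ∑ l, Chr h l j.succ k.succ x * Chr h i i l x)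
      - (∑ i, ∑ l, Chr h l j.succ i x * Chr h i k.succ l x)
      = R j k - 1 / 8 * (Real.exp (x 0 / 2) * β (pr32 x) j k) := fun j k => by
    simp only [Fin.sum_univ_succ (n := 2), d2, d4, d7, c00, c0, c2, c4, c5, hR]
    simp only [ite_mul, mul_ite, Finset.sum_ite_eq', Finset.mem_univ, if_true,
      zero_mul, mul_zero, Finset.sum_add_distrib, Finset.sum_const_zero, hs k j]
    simp [Fin.sum_univ_two]
    ring
  have hsum : Rscal h x = -(1 / 8) + ∑ j : Fin 2, ∑ k : Fin 2,
      (Real.exp (x 0 / 2))⁻¹ * (β (pr32 x))⁻¹ j k *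
        (R j k - 1 / 8 * (Real.exp (x 0 / 2) * β (pr32 x) j k)) := by
    rw [Rscal, Fin.sum_univ_succ (n := 2), Fin.sum_univ_succ (n := 2), hw.inv_eq hβp hx, r00]
    congr 1
    · simp
    · refine Finset.sum_congr rfl fun j _ => ?_
      rw [Fin.sum_univ_succ (n := 2), wrapM_succ_zero, zero_mul, zero_add]
      exact Finset.sum_congr rfl fun k _ => by rw [rjk, wrapM_succ_succ]
  have hsumβ : Rscal β (pr32 x) = ∑ j, ∑ k, (β (pr32 x))⁻¹ j k * R j k := rfl
  rw [hsum, hsumβ]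
  have : ∀ j k, (Real.exp (x 0 / 2))⁻¹ * (β (pr32 x))⁻¹ j k *
      (R j k - 1 / 8 * (Real.exp (x 0 / 2) * β (pr32 x) j k)) =
      (Real.exp (x 0 / 2))⁻¹ * ((β (pr32 x))⁻¹ j k * R j k) -
        1 / 8 * ((β (pr32 x))⁻¹ j k * β (pr32 x) j k) := fun j k => by
    field_simp
  simp only [this, Finset.sum_sub_distrib]
  simp only [← Finset.mul_sum, htr]
  ring

end WrappedCurvature

section SpaceTime

variable {n : ℕ} {F : Type*} [NormedAddCommGroup F] [NormedSpace ℝ F] {U : Set (Eu n)}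
  {f : ℝ → Eu n → F}

/-- Joint smoothness of a time-dependent function on `ℝ × U`. -/
def JSmooth (U : Set (Eu n)) (f : ℝ → Eu n → F) : Prop :=
  ContDiffOn ℝ ∞ (fun p : ℝ × Eu n => f p.1 p.2) (univ ×ˢ U)

theorem JSmooth.contDiffAt (hU : IsOpen U) (hf : JSmooth U f) (t : ℝ) {x : Eu n} (hx : x ∈ U) :
    ContDiffAt ℝ ∞ (fun p : ℝ × Eu n => f p.1 p.2) (t, x) :=
  ContDiffOn.contDiffAt hf ((isOpen_univ.prod hU).mem_nhds ⟨mem_univ _, hx⟩)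

theorem JSmooth.slice (hf : JSmooth U f) (t : ℝ) : ContDiffOn ℝ ∞ (f t) U :=
  ContDiffOn.comp (f := fun x => (t, x)) hf (by fun_prop) fun x hx => ⟨mem_univ _, hx⟩

theorem JSmooth.hasFDerivAt (hU : IsOpen U) (hf : JSmooth U f) (t : ℝ) {x : Eu n} (hx : x ∈ U) :
    HasFDerivAt (fun p : ℝ × Eu n => f p.1 p.2)
      (fderiv ℝ (fun p : ℝ × Eu n => f p.1 p.2) (t, x)) (t, x) :=
  ((hf.contDiffAt hU t hx).differentiableAt (by simp)).hasFDerivAt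

theorem JSmooth.pd_eq (hU : IsOpen U) (hf : JSmooth U f) (t : ℝ) {x : Eu n} (hx : x ∈ U)
    (j : Fin n) : pd j (f t) x =
      fderiv ℝ (fun p : ℝ × Eu n => f p.1 p.2) (t, x) (0, EuclideanSpace.single j 1) := by
  have := (hf.hasFDerivAt hU t hx).comp x (hasFDerivAt_prodMk_right (𝕜 := ℝ) t x)
  rw [pd, show f t = (fun p : ℝ × Eu n => f p.1 p.2) ∘ fun y => (t, y) from rfl, this.fderiv]
  simp

theorem JSmooth.hasDerivAt (hU : IsOpen U) (hf : JSmooth U f) (t : ℝ) {x : Eu n} (hx : x ∈ U) :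
    HasDerivAt (fun s => f s x)
      (fderiv ℝ (fun p : ℝ × Eu n => f p.1 p.2) (t, x) (1, 0)) t := by
  have := (hf.hasFDerivAt hU t hx).comp t (hasFDerivAt_prodMk_left (𝕜 := ℝ) t x)
  have h2 := this.hasDerivAt
  simp only [ContinuousLinearMap.comp_apply, ContinuousLinearMap.inl_apply] at h2
  exact h2

theorem JSmooth.spaceDeriv (hU : IsOpen U) (hf : JSmooth U f) (j : Fin n) :
    JSmooth U fun t => pd j (f t) := by
  have h1 := hf.fderiv_of_isOpen (m := ∞) (isOpen_univ.prod hU) (by simp)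
  refine (h1.clm_apply (contDiffOn_const (c := ((0 : ℝ), EuclideanSpace.single j (1 : ℝ))))).congr
    fun p hp => ?_
  exact hf.pd_eq hU p.1 hp.2 j

theorem JSmooth.timeDeriv (hU : IsOpen U) (hf : JSmooth U f) :
    JSmooth U fun t x => deriv (fun s => f s x) t := by
  have h1 := hf.fderiv_of_isOpen (m := ∞) (isOpen_univ.prod hU) (by simp)
  refine (h1.clm_apply (contDiffOn_const (c := ((1 : ℝ), (0 : Eu n))))).congr fun p hp => ?_
  exact (hf.hasDerivAt hU p.1 hp.2).deriv

/-- Time and space derivatives commute. -/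
theorem JSmooth.timeDeriv_pd (hU : IsOpen U) (hf : JSmooth U f) (t : ℝ) {x : Eu n} (hx : x ∈ U)
    (j : Fin n) : deriv (fun s => pd j (f s) x) t =
      pd j (fun y => deriv (fun s => f s y) t) x := by
  set G := fun p : ℝ × Eu n => f p.1 p.2 with hG
  have hsym : IsSymmSndFDerivAt ℝ G (t, x) :=
    (hf.contDiffAt hU t hx).isSymmSndFDerivAt
      (by simpa using WithTop.coe_le_coe.2 (le_top (a := (2 : ℕ∞))))
  have h2 : HasFDerivAt (fderiv ℝ G) (fderiv ℝ (fderiv ℝ G) (t, x)) (t, x) :=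
    (((hf.contDiffAt hU t hx).fderiv_right (m := ∞) (by simp)).differentiableAt
      (by simp)).hasFDerivAt
  have e1 : HasDerivAt (fun s => fderiv ℝ G (s, x) (0, EuclideanSpace.single j 1))
      (fderiv ℝ (fderiv ℝ G) (t, x) (1, 0) (0, EuclideanSpace.single j 1)) t := by
    have h3 := (h2.comp t (hasFDerivAt_prodMk_left (𝕜 := ℝ) t x)).hasDerivAt
    have h4 := h3.clm_apply (hasDerivAt_const t ((0 : ℝ), EuclideanSpace.single j (1 : ℝ)))
    simpa using h4
  have e2 : HasFDerivAt (fun y => fderiv ℝ G (t, y) (1, 0))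
      (((fderiv ℝ (fderiv ℝ G) (t, x)).comp (ContinuousLinearMap.inr ℝ ℝ (Eu n))).flip (1, 0))
      x := by
    have h3 := h2.comp x (hasFDerivAt_prodMk_right (𝕜 := ℝ) t x)
    have h4 := h3.clm_apply (hasFDerivAt_const ((1 : ℝ), (0 : Eu n)) x)
    simpa using h4
  have h5 : (fun s => pd j (f s) x) = fun s =>
      fderiv ℝ G (s, x) (0, EuclideanSpace.single j 1) := funext fun s => hf.pd_eq hU s hx j
  rw [h5, e1.deriv, pd_congr_of_isOpen hU
    (fun y hy => (hf.hasDerivAt hU t hy).deriv) j hx, pd, e2.fderiv]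
  simpa using hsym.eq _ _

theorem JSmooth.continuousOn {S : Set (ℝ × Eu n)} (hf : JSmooth U f) (hS : S ⊆ univ ×ˢ U) :
    ContinuousOn (fun p : ℝ × Eu n => f p.1 p.2) S :=
  (ContDiffOn.continuousOn hf).mono hS

theorem JSmooth.apply {m : ℕ} {f : ℝ → Eu n → Fin m → ℂ} (hf : JSmooth U f) (c : Fin m) :
    JSmooth U fun t x => f t x c :=
  contDiffOn_pi.1 hf c

end SpaceTime

section DiracOperator

variable {U : Set (Eu 3)} {A : Fin 3 → Eu 3 → Fin 4 → Fin 4 → ℂ} {B : Eu 3 → Fin 4 → Fin 4 → ℂ}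

theorem Hop_eq_zero {K : Set (Eu 3)} (hK : IsClosed K) {f : Eu 3 → Fin 4 → ℂ}
    (h0 : ∀ x, x ∉ K → f x = 0) {x : Eu 3} (hx : x ∉ K) : Hop A B f x = 0 := by
  funext i
  simp [Hop, pd_eq_zero hK h0 _ hx, h0 x hx]

theorem contDiffOn_Hop (hU : IsOpen U) (hA : ∀ j i k, ContDiffOn ℝ ∞ (fun x => A j x i k) U)
    (hB : ∀ i k, ContDiffOn ℝ ∞ (fun x => B x i k) U) {f : Eu 3 → Fin 4 → ℂ}
    (hf : ContDiffOn ℝ ∞ f U) : ContDiffOn ℝ ∞ (Hop A B f) U :=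
  contDiffOn_pi.2 fun i => (ContDiffOn.sum fun j _ => ContDiffOn.sum fun k _ =>
    (hA j i k).mul (contDiffOn_pi.1 (contDiffOn_pd hU hf j) k)).add
    (ContDiffOn.sum fun k _ => (hB i k).mul (contDiffOn_pi.1 hf k))

theorem IsTest.Hop (hU : IsOpen U) (hA : ∀ j i k, ContDiffOn ℝ ∞ (fun x => A j x i k) U)
    (hB : ∀ i k, ContDiffOn ℝ ∞ (fun x => B x i k) U) {f : Eu 3 → Fin 4 → ℂ}
    (hf : IsTest U f) : IsTest U (Hop A B f) :=
  IsTest.of_eq_zero hU hf.2.1 hf.2.2 (contDiffOn_Hop hU hA hB hf.1.contDiffOn)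
    fun _ hx => Hop_eq_zero (isClosed_tsupport f)
      (fun _ h => image_eq_zero_of_notMem_tsupport h) hx

theorem JSmooth.Hop (hU : IsOpen U) (hA : ∀ j i k, ContDiffOn ℝ ∞ (fun x => A j x i k) U)
    (hB : ∀ i k, ContDiffOn ℝ ∞ (fun x => B x i k) U) {u : ℝ → Eu 3 → Fin 4 → ℂ}
    (hu : JSmooth U u) : JSmooth U fun t => Hop A B (u t) := by
  have hs : ∀ {g : Eu 3 → ℂ}, ContDiffOn ℝ ∞ g U →
      ContDiffOn ℝ ∞ (fun p : ℝ × Eu 3 => g p.2) (univ ×ˢ U) := fun hg =>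
    hg.comp contDiff_snd.contDiffOn fun p hp => hp.2
  exact contDiffOn_pi.2 fun i => (ContDiffOn.sum fun j _ => ContDiffOn.sum fun k _ =>
    (hs (hA j i k)).mul ((hu.spaceDeriv hU j).apply k)).add
    (ContDiffOn.sum fun k _ => (hs (hB i k)).mul (hu.apply k))

/-- A spatially compactly supported solution of `i φ ∂ₜu = Hu` on `ℝ × U`, where `H` is symmetric
with respect to the density `w`. -/
structure DSol (U : Set (Eu 3)) (w : Eu 3 → ℝ) (φ : ℝ → ℝ)
    (A : Fin 3 → Eu 3 → Fin 4 → Fin 4 → ℂ) (B : Eu 3 → Fin 4 → Fin 4 → ℂ)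
    (u : ℝ → Eu 3 → Fin 4 → ℂ) : Prop where
  isOpen : IsOpen U
  contw : ContinuousOn w U
  posw : ∀ x ∈ U, 0 < w x
  contφ : Continuous φ
  posφ : ∀ t, 0 < φ t
  smoothA : ∀ j i k, ContDiffOn ℝ ∞ (fun x => A j x i k) U
  smoothB : ∀ i k, ContDiffOn ℝ ∞ (fun x => B x i k) U
  symm : ∀ f g : Eu 3 → Fin 4 → ℂ, IsTest U f → IsTest U g →
    ∫ x in U, (∑ i, conj (Hop A B f x i) * g x i) * ((w x : ℝ) : ℂ) =
      ∫ x in U, (∑ i, conj (f x i) * Hop A B g x i) * ((w x : ℝ) : ℂ)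
  smooth : JSmooth U u
  supp : ∀ t, HasCompactSupport (u t) ∧ tsupport (u t) ⊆ U
  eqn : ∀ t, ∀ x ∈ U, ∀ c, Complex.I * ((φ t : ℝ) : ℂ) * deriv (fun s => u s x c) t =
    Hop A B (u t) x c

namespace DSol

variable {w : Eu 3 → ℝ} {φ : ℝ → ℝ} {u : ℝ → Eu 3 → Fin 4 → ℂ}

theorem isTest (S : DSol U w φ A B u) (t : ℝ) : IsTest U (u t) :=
  IsTest.of_eq_zero S.isOpen (S.supp t).1 (S.supp t).2 (S.smooth.slice t)
    fun _ h => image_eq_zero_of_notMem_tsupport h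

theorem hasDerivAt (S : DSol U w φ A B u) (t : ℝ) {x : Eu 3} (hx : x ∈ U) (c : Fin 4) :
    HasDerivAt (fun s => u s x c)
      (-Complex.I * (((φ t)⁻¹ : ℝ) : ℂ) * Hop A B (u t) x c) t := by
  have h1 := ((S.smooth.apply c).hasDerivAt S.isOpen t hx).differentiableAt.hasDerivAt
  have : ((φ t : ℝ) : ℂ) ≠ 0 := by exact_mod_cast (S.posφ t).ne'
  have e : -Complex.I * (((φ t)⁻¹ : ℝ) : ℂ) * Hop A B (u t) x c = deriv (fun s => u s x c) t := by
    rw [← S.eqn t x hx c]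
    push_cast
    field_simp
    rw [Complex.I_sq]
    ring_nf
  rw [e]
  exact h1

theorem hasDerivAt_vec (S : DSol U w φ A B u) (t : ℝ) {x : Eu 3} (hx : x ∈ U) :
    HasDerivAt (fun s => u s x) ((-Complex.I * (((φ t)⁻¹ : ℝ) : ℂ)) • Hop A B (u t) x) t :=
  hasDerivAt_pi.2 fun c => S.hasDerivAt t hx c

/-- `Hu` is again a solution. -/
theorem hop (S : DSol U w φ A B u) : DSol U w φ A B fun t => Hop A B (u t) where
  __ := S
  smooth := S.smooth.Hop S.isOpen S.smoothA S.smoothB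
  supp t := ((S.isTest t).Hop S.isOpen S.smoothA S.smoothB).2
  eqn t x hx c := by
    have hU := S.isOpen
    have hs := S.smooth
    have h1 : HasDerivAt (fun s => Hop A B (u s) x c)
        (Hop A B (fun y => deriv (fun s => u s y) t) x c) t := by
      refine HasDerivAt.fun_add (HasDerivAt.fun_sum fun j _ => HasDerivAt.fun_sum fun k _ => ?_)
        (HasDerivAt.fun_sum fun k _ => ?_)
      · refine HasDerivAt.const_mul _ ?_
        rw [← hs.timeDeriv_pd hU t hx j]
        exact hasDerivAt_pi.1
            ((hs.spaceDeriv hU j).hasDerivAt hU t hx).differentiableAt.hasDerivAt k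
      · refine HasDerivAt.const_mul _ ?_
        exact hasDerivAt_pi.1 (hs.hasDerivAt hU t hx).differentiableAt.hasDerivAt k
    have h2 : Hop A B (fun y => deriv (fun s => u s y) t) x c =
        -Complex.I * (((φ t)⁻¹ : ℝ) : ℂ) * Hop A B (Hop A B (u t)) x c := by
      have e1 : ∀ y ∈ U, deriv (fun s => u s y) t =
          (-Complex.I * (((φ t)⁻¹ : ℝ) : ℂ)) • Hop A B (u t) y := fun y hy =>
        (S.hasDerivAt_vec t hy).deriv
      have e2 : ∀ j k, pd j (fun y => deriv (fun s => u s y) t) x k =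
          -Complex.I * (((φ t)⁻¹ : ℝ) : ℂ) * pd j (Hop A B (u t)) x k := fun j k => by
        rw [pd_congr_of_isOpen hU e1 j hx, pd, fderiv_fun_const_smul]
        · rfl
        · exact ((contDiffOn_Hop hU S.smoothA S.smoothB (hs.slice t)).contDiffAt
            (hU.mem_nhds hx)).differentiableAt (by simp)
      unfold Hop
      simp only [e2, e1 x hx, Pi.smul_apply, smul_eq_mul, mul_add, Finset.mul_sum]
      congr 1
      · exact Finset.sum_congr rfl fun j _ => Finset.sum_congr rfl fun k _ => by
          unfold Hop
          ring
      · exact Finset.sum_congr rfl fun k _ => by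
          unfold Hop
          simp only [mul_add, Finset.mul_sum]
          ring_nf
    rw [h1.deriv, h2]
    have : ((φ t : ℝ) : ℂ) ≠ 0 := by exact_mod_cast (S.posφ t).ne'
    push_cast
    field_simp
    rw [Complex.I_sq]
    ring_nf

/-- Time reversal. -/
theorem reverse (S : DSol U w φ A B u) : DSol U w (fun t => φ (-t)) (fun j x i k => -A j x i k)
    (fun x i k => -B x i k) fun t => u (-t) := by
  have hH : ∀ f x i, Hop (fun j x i k => -A j x i k) (fun x i k => -B x i k) f x i =
      -Hop A B f x i := fun f x i => by
    simp only [Hop, neg_mul, Finset.sum_neg_distrib, neg_add]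
  refine ⟨S.isOpen, S.contw, S.posw, S.contφ.comp continuous_neg, fun t => S.posφ _,
    fun j i k => (S.smoothA j i k).neg, fun i k => (S.smoothB i k).neg, fun f g hf hg => ?_, ?_,
    fun t => S.supp _, fun t x hx c => ?_⟩
  · simp only [hH, map_neg, neg_mul, mul_neg, Finset.sum_neg_distrib, integral_neg,
      S.symm f g hf hg]
  · exact ContDiffOn.comp (f := fun p : ℝ × Eu 3 => (-p.1, p.2)) S.smooth
      ((contDiff_fst.neg.prodMk contDiff_snd).contDiffOn) fun p hp => ⟨mem_univ _, hp.2⟩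
  · rw [hH, ← S.eqn (-t) x hx c]
    have := deriv_comp_neg (f := fun s => u s x c) (x := t)
    rw [this]
    ring_nf

end DSol

end DiracOperator

section LocalEnergy

/-- The squared norm on `ℂ⁴`. -/
def nsq (a : Fin 4 → ℂ) : ℝ := ∑ c, ‖a c‖ ^ 2

theorem nsq_nonneg (a : Fin 4 → ℂ) : 0 ≤ nsq a := Finset.sum_nonneg fun _ _ => sq_nonneg _

@[simp] theorem nsq_zero : nsq 0 = 0 := by simp [nsq]

theorem nsq_eq_zero {a : Fin 4 → ℂ} (h : nsq a = 0) : a = 0 := by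
  funext c
  have := (Finset.sum_eq_zero_iff_of_nonneg fun c _ => sq_nonneg ‖a c‖).1 h c (Finset.mem_univ c)
  simpa using this

theorem continuous_nsq : Continuous nsq := by
  unfold nsq
  fun_prop

/-- The solution has uniformly compact support near the time `t₀`. -/
def UnifAt (U : Set (Eu 3)) (u : ℝ → Eu 3 → Fin 4 → ℂ) (t₀ : ℝ) : Prop :=
  ∃ ε > 0, ∃ K, IsCompact K ∧ K ⊆ U ∧ ∀ t, |t - t₀| < ε → ∀ x, x ∉ K → u t x = 0

namespace DSol

variable {U : Set (Eu 3)} {A : Fin 3 → Eu 3 → Fin 4 → Fin 4 → ℂ} {B : Eu 3 → Fin 4 → Fin 4 → ℂ}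
  {w : Eu 3 → ℝ} {φ : ℝ → ℝ} {u : ℝ → Eu 3 → Fin 4 → ℂ}

theorem isTest_hop (S : DSol U w φ A B u) (t : ℝ) : IsTest U (Hop A B (u t)) :=
  S.hop.isTest t

theorem contHop (S : DSol U w φ A B u) :
    ContinuousOn (fun p : ℝ × Eu 3 => Hop A B (u p.1) p.2) (univ ×ˢ U) :=
  S.hop.smooth.continuousOn subset_rfl

theorem integrableOn_of_test (S : DSol U w φ A B u) {G : Type*} [NormedAddCommGroup G]
    {f : Eu 3 → Fin 4 → ℂ} (hf : IsTest U f) {F : Eu 3 → G} (hF : ContinuousOn F U)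
    (h0 : ∀ x, f x = 0 → F x = 0) : IntegrableOn F U :=
  integrableOn_of_compact S.isOpen hf.2.1 hf.2.2 hF fun x _ hx =>
    h0 x (image_eq_zero_of_notMem_tsupport hx)

/-- Evolution of weighted energies of `u - g`. -/
theorem hasDerivAt_energy (S : DSol U w φ A B u) {t₀ : ℝ} (hL : UnifAt U u t₀)
    {g : Eu 3 → Fin 4 → ℂ} (hg : IsTest U g) {Θ Θ' : ℝ → Eu 3 → ℝ}
    (hd : ∀ t, ∀ x ∈ U, HasDerivAt (fun s => Θ s x) (Θ' t x) t)
    (hc : ContinuousOn (fun p : ℝ × Eu 3 => Θ p.1 p.2) (univ ×ˢ U))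
    (hc' : ContinuousOn (fun p : ℝ × Eu 3 => Θ' p.1 p.2) (univ ×ˢ U)) :
    HasDerivAt (fun t => ∫ x in U, Θ t x * nsq (u t x - g x) * w x)
      (∫ x in U, (Θ' t₀ x * nsq (u t₀ x - g x) + Θ t₀ x * ((φ t₀)⁻¹ *
        (2 * ∑ c, (conj ((u t₀ x - g x) c) * Hop A B (u t₀) x c).im))) * w x) t₀ := by
  obtain ⟨ε, hε, K, hK, hKU, h0⟩ := hL
  set K' := K ∪ tsupport g with hK'
  have hK'c : IsCompact K' := hK.union hg.2.1
  have hK'U : K' ⊆ U := union_subset hKU hg.2.2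
  have hz : ∀ t, |t - t₀| < ε → ∀ x, x ∉ K' → u t x - g x = 0 := fun t ht x hx => by
    rw [h0 t ht x (fun h => hx (Or.inl h)),
      image_eq_zero_of_notMem_tsupport (fun h => hx (Or.inr h)), sub_zero]
  have hε2 : 0 < ε / 2 := by positivity
  have hsub : (Icc (t₀ - ε / 2) (t₀ + ε / 2)) ×ˢ K' ⊆ (univ : Set ℝ) ×ˢ U :=
    prod_mono (subset_univ _) hK'U
  have hu := (S.smooth.continuousOn hsub)
  have hgc : ContinuousOn (fun p : ℝ × Eu 3 => g p.2) (Icc (t₀ - ε / 2) (t₀ + ε / 2) ×ˢ K') :=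
    (hg.1.continuous.comp continuous_snd).continuousOn
  have hH := S.contHop.mono hsub
  have key := hasDerivAt_setIntegral_compact (𝕜 := ℝ) (t₀ := t₀) hK'c
    ((S.contw.mono hK'U).integrableOn_compact hK'c) hε2
    (f := fun t x => Θ t x * nsq (u t x - g x))
    (f' := fun t x => Θ' t x * nsq (u t x - g x) + Θ t x * ((φ t)⁻¹ *
        (2 * ∑ c, (conj ((u t x - g x) c) * Hop A B (u t) x c).im))) ?_ ?_ ?_
  · rw [setIntegral_eq_compact S.isOpen hK'U]
    · refine key.congr_of_eventuallyEq ?_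
      filter_upwards [Metric.ball_mem_nhds t₀ hε] with t ht
      rw [setIntegral_eq_compact S.isOpen hK'U]
      intro x _ hx
      rw [hz t (by simpa [Real.dist_eq] using ht) x hx]
      simp
    · intro x _ hx
      rw [hz t₀ (by simpa using hε) x hx]
      simp
  · intro t _ x hx
    refine (hd t x (hK'U hx)).mul ?_
    have h1 : ∀ c, HasDerivAt (fun s => ‖u s x c - g x c‖ ^ 2)
        ((φ t)⁻¹ * (2 * (conj ((u t x - g x) c) * Hop A B (u t) x c).im)) t := fun c => by
      have := ((S.hasDerivAt t (hK'U hx) c).sub_const (g x c)).norm_sq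
      convert this using 1
      rw [Complex.inner]
      simp only [Pi.sub_apply, Complex.mul_im, Complex.mul_re, Complex.neg_re, Complex.neg_im,
        Complex.I_re, Complex.I_im, Complex.ofReal_re, Complex.ofReal_im, Complex.conj_re,
        Complex.conj_im]
      ring
    have h2 := HasDerivAt.fun_sum (u := Finset.univ) fun c _ => h1 c
    rw [Finset.mul_sum, Finset.mul_sum]
    exact h2
  · intro t _
    refine ((hc.comp (f := fun x => (t, x)) (by fun_prop) fun x hx => ⟨mem_univ _, hK'U hx⟩)).mul ?_
    exact continuous_nsq.comp_continuousOn
      (((S.smooth.slice t).continuousOn.mono hK'U).sub hg.1.continuous.continuousOn)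
  · refine ((hc'.mono hsub).mul (continuous_nsq.comp_continuousOn (hu.sub hgc))).add
      ((hc.mono hsub).mul (ContinuousOn.mul ?_ (continuousOn_const.mul
        (continuousOn_finsetSum _ fun c _ => ?_))))
    · exact ((S.contφ.comp continuous_fst).inv₀ fun p => (S.posφ _).ne').continuousOn
    · refine Complex.continuous_im.comp_continuousOn (ContinuousOn.mul ?_ ?_)
      · exact Complex.continuous_conj.comp_continuousOn (continuousOn_pi.1 (hu.sub hgc) c)
      · exact continuousOn_pi.1 hH c

theorem Hop_mul {Θ : Eu 3 → ℝ} {f : Eu 3 → Fin 4 → ℂ} {x : Eu 3} (hΘ : DifferentiableAt ℝ Θ x)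
    (hf : DifferentiableAt ℝ f x) (i : Fin 4) :
    Hop A B (fun y => Θ y • f y) x i = ((Θ x : ℝ) : ℂ) * Hop A B f x i +
      ∑ j, ∑ k, A j x i k * (((pd j Θ x : ℝ) : ℂ) * f x k) := by
  have h1 : ∀ j k, pd j (fun y => Θ y • f y) x k =
      ((Θ x : ℝ) : ℂ) * pd j f x k + ((pd j Θ x : ℝ) : ℂ) * f x k := fun j k => by
    simp only [pd]
    rw [fderiv_fun_smul hΘ hf]
    simp [ContinuousLinearMap.smulRight_apply]
  simp only [Hop, h1, mul_add, Finset.sum_add_distrib, Pi.smul_apply, Complex.real_smul,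
    Finset.mul_sum]
  have e1 : ∀ j k, ((Θ x : ℝ) : ℂ) * (A j x i k * pd j f x k) =
    A j x i k * (((Θ x : ℝ) : ℂ) * pd j f x k) := fun j k => by ring
  have e2 : ∀ k, ((Θ x : ℝ) : ℂ) * (B x i k * f x k) =
    B x i k * (((Θ x : ℝ) : ℂ) * f x k) := fun k => by ring
  simp only [e1, e2]
  ring

/-- The commutator estimate for a symmetric first-order operator. -/
theorem abs_integral_im_le (S : DSol U w φ A B u) {Θ : Eu 3 → ℝ} (hΘ : ContDiffOn ℝ ∞ Θ U)
    {f : Eu 3 → Fin 4 → ℂ} (hf : IsTest U f) {b : Eu 3 → ℝ} (hb : ContinuousOn b U)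
    (hbA : ∀ x ∈ U, ∀ j i k, ‖A j x i k‖ * |pd j Θ x| ≤ b x) :
    |∫ x in U, Θ x * (2 * ∑ c, (conj (f x c) * Hop A B f x c).im) * w x| ≤
      ∫ x in U, 12 * b x * nsq (f x) * w x := by
  have hU := S.isOpen
  have hfc := hf.1.continuous.continuousOn (s := U)
  have hHt := hf.Hop hU S.smoothA S.smoothB
  have hHc := hHt.1.continuous.continuousOn (s := U)
  have hΘf : IsTest U (fun y => Θ y • f y) :=
    IsTest.of_eq_zero hU hf.2.1 hf.2.2 (hΘ.smul hf.1.contDiffOn) fun x hx => by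
      rw [image_eq_zero_of_notMem_tsupport hx, smul_zero]
  have hdΘ : ∀ x ∈ U, DifferentiableAt ℝ Θ x := fun x hx =>
    (hΘ.contDiffAt (hU.mem_nhds hx)).differentiableAt (by simp)
  have hdf : ∀ x, DifferentiableAt ℝ f x := fun x => hf.1.contDiffAt.differentiableAt (by simp)
  have hwC : ContinuousOn (fun x => ((w x : ℝ) : ℂ)) U :=
    Complex.continuous_ofReal.comp_continuousOn S.contw
  have hΘC : ContinuousOn (fun x => ((Θ x : ℝ) : ℂ)) U :=
    Complex.continuous_ofReal.comp_continuousOn hΘ.continuousOn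
  set P : Eu 3 → ℂ := fun x => ∑ i, conj (∑ j, ∑ k, A j x i k * (((pd j Θ x : ℝ) : ℂ) * f x k)) *
    f x i with hP
  have hPc : ContinuousOn P U := by
    refine continuousOn_finsetSum _ fun i _ => ContinuousOn.mul
      (Complex.continuous_conj.comp_continuousOn (continuousOn_finsetSum _ fun j _ =>
        continuousOn_finsetSum _ fun k _ => (S.smoothA j i k).continuousOn.mul
          (ContinuousOn.mul (Complex.continuous_ofReal.comp_continuousOn
            (contDiffOn_pd hU hΘ j).continuousOn) (continuousOn_pi.1 hfc k))))
      (continuousOn_pi.1 hfc i)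
  have i1 : IntegrableOn (fun x => (∑ i, conj (f x i) * Hop A B f x i) * ((Θ x : ℝ) : ℂ) *
      ((w x : ℝ) : ℂ)) U := by
    refine S.integrableOn_of_test hf (((continuousOn_finsetSum _ fun i _ =>
      (Complex.continuous_conj.comp_continuousOn (continuousOn_pi.1 hfc i)).mul
        (continuousOn_pi.1 hHc i)).mul hΘC).mul hwC) fun x hx => by simp [hx]
  have i2 : IntegrableOn (fun x => (∑ i, conj (Hop A B f x i) * f x i) * ((Θ x : ℝ) : ℂ) *
      ((w x : ℝ) : ℂ)) U := by
    refine S.integrableOn_of_test hf (((continuousOn_finsetSum _ fun i _ =>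
      (Complex.continuous_conj.comp_continuousOn (continuousOn_pi.1 hHc i)).mul
        (continuousOn_pi.1 hfc i)).mul hΘC).mul hwC) fun x hx => by simp [hx]
  have i3 : IntegrableOn (fun x => P x * ((w x : ℝ) : ℂ)) U :=
    S.integrableOn_of_test hf (hPc.mul hwC) fun x hx => by simp [hP, hx]
  have hsym := S.symm _ _ hΘf hf
  have e1 : ∫ x in U, (∑ i, conj (Hop A B (fun y => Θ y • f y) x i) * f x i) * ((w x : ℝ) : ℂ) =
      (∫ x in U, (∑ i, conj (Hop A B f x i) * f x i) * ((Θ x : ℝ) : ℂ) * ((w x : ℝ) : ℂ)) +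
      ∫ x in U, P x * ((w x : ℝ) : ℂ) := by
    rw [← integral_add i2 i3]
    refine setIntegral_congr_fun hU.measurableSet fun x hx => ?_
    simp only [Hop_mul (hdΘ x hx) (hdf x), map_add, map_mul, Complex.conj_ofReal, add_mul,
      Finset.sum_add_distrib, hP, Finset.sum_mul]
    congr 1
    exact Finset.sum_congr rfl fun i _ => by ring
  have e2 : ∫ x in U, (∑ i, conj (Θ x • f x i) * Hop A B f x i) * ((w x : ℝ) : ℂ) =
      ∫ x in U, (∑ i, conj (f x i) * Hop A B f x i) * ((Θ x : ℝ) : ℂ) * ((w x : ℝ) : ℂ) := by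
    refine setIntegral_congr_fun hU.measurableSet fun x hx => ?_
    simp only [Complex.real_smul, map_mul, Complex.conj_ofReal, Finset.sum_mul]
    exact Finset.sum_congr rfl fun i _ => by ring
  have e3 : (∫ x in U, P x * ((w x : ℝ) : ℂ)) =
      ∫ x in U, Complex.I *
        ((Θ x * (2 * ∑ c, (conj (f x c) * Hop A B f x c).im) * w x : ℝ) : ℂ) := by
    have : (∫ x in U, P x * ((w x : ℝ) : ℂ)) =
        (∫ x in U, (∑ i, conj (f x i) * Hop A B f x i) * ((Θ x : ℝ) : ℂ) * ((w x : ℝ) : ℂ)) -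
        (∫ x in U, (∑ i, conj (Hop A B f x i) * f x i) * ((Θ x : ℝ) : ℂ) * ((w x : ℝ) : ℂ)) := by
      rw [eq_sub_iff_add_eq, add_comm, ← e1, ← e2]
      exact hsym
    rw [this, ← integral_sub i1 i2]
    refine setIntegral_congr_fun hU.measurableSet fun x hx => ?_
    have h3 : ∀ a b : ℂ, conj a * b - conj b * a = Complex.I * ((2 * (conj a * b).im : ℝ) : ℂ) :=
      fun a b => by
        apply Complex.ext <;> simp <;> ring
    have h4 : (∑ i, conj (f x i) * Hop A B f x i) - (∑ i, conj (Hop A B f x i) * f x i) =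
        Complex.I * ((2 * ∑ c, (conj (f x c) * Hop A B f x c).im : ℝ) : ℂ) := by
      rw [← Finset.sum_sub_distrib, Finset.mul_sum, Complex.ofReal_sum, Finset.mul_sum]
      exact Finset.sum_congr rfl fun i _ => h3 _ _
    rw [← sub_mul, ← sub_mul, h4]
    push_cast
    ring
  have e4 : |∫ x in U, Θ x * (2 * ∑ c, (conj (f x c) * Hop A B f x c).im) * w x| =
      ‖∫ x in U, P x * ((w x : ℝ) : ℂ)‖ := by
    rw [e3, integral_const_mul, integral_complex_ofReal, norm_mul, Complex.norm_I, one_mul,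
      Complex.norm_real, Real.norm_eq_abs]
  rw [e4]
  refine (norm_integral_le_integral_norm _).trans (setIntegral_mono_on i3.norm ?_
    hU.measurableSet fun x hx => ?_)
  · exact S.integrableOn_of_test hf (((continuousOn_const.mul hb).mul
      (continuous_nsq.comp_continuousOn hfc)).mul S.contw) fun x hx => by simp [hx]
  · rw [norm_mul, Complex.norm_real, Real.norm_eq_abs, abs_of_pos (S.posw x hx)]
    refine mul_le_mul_of_nonneg_right ?_ (S.posw x hx).le
    have hb0 : 0 ≤ b x := (by positivity : (0 : ℝ) ≤ ‖A 0 x 0 0‖ * |pd 0 Θ x|).trans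
      (hbA x hx 0 0 0)
    have h5 : ∀ i, ‖conj (∑ j, ∑ k, A j x i k * (((pd j Θ x : ℝ) : ℂ) * f x k))‖ ≤
        3 * (b x * ∑ k, ‖f x k‖) := fun i => by
      rw [Complex.norm_conj]
      have : ∀ j ∈ Finset.univ, ‖∑ k, A j x i k * (((pd j Θ x : ℝ) : ℂ) * f x k)‖ ≤
          b x * ∑ k, ‖f x k‖ := fun j _ => by
        rw [Finset.mul_sum]
        refine norm_sum_le_of_le _ fun k _ => ?_
        rw [norm_mul, norm_mul, Complex.norm_real, Real.norm_eq_abs, ← mul_assoc]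
        exact mul_le_mul_of_nonneg_right (hbA x hx j i k) (norm_nonneg _)
      simpa using norm_sum_le_of_le _ this
    have h6 : ‖P x‖ ≤ ∑ i, 3 * (b x * ∑ k, ‖f x k‖) * ‖f x i‖ :=
      norm_sum_le_of_le _ fun i _ => by
        rw [norm_mul]
        exact mul_le_mul_of_nonneg_right (h5 i) (norm_nonneg _)
    rw [← Finset.mul_sum] at h6
    have h7 : (∑ k, ‖f x k‖) ^ 2 ≤ 4 * nsq (f x) := by
      have := sq_sum_le_card_mul_sum_sq (s := (Finset.univ : Finset (Fin 4)))
        (f := fun k => ‖f x k‖)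
      simpa [nsq] using this
    nlinarith

/-- Conservation of charge, in differential form. -/
theorem integral_im_eq_zero (S : DSol U w φ A B u) {f : Eu 3 → Fin 4 → ℂ} (hf : IsTest U f) :
    ∫ x in U, (2 * ∑ c, (conj (f x c) * Hop A B f x c).im) * w x = 0 := by
  have := S.abs_integral_im_le (Θ := fun _ => 1) contDiffOn_const hf (b := fun _ => 0)
    continuousOn_const fun x _ j i k => by simp [pd_const]
  simpa using this

end DSol

end LocalEnergy

section FiniteSpeed

theorem exists_cutoff {U K : Set (Eu 3)} (hU : IsOpen U) (hK : IsCompact K) (hKU : K ⊆ U) :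
    ∃ K', IsCompact K' ∧ K' ⊆ U ∧ ∃ ζ : Eu 3 → ℝ, ContDiff ℝ ∞ ζ ∧ (∀ x, ζ x ∈ Icc (0 : ℝ) 1) ∧
      (∀ x ∈ K, ζ x = 0) ∧ ∀ x, x ∉ K' → ζ x = 1 := by
  obtain ⟨K', hK', h1, h2⟩ := exists_compact_between hK hU hKU
  obtain ⟨f, hf, hr, h0, h3⟩ := exists_contMDiff_zero_iff_one_iff_of_isClosed (n := (⊤ : ℕ∞))
    (modelWithCornersSelf ℝ (Eu 3)) hK.isClosed isOpen_interior.isClosed_compl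
    (disjoint_compl_right_iff_subset.2 h1)
  exact ⟨K', hK', h2, f, hf.contDiff, fun x => hr (mem_range_self x), fun x hx => (h0 x).1 hx,
    fun x hx => (h3 x).1 fun h => hx (interior_subset h)⟩

theorem two_mul_im_conj_le (a b : Fin 4 → ℂ) :
    2 * ∑ c, (conj (a c) * b c).im ≤ nsq a + nsq b := by
  unfold nsq
  rw [Finset.mul_sum, ← Finset.sum_add_distrib]
  refine Finset.sum_le_sum fun c _ => ?_
  have h1 : (conj (a c) * b c).im ≤ ‖a c‖ * ‖b c‖ :=
    ((le_abs_self _).trans (Complex.abs_im_le_norm _)).trans_eq (by simp)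
  nlinarith [sq_nonneg (‖a c‖ - ‖b c‖)]

theorem UnifAt.isOpen (U : Set (Eu 3)) (u : ℝ → Eu 3 → Fin 4 → ℂ) : IsOpen {t | UnifAt U u t} := by
  rw [Metric.isOpen_iff]
  rintro t ⟨ε, hε, K, hK, hKU, h0⟩
  refine ⟨ε / 2, by positivity, fun s hs => ⟨ε / 2, by positivity, K, hK, hKU, fun r hr => h0 r ?_⟩⟩
  rw [Metric.mem_ball, Real.dist_eq] at hs
  calc |r - t| ≤ |r - s| + |s - t| := abs_sub_le _ _ _
    _ < ε := by linarith

namespace DSol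

variable {U : Set (Eu 3)} {A : Fin 3 → Eu 3 → Fin 4 → Fin 4 → ℂ} {B : Eu 3 → Fin 4 → Fin 4 → ℂ}
  {w : Eu 3 → ℝ} {φ : ℝ → ℝ} {u : ℝ → Eu 3 → Fin 4 → ℂ}

theorem unifAt_hop {t : ℝ} (hL : UnifAt U u t) : UnifAt U (fun t => Hop A B (u t)) t := by
  obtain ⟨ε, hε, K, hK, hKU, h0⟩ := hL
  exact ⟨ε, hε, K, hK, hKU, fun s hs x hx => Hop_eq_zero hK.isClosed (h0 s hs) hx⟩

theorem hasDerivAt_charge (S : DSol U w φ A B u) {t : ℝ} (hL : UnifAt U u t) :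
    HasDerivAt (fun t => ∫ x in U, nsq (u t x) * w x) 0 t := by
  have h1 := S.hasDerivAt_energy hL (g := 0) (Θ := fun _ _ => 1) (Θ' := fun _ _ => 0)
    ⟨contDiff_const, HasCompactSupport.zero, by simp⟩
    (fun t x _ => hasDerivAt_const _ _) continuousOn_const continuousOn_const
  have h2 : (∫ x in U, (0 * nsq (u t x - (0 : Eu 3 → Fin 4 → ℂ) x) + 1 * ((φ t)⁻¹ *
        (2 * ∑ c, (conj ((u t x - (0 : Eu 3 → Fin 4 → ℂ) x) c) * Hop A B (u t) x c).im))) * w x) =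
      0 := by
    simp only [Pi.zero_apply, sub_zero, zero_mul, zero_add, one_mul, mul_assoc ((φ t)⁻¹)]
    rw [integral_const_mul, S.integral_im_eq_zero (S.isTest t), mul_zero]
  rw [h2] at h1
  simpa using h1

theorem charge_eq (S : DSol U w φ A B u) {s t : ℝ} (hst : s ≤ t)
    (hL : ∀ r ∈ Icc s t, UnifAt U u r) :
    ∫ x in U, nsq (u t x) * w x = ∫ x in U, nsq (u s x) * w x :=
  constant_of_has_deriv_right_zero
    (fun r hr => (S.hasDerivAt_charge (hL r hr)).continuousAt.continuousWithinAt)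
    (fun r hr => (S.hasDerivAt_charge (hL r (Ico_subset_Icc_self hr))).hasDerivWithinAt) t
    (right_mem_Icc.2 hst)

theorem integrableOn_nsq (S : DSol U w φ A B u) {f : Eu 3 → Fin 4 → ℂ} (hf : IsTest U f) :
    IntegrableOn (fun x => nsq (f x) * w x) U :=
  S.integrableOn_of_test hf
    ((continuous_nsq.comp_continuousOn hf.1.continuous.continuousOn).mul S.contw) fun x hx => by
      simp [hx]

/-- Lipschitz-type continuity in time, controlled by the conserved energy. -/
theorem dist_le (S : DSol U w φ A B u) {s t Λ : ℝ} (hst : s ≤ t)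
    (hL : ∀ r ∈ Icc s t, UnifAt U u r) (hΛ : ∀ r ∈ Icc s t, (φ r)⁻¹ ≤ Λ) :
    ∫ x in U, nsq (u t x - u s x) * w x ≤
      (exp (Λ * (t - s)) - 1) * ∫ x in U, nsq (Hop A B (u t) x) * w x := by
  have hU := S.isOpen
  set E := ∫ x in U, nsq (Hop A B (u t) x) * w x with hE
  have hEr : ∀ r ∈ Icc s t, ∫ x in U, nsq (Hop A B (u r) x) * w x = E := fun r hr =>
    (S.hop.charge_eq hr.2 fun q hq => unifAt_hop (hL q ⟨hr.1.trans hq.1, hq.2⟩)).symm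
  set f : ℝ → ℝ := fun r => ∫ x in U, nsq (u r x - u s x) * w x with hf
  have htest : ∀ r, IsTest U (fun x => u r x - u s x) := fun r =>
    ⟨(S.isTest r).1.sub (S.isTest s).1, (S.isTest r).2.1.sub (S.isTest s).2.1,
      (tsupport_sub _ _).trans (union_subset (S.isTest r).2.2 (S.isTest s).2.2)⟩
  have hd : ∀ r ∈ Icc s t, ∃ f', HasDerivAt f f' r ∧ f' ≤ Λ * (f r + E) := fun r hr => by
    have h1 := S.hasDerivAt_energy (hL r hr) (g := u s) (Θ := fun _ _ => 1) (Θ' := fun _ _ => 0)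
      (S.isTest s) (fun t x _ => hasDerivAt_const _ _) continuousOn_const continuousOn_const
    simp only [one_mul, zero_mul, zero_add, mul_assoc ((φ r)⁻¹)] at h1
    rw [integral_const_mul] at h1
    refine ⟨_, h1, ?_⟩
    have h2 : ∫ x in U, (2 * ∑ c, (conj ((u r x - u s x) c) * Hop A B (u r) x c).im) * w x ≤
        f r + E := by
      rw [← hEr r hr, ← integral_add (S.integrableOn_nsq (htest r))
        (S.integrableOn_nsq (S.isTest_hop r))]
      refine setIntegral_mono_on ?_ ((S.integrableOn_nsq (htest r)).add
        (S.integrableOn_nsq (S.isTest_hop r))) hU.measurableSet fun x hx => ?_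
      · refine S.integrableOn_of_test (htest r) ((continuousOn_const.mul
          (continuousOn_finsetSum _ fun c _ => Complex.continuous_im.comp_continuousOn
          ((Complex.continuous_conj.comp_continuousOn (continuousOn_pi.1
            (htest r).1.continuous.continuousOn c)).mul
          (continuousOn_pi.1 (S.isTest_hop r).1.continuous.continuousOn c)))).mul S.contw)
          fun x hx => ?_
        simp only [hx]
        simp
      · rw [← add_mul]
        exact mul_le_mul_of_nonneg_right (two_mul_im_conj_le _ _) (S.posw x hx).le
    have h3 : 0 ≤ f r + E := add_nonneg
      (setIntegral_nonneg hU.measurableSet fun x hx => mul_nonneg (nsq_nonneg _) (S.posw x hx).le)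
      (setIntegral_nonneg hU.measurableSet fun x hx => mul_nonneg (nsq_nonneg _) (S.posw x hx).le)
    exact (mul_le_mul_of_nonneg_left h2 (inv_pos.2 (S.posφ r)).le).trans
      (mul_le_mul_of_nonneg_right (hΛ r hr) h3)
  set G : ℝ → ℝ := fun r => (f r + E) * exp (-(Λ * (r - s))) with hG
  have hGd : ∀ r ∈ Icc s t, ∃ G', HasDerivAt G G' r ∧ G' ≤ 0 := fun r hr => by
    obtain ⟨f', h1, h2⟩ := hd r hr
    have h3 : HasDerivAt (fun r => exp (-(Λ * (r - s)))) (exp (-(Λ * (r - s))) * (-(Λ * 1))) r :=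
      ((((hasDerivAt_id r).sub_const s).const_mul Λ).neg).exp
    refine ⟨_, (h1.add_const E).mul h3, ?_⟩
    have := exp_pos (-(Λ * (r - s)))
    nlinarith
  have hanti : AntitoneOn G (Icc s t) := by
    refine antitoneOn_of_deriv_nonpos (convex_Icc s t) (fun r hr => ?_)
      (fun r hr => ?_) fun r hr => ?_
    · obtain ⟨_, h, _⟩ := hGd r hr
      exact h.continuousAt.continuousWithinAt
    · rw [interior_Icc] at hr
      obtain ⟨_, h, _⟩ := hGd r (Ioo_subset_Icc_self hr)
      exact h.differentiableAt.differentiableWithinAt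
    · rw [interior_Icc] at hr
      obtain ⟨_, h, h'⟩ := hGd r (Ioo_subset_Icc_self hr)
      rwa [h.deriv]
  have h4 := hanti (left_mem_Icc.2 hst) (right_mem_Icc.2 hst) hst
  have h5 : f s = 0 := by simp [hf]
  simp only [hG, h5, sub_self, mul_zero, neg_zero, exp_zero, zero_add, mul_one] at h4
  have h6 : exp (-(Λ * (t - s))) * exp (Λ * (t - s)) = 1 := by rw [← exp_add]; simp
  have h7 := mul_le_mul_of_nonneg_right h4 (exp_pos (Λ * (t - s))).le
  rw [mul_assoc, h6, mul_one] at h7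
  linarith

/-- Finite speed of propagation, forward in time. -/
theorem finite_speed (S : DSol U w φ A B u) (a b : ℝ) {K : Set (Eu 3)} (hK : IsCompact K)
    (hKU : K ⊆ U) : ∃ κ > 0, ∃ K', IsCompact K' ∧ K' ⊆ U ∧ ∀ c d, a ≤ c → d ≤ b → d - c < κ →
      (∀ x, x ∉ K → u c x = 0) → (∀ t ∈ Ioc c d, UnifAt U u t) →
      ∀ t ∈ Ioc c d, ∀ x, x ∉ K' → u t x = 0 := by
  have hU := S.isOpen
  obtain ⟨K', hK', hK'U, ζ, hζ, hζI, hζ0, hζ1⟩ := exists_cutoff hU hK hKU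
  obtain ⟨Λ, hΛ⟩ := isCompact_Icc.exists_bound_of_continuousOn (s := Icc a b)
    (S.contφ.inv₀ fun t => (S.posφ t).ne').continuousOn
  obtain ⟨D, hD⟩ := hK'.exists_bound_of_continuousOn
    (f := fun x => ∑ j, ∑ i, ∑ k, ‖A j x i k‖ * |pd j ζ x|)
    (continuousOn_finsetSum _ fun j _ => continuousOn_finsetSum _ fun i _ =>
      continuousOn_finsetSum _ fun k _ =>
      (((S.smoothA j i k).continuousOn.norm).mul
        (contDiffOn_pd hU hζ.contDiffOn j).continuousOn.abs).mono hK'U)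
  have hD' : ∀ x ∈ U, ∀ j i k, ‖A j x i k‖ * |pd j ζ x| ≤ |D| := fun x hx j i k => by
    by_cases hxK : x ∈ K'
    · have h1 := (le_abs_self _).trans ((hD x hxK).trans (le_abs_self D))
      refine le_trans ?_ h1
      have e1 : ‖A j x i k‖ * |pd j ζ x| ≤ ∑ k, ‖A j x i k‖ * |pd j ζ x| :=
        Finset.single_le_sum (f := fun k => ‖A j x i k‖ * |pd j ζ x|)
          (fun _ _ => by positivity) (Finset.mem_univ k)
      have e2 : ∑ k, ‖A j x i k‖ * |pd j ζ x| ≤ ∑ i, ∑ k, ‖A j x i k‖ * |pd j ζ x| :=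
        Finset.single_le_sum (f := fun i => ∑ k, ‖A j x i k‖ * |pd j ζ x|)
          (fun _ _ => by positivity) (Finset.mem_univ i)
      have e3 : ∑ i, ∑ k, ‖A j x i k‖ * |pd j ζ x| ≤ ∑ j, ∑ i, ∑ k, ‖A j x i k‖ * |pd j ζ x| :=
        Finset.single_le_sum (f := fun j => ∑ i, ∑ k, ‖A j x i k‖ * |pd j ζ x|)
          (fun _ _ => by positivity) (Finset.mem_univ j)
      exact e1.trans (e2.trans e3)
    · have : pd j ζ x = 0 := by
        have h1 : ∀ y ∈ K'ᶜ, ζ y = (fun _ => (1 : ℝ)) y := fun y hy => hζ1 y hy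
        rw [pd_congr_of_isOpen hK'.isClosed.isOpen_compl h1 j hxK, pd_const]
      rw [this]
      simp
  set C : ℝ := |Λ| * (12 * |D|) + 1 with hC
  have hC0 : 0 < C := by positivity
  refine ⟨C⁻¹, by positivity, K', hK', hK'U, fun c d hac hdb hdc hu0 hL t ht x hx => ?_⟩
  have hφΛ : ∀ r ∈ Icc a b, (φ r)⁻¹ ≤ |Λ| := fun r hr =>
    (le_abs_self _).trans ((hΛ r hr).trans (le_abs_self _))
  set ψ := Real.smoothTransition
  have hψd : ∀ s, HasDerivAt ψ (deriv ψ s) s := fun s =>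
    (Real.smoothTransition.contDiff (n := 1)).contDiffAt.differentiableAt (by simp) |>.hasDerivAt
  have hψ0 : ∀ s, 0 ≤ deriv ψ s := fun s => Real.smoothTransition.monotone.deriv_nonneg
  have hψc : Continuous (deriv ψ) :=
    (Real.smoothTransition.contDiff (n := 1)).continuous_deriv (by simp)
  set Θ : ℝ → Eu 3 → ℝ := fun s y => ψ (ζ y - C * (s - c)) with hΘ
  set Θ' : ℝ → Eu 3 → ℝ := fun s y => deriv ψ (ζ y - C * (s - c)) * (-C) with hΘ'
  have hΘd : ∀ s, ∀ y ∈ U, HasDerivAt (fun s => Θ s y) (Θ' s y) s := fun s y _ => by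
    have := (hψd (ζ y - C * (s - c))).comp s
      ((((hasDerivAt_id s).sub_const c).const_mul C).const_sub (ζ y))
    simpa [hΘ', hΘ, Function.comp_def] using this
  have hζc := hζ.continuous
  have hΘc : Continuous fun p : ℝ × Eu 3 => Θ p.1 p.2 :=
    Real.smoothTransition.continuous.comp (by fun_prop)
  have hΘ'c : Continuous fun p : ℝ × Eu 3 => Θ' p.1 p.2 :=
    (hψc.comp (by fun_prop)).mul continuous_const
  set F : ℝ → ℝ := fun s => ∫ y in U, Θ s y * nsq (u s y) * w y with hF
  have hFd : ∀ s ∈ Ioc c d, ∃ F', HasDerivAt F F' s ∧ F' ≤ 0 := fun s hs => by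
    have h1 := S.hasDerivAt_energy (hL s hs) (g := 0)
      ⟨contDiff_const, HasCompactSupport.zero, by simp⟩ hΘd hΘc.continuousOn hΘ'c.continuousOn
    simp only [Pi.zero_apply, sub_zero] at h1
    refine ⟨_, h1, ?_⟩
    have hus := (S.isTest s)
    have hΘs : ContDiff ℝ ∞ (Θ s) := Real.smoothTransition.contDiff.comp (hζ.sub contDiff_const)
    have h2 := S.abs_integral_im_le hΘs.contDiffOn hus
      (b := fun y => deriv ψ (ζ y - C * (s - c)) * |D|)
      ((hψc.comp (by fun_prop)).mul continuous_const).continuousOn fun y hy j i k => by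
        have : pd j (Θ s) y = deriv ψ (ζ y - C * (s - c)) * pd j ζ y := by
          have h3 := (hψd (ζ y - C * (s - c))).comp_hasFDerivAt y
            ((hζ.contDiffAt.differentiableAt (by simp)).hasFDerivAt.sub_const (C * (s - c)))
          have h4 : fderiv ℝ (Θ s) y = _ := h3.fderiv
          rw [pd, h4]
          rfl
        rw [this, abs_mul, abs_of_nonneg (hψ0 _), mul_left_comm]
        exact mul_le_mul_of_nonneg_left (hD' y hy j i k) (hψ0 _)
    have hsc : s ∈ Icc a b := ⟨hac.trans hs.1.le, hs.2.trans hdb⟩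
    have i1 : IntegrableOn (fun y => Θ' s y * nsq (u s y) * w y) U :=
      S.integrableOn_of_test hus ((((hψc.comp (by fun_prop)).mul
        continuous_const).mul (continuous_nsq.comp hus.1.continuous)).continuousOn.mul S.contw)
        fun y hy => by simp [hy]
    have i2 : IntegrableOn (fun y => Θ s y * (2 * ∑ c, (conj (u s y c) *
        Hop A B (u s) y c).im) * w y) U := by
      refine S.integrableOn_of_test hus ((hΘs.continuous.continuousOn.mul (continuousOn_const.mul
          (continuousOn_finsetSum _ fun c _ => Complex.continuous_im.comp_continuousOn
          ((Complex.continuous_conj.comp_continuousOn (continuousOn_pi.1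
            hus.1.continuous.continuousOn c)).mul
          (continuousOn_pi.1 (S.isTest_hop s).1.continuous.continuousOn c))))).mul S.contw)
          fun x hx => ?_
      simp only [hx]
      simp
    have i3 : IntegrableOn (fun y => deriv ψ (ζ y - C * (s - c)) * nsq (u s y) * w y) U :=
      S.integrableOn_of_test hus (((hψc.comp (by fun_prop)).mul
        (continuous_nsq.comp hus.1.continuous)).continuousOn.mul S.contw)
        fun y hy => by simp [hy]
    set I := ∫ y in U, deriv ψ (ζ y - C * (s - c)) * nsq (u s y) * w y with hI
    have hI0 : 0 ≤ I := setIntegral_nonneg hU.measurableSet fun y hy =>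
      mul_nonneg (mul_nonneg (hψ0 _) (nsq_nonneg _)) (S.posw y hy).le
    have e1 : ∫ y in U, (Θ' s y * nsq (u s y) + Θ s y * ((φ s)⁻¹ * (2 * ∑ c, (conj (u s y c) *
        Hop A B (u s) y c).im))) * w y = -C * I + (φ s)⁻¹ * ∫ y in U, Θ s y * (2 * ∑ c,
          (conj (u s y c) * Hop A B (u s) y c).im) * w y := by
      rw [hI, ← integral_const_mul, ← integral_const_mul, ← integral_add (i3.const_mul _)
        (i2.const_mul _)]
      refine setIntegral_congr_fun hU.measurableSet fun y hy => ?_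
      simp only [hΘ']
      ring
    have e2 : ∫ y in U, 12 * (deriv ψ (ζ y - C * (s - c)) * |D|) * nsq (u s y) * w y =
        12 * |D| * I := by
      rw [hI, ← integral_const_mul]
      refine setIntegral_congr_fun hU.measurableSet fun y hy => ?_
      ring
    rw [e1]
    rw [e2] at h2
    have h3 := (le_abs_self _).trans h2
    have h4 : (φ s)⁻¹ * ∫ y in U, Θ s y * (2 * ∑ c,
          (conj (u s y c) * Hop A B (u s) y c).im) * w y ≤ |Λ| * (12 * |D| * I) :=
      (mul_le_mul_of_nonneg_left h3 (inv_pos.2 (S.posφ s)).le).trans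
        (mul_le_mul_of_nonneg_right (hφΛ s hsc) (by positivity))
    rw [hC]
    nlinarith
  have hFanti : ∀ s ∈ Ioc c t, F t ≤ F s := fun s hs => by
    have hsub : Icc s t ⊆ Ioc c d := fun r hr => ⟨hs.1.trans_le hr.1, hr.2.trans ht.2⟩
    have : AntitoneOn F (Icc s t) := by
      refine antitoneOn_of_deriv_nonpos (convex_Icc s t) (fun r hr => ?_) (fun r hr => ?_)
        fun r hr => ?_
      · obtain ⟨_, h, _⟩ := hFd r (hsub hr)
        exact h.continuousAt.continuousWithinAt
      · obtain ⟨_, h, _⟩ := hFd r (hsub (interior_subset hr))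
        exact h.differentiableAt.differentiableWithinAt
      · obtain ⟨_, h, h'⟩ := hFd r (hsub (interior_subset hr))
        rwa [h.deriv]
    exact this (left_mem_Icc.2 hs.2) (right_mem_Icc.2 hs.2) hs.2
  set E := ∫ y in U, nsq (Hop A B (u t) y) * w y with hE
  have hFE : ∀ s ∈ Ioc c t, F s ≤ (exp (|Λ| * (s - c)) - 1) * E := fun s hs => by
    have hEs : ∫ y in U, nsq (Hop A B (u s) y) * w y = E :=
      (S.hop.charge_eq hs.2 fun q hq => unifAt_hop (hL q
        ⟨hs.1.trans_le hq.1, hq.2.trans ht.2⟩)).symm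
    have h0 : 0 ≤ E := setIntegral_nonneg hU.measurableSet fun y hy =>
      mul_nonneg (nsq_nonneg _) (S.posw y hy).le
    have hus := S.isTest s
    set L := tsupport (u s) with hLdef
    have hLc : IsCompact L := hus.2.1
    have hLU : L ⊆ U := hus.2.2
    set g : ℝ → ℝ := fun r => ∫ y in L, (Θ s y * nsq (u s y - u r y)) * w y with hg
    have hg0 : g c = F s := by
      simp only [hg, hF]
      rw [setIntegral_eq_compact hU hLU fun y _ hy => by
        rw [image_eq_zero_of_notMem_tsupport hy]; simp]
      refine setIntegral_congr_fun hLc.measurableSet fun y hy => ?_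
      by_cases hyK : y ∈ K
      · have : Θ s y = 0 := by
          simp only [hΘ]
          refine Real.smoothTransition.zero_of_nonpos ?_
          rw [hζ0 y hyK]
          nlinarith [hs.1]
        simp [this]
      · simp [hu0 y hyK]
    have hgle : ∀ r ∈ Ioc c s, g r ≤ (exp (|Λ| * (s - r)) - 1) * E := fun r hr => by
      have h1 := S.dist_le hr.2 (fun q hq => hL q ⟨hr.1.trans_le hq.1,
        hq.2.trans (hs.2.trans ht.2)⟩) (Λ := |Λ|) fun q hq => hφΛ q
          ⟨hac.trans (hr.1.le.trans hq.1), hq.2.trans (hs.2.trans (ht.2.trans hdb))⟩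
      rw [hEs] at h1
      refine le_trans ?_ h1
      have htest : IsTest U (fun y => u s y - u r y) :=
        ⟨hus.1.sub (S.isTest r).1, hus.2.1.sub (S.isTest r).2.1,
          (tsupport_sub _ _).trans (union_subset hus.2.2 (S.isTest r).2.2)⟩
      have hi := S.integrableOn_nsq htest
      refine (setIntegral_mono_on ?_ (hi.mono_set hLU) hLc.measurableSet fun y hy => ?_).trans
        (setIntegral_mono_set hi ?_ hLU.eventuallyLE)
      · exact (((hΘc.comp (f := fun y => (s, y)) (by fun_prop)).mul (continuous_nsq.comp
          htest.1.continuous)).continuousOn.mul (S.contw.mono hLU)).integrableOn_compact hLc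
      · refine mul_le_mul_of_nonneg_right ?_ (S.posw y (hLU hy)).le
        exact mul_le_of_le_one_left (nsq_nonneg _) (Real.smoothTransition.le_one _)
      · exact (ae_restrict_iff' hU.measurableSet).2 (Filter.Eventually.of_forall fun y hy =>
          mul_nonneg (nsq_nonneg _) (S.posw y hy).le)
    have hsub : Icc c s ×ˢ L ⊆ (univ : Set ℝ) ×ˢ U := prod_mono (subset_univ _) hLU
    have hcont : ContinuousWithinAt g (Icc c s) c :=
      continuousWithinAt_setIntegral_compact hLc ((S.contw.mono hLU).integrableOn_compact hLc)
        isCompact_Icc (left_mem_Icc.2 hs.1.le)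
        ((hΘc.comp (f := fun p : ℝ × Eu 3 => (s, p.2)) (by fun_prop)).continuousOn.mul
          (continuous_nsq.comp_continuousOn ((hus.1.continuous.comp
            continuous_snd).continuousOn.sub (S.smooth.continuousOn hsub))))
    rw [← hg0]
    have ht1 : Filter.Tendsto g (𝓝[>] c) (𝓝 (g c)) := by
      have := hcont.mono (Ioc_subset_Icc_self (a := c) (b := s))
      rwa [ContinuousWithinAt, nhdsWithin_Ioc_eq_nhdsGT hs.1] at this
    have ht2 : Filter.Tendsto (fun r => (exp (|Λ| * (s - r)) - 1) * E) (𝓝[>] c)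
        (𝓝 ((exp (|Λ| * (s - c)) - 1) * E)) :=
      (Continuous.tendsto (by fun_prop) c).mono_left nhdsWithin_le_nhds
    exact le_of_tendsto_of_tendsto ht1 ht2 (Filter.eventually_of_mem (Ioc_mem_nhdsGT hs.1) hgle)
  have hFt : F t ≤ 0 := by
    have ht2 : Filter.Tendsto (fun s => (exp (|Λ| * (s - c)) - 1) * E) (𝓝[>] c) (𝓝 0) := by
      have : (fun s => (exp (|Λ| * (s - c)) - 1) * E) c = 0 := by simp
      rw [← this]
      exact (Continuous.tendsto (by fun_prop) c).mono_left nhdsWithin_le_nhds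
    exact ge_of_tendsto ht2 (Filter.eventually_of_mem (Ioc_mem_nhdsGT ht.1)
      fun s hs => (hFanti s hs).trans (hFE s hs))
  by_cases hxU : x ∈ U
  · have hut := S.isTest t
    have hnn : ∀ y ∈ U, 0 ≤ Θ t y * nsq (u t y) * w y := fun y hy =>
      mul_nonneg (mul_nonneg (Real.smoothTransition.nonneg _) (nsq_nonneg _)) (S.posw y hy).le
    have hco : ContinuousOn (fun y => Θ t y * nsq (u t y) * w y) U :=
      (((hΘc.comp (f := fun y => (t, y)) (by fun_prop)).mul (continuous_nsq.comp
          hut.1.continuous)).continuousOn.mul S.contw)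
    have h1 := eq_zero_of_setIntegral_eq_zero hU hco hnn
      (S.integrableOn_of_test hut hco fun y hy => by simp [hy])
      (le_antisymm hFt (setIntegral_nonneg hU.measurableSet hnn)) x hxU
    have h2 : 0 < Θ t x := by
      refine Real.smoothTransition.pos_of_pos ?_
      rw [hζ1 x hx]
      have : t - c < C⁻¹ := lt_of_le_of_lt (by linarith [ht.2]) hdc
      rw [lt_inv_comm₀, ← one_div, lt_div_iff₀] at this <;> nlinarith [ht.1]
    have h3 := S.posw x hxU
    exact nsq_eq_zero (by
      rcases mul_eq_zero.1 h1 with h | h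
      · exact (mul_eq_zero.1 h).resolve_left h2.ne'
      · exact absurd h h3.ne')
  · exact image_eq_zero_of_notMem_tsupport fun h => hxU ((S.isTest t).2.2 h)

end DSol

end FiniteSpeed

section UniformSupport

variable {U : Set (Eu 3)} {A : Fin 3 → Eu 3 → Fin 4 → Fin 4 → ℂ} {B : Eu 3 → Fin 4 → Fin 4 → ℂ}
  {w : Eu 3 → ℝ} {φ : ℝ → ℝ} {u : ℝ → Eu 3 → Fin 4 → ℂ}

/-- A nonempty closed set of times contains a relatively open nonempty part on which the supports
of `u` lie in a common compact set. -/
theorem DSol.exists_local_support (S : DSol U w φ A B u) {T : Set ℝ} (hT : IsClosed T)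
    (hne : T.Nonempty) : ∃ t₀ ∈ T, ∃ ε > 0, ∃ K, IsCompact K ∧ K ⊆ U ∧
      ∀ t ∈ T, |t - t₀| < ε → ∀ x, x ∉ K → u t x = 0 := by
  have : LocallyCompactSpace U := S.isOpen.locallyCompactSpace
  let Ke := CompactExhaustion.choice U
  have hKe : ∀ n, IsCompact (((↑) : U → Eu 3) '' Ke n) := fun n =>
    (Ke.isCompact n).image continuous_subtype_val
  have : CompleteSpace T := hT.completeSpace_coe
  have : Nonempty T := hne.to_subtype
  obtain ⟨n, hn⟩ := nonempty_interior_of_iUnion_of_closed (X := T)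
    (f := fun n => {t : T | ∀ x ∈ U, x ∉ ((↑) : U → Eu 3) '' Ke n → u t x = 0}) (fun n => by
      simp only [ofPred_forall]
      refine isClosed_iInter fun x => isClosed_iInter fun hx => isClosed_iInter fun _ => ?_
      refine isClosed_eq (Continuous.comp (g := fun t : ℝ => u t x) ?_ continuous_subtype_val)
        continuous_const
      exact continuous_iff_continuousAt.2 fun t => (S.hasDerivAt_vec t hx).continuousAt) (by
      refine eq_univ_of_forall fun t => mem_iUnion.2 ?_
      obtain ⟨n, hn⟩ := Ke.exists_superset_of_isCompact
        (s := ((↑) : U → Eu 3) ⁻¹' tsupport (u t))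
        ((S.isOpen.isOpenEmbedding_subtypeVal.isInducing.isCompact_preimage_iff
          (by simpa using (S.supp t).2)).2 (S.supp t).1)
      refine ⟨n, fun x hx hxn => image_eq_zero_of_notMem_tsupport fun h => hxn ?_⟩
      exact ⟨⟨x, hx⟩, hn h, rfl⟩)
  obtain ⟨t₀, ht₀⟩ := hn
  obtain ⟨ε, hε, hball⟩ := Metric.isOpen_iff.1 isOpen_interior t₀ ht₀
  refine ⟨t₀, t₀.2, ε, hε, _, hKe n, by rintro _ ⟨x, _, rfl⟩; exact x.2, fun t ht htε x hx => ?_⟩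
  by_cases hxU : x ∈ U
  · exact interior_subset (hball (a := ⟨t, ht⟩)
      (by simpa [Subtype.dist_eq, Real.dist_eq] using htε))
      x hxU hx
  · exact image_eq_zero_of_notMem_tsupport fun h => hxU ((S.supp t).2 h)

/-- One-sided version of the local uniformity of supports. -/
theorem DSol.support_right (S : DSol U w φ A B u) {t₀ ε : ℝ} (hε : 0 < ε) {K : Set (Eu 3)}
    (hK : IsCompact K) (hKU : K ⊆ U) (ht₀ : ¬ UnifAt U u t₀)
    (h0 : ∀ t, ¬ UnifAt U u t → |t - t₀| < ε → ∀ x, x ∉ K → u t x = 0) :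
    ∃ δ > 0, ∃ K', IsCompact K' ∧ K' ⊆ U ∧ ∀ t, t₀ ≤ t → t - t₀ < δ → ∀ x, x ∉ K' → u t x = 0 := by
  obtain ⟨κ, hκ, K', hK', hK'U, H⟩ := S.finite_speed t₀ (t₀ + ε) hK hKU
  refine ⟨min ε κ, lt_min hε hκ, K ∪ K', hK.union hK', union_subset hKU hK'U,
    fun t htt ht x hx => ?_⟩
  have hx1 : x ∉ K := fun h => hx (Or.inl h)
  have hx2 : x ∉ K' := fun h => hx (Or.inr h)
  have htε := ht.trans_le (min_le_left _ _)
  have htκ := ht.trans_le (min_le_right _ _)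
  have habs : ∀ s ∈ Icc t₀ t, |s - t₀| < ε := fun s hs => by
    rw [abs_of_nonneg (by linarith [hs.1])]
    linarith [hs.2]
  by_cases hb : UnifAt U u t
  · set Z : Set ℝ := {s | ¬ UnifAt U u s} ∩ Icc t₀ t with hZ
    have hZc : IsCompact Z := isCompact_Icc.inter_left (UnifAt.isOpen U u).isClosed_compl
    obtain ⟨c, hcZ, hc⟩ := hZc.exists_isGreatest ⟨t₀, ht₀, left_mem_Icc.2 htt⟩
    have hct : c < t := lt_of_le_of_ne hcZ.2.2 fun h => hcZ.1 (h ▸ hb)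
    refine H c t hcZ.2.1 (by linarith) (by linarith [hcZ.2.1]) (h0 c hcZ.1 (habs c hcZ.2))
      (fun s hs => ?_) t (right_mem_Ioc.2 hct) x hx2
    by_contra hs'
    exact absurd (hc ⟨hs', hcZ.2.1.trans hs.1.le, hs.2⟩) (not_le.2 hs.1)
  · exact h0 t hb (habs t (right_mem_Icc.2 htt)) x hx1

theorem UnifAt.comp_neg {t : ℝ} (h : UnifAt U u t) : UnifAt U (fun s => u (-s)) (-t) := by
  obtain ⟨ε, hε, K, hK, hKU, h0⟩ := h
  refine ⟨ε, hε, K, hK, hKU, fun s hs => h0 (-s) ?_⟩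
  rw [← abs_neg]
  convert hs using 2
  ring

/-- The supports of a solution are locally uniformly compact in time. -/
theorem DSol.unifAt (S : DSol U w φ A B u) (t : ℝ) : UnifAt U u t := by
  by_contra ht
  obtain ⟨t₀, ht₀, ε, hε, K, hK, hKU, h0⟩ := S.exists_local_support
    (UnifAt.isOpen U u).isClosed_compl ⟨t, ht⟩
  have h0' : ∀ t, ¬ UnifAt U u t → |t - t₀| < ε → ∀ x, x ∉ K → u t x = 0 := fun t ht => h0 t ht
  obtain ⟨δ, hδ, K', hK', hK'U, h1⟩ := S.support_right hε hK hKU ht₀ h0'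
  obtain ⟨δ', hδ', K'', hK'', hK''U, h2⟩ := S.reverse.support_right (t₀ := -t₀) hε hK hKU
    (fun h => ht₀ (by simpa using h.comp_neg)) fun s hs hs' => h0' (-s)
      (fun h => hs (by simpa using h.comp_neg)) (by
        rw [← abs_neg]
        convert hs' using 2
        ring)
  refine ht₀ ⟨min δ δ', lt_min hδ hδ', K' ∪ K'', hK'.union hK'', union_subset hK'U hK''U,
    fun s hs x hx => ?_⟩
  rcases le_total t₀ s with h | h
  · exact h1 s h ((le_abs_self _).trans_lt (hs.trans_le (min_le_left _ _))) x
      fun hx' => hx (Or.inl hx')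
  · have := h2 (-s) (by linarith) (by
      linarith [neg_abs_le (s - t₀), hs.trans_le (min_le_right _ _)]) x fun hx' => hx (Or.inr hx')
    simpa using this

/-- The supports over a compact time interval lie in a common compact set. -/
theorem DSol.exists_support (S : DSol U w φ A B u) (a b : ℝ) :
    ∃ K, IsCompact K ∧ K ⊆ U ∧ ∀ t ∈ Icc a b, ∀ x, x ∉ K → u t x = 0 := by
  refine isCompact_Icc.induction_on (p := fun J => ∃ K, IsCompact K ∧ K ⊆ U ∧
    ∀ t ∈ J, ∀ x, x ∉ K → u t x = 0) ⟨∅, isCompact_empty, empty_subset _, by simp⟩ ?_ ?_ ?_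
  · rintro s t hst ⟨K, hK, hKU, h⟩
    exact ⟨K, hK, hKU, fun r hr => h r (hst hr)⟩
  · rintro s t ⟨K, hK, hKU, h⟩ ⟨K', hK', hKU', h'⟩
    refine ⟨K ∪ K', hK.union hK', union_subset hKU hKU', fun r hr x hx => ?_⟩
    rcases hr with hr | hr
    · exact h r hr x fun hx' => hx (Or.inl hx')
    · exact h' r hr x fun hx' => hx (Or.inr hx')
  · intro t _
    obtain ⟨ε, hε, K, hK, hKU, h0⟩ := S.unifAt t
    exact ⟨Metric.ball t ε, mem_nhdsWithin_of_mem_nhds (Metric.ball_mem_nhds t hε), K, hK, hKU,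
      fun s hs => h0 s (by simpa [Real.dist_eq] using hs)⟩

/-- Conservation of the charge. -/
theorem DSol.charge_const (S : DSol U w φ A B u) (s t : ℝ) :
    ∫ x in U, nsq (u t x) * w x = ∫ x in U, nsq (u s x) * w x := by
  rcases le_total s t with h | h
  · exact S.charge_eq h fun r _ => S.unifAt r
  · exact (S.charge_eq h fun r _ => S.unifAt r).symm

end UniformSupport

section SpectralCutoff

open UniformSpace in
/-- A bounded self-adjoint inverse of `1 + L` for a nonnegative symmetric operator `L` (Friedrichs),
the form norm being the norm of the domain. -/
theorem exists_isSelfAdjoint_of_form {D E : Type*} [SeminormedAddCommGroup D]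
    [InnerProductSpace ℂ D] [NormedAddCommGroup E] [InnerProductSpace ℂ E] [CompleteSpace E]
    (ι L : D →ₗ[ℂ] E) (h : ∀ x y : D, inner ℂ x y = inner ℂ (ι x) (ι y + L y))
    (hL : ∀ x, 0 ≤ (inner ℂ (ι x) (L x)).re) :
    ∃ T : E →L[ℂ] E, IsSelfAdjoint T ∧ ∀ x, T (ι x + L x) = ι x := by
  have hb : ∀ x, ‖ι x‖ ≤ 1 * ‖x‖ := fun x => by
    rw [one_mul]
    refine le_of_sq_le_sq ?_ (norm_nonneg _)
    have h1 : (inner ℂ x x).re = ‖x‖ ^ 2 := by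
      rw [inner_self_eq_norm_sq_to_K]
      norm_cast
    have h2 : (inner ℂ (ι x) (ι x)).re = ‖ι x‖ ^ 2 := by
      rw [inner_self_eq_norm_sq_to_K]
      norm_cast
    rw [← h1, ← h2, h, inner_add_right, Complex.add_re]
    linarith [hL x]
  set J₀ : D →L[ℂ] E := ι.mkContinuous 1 hb
  set J : Completion D →L[ℂ] E := J₀.extend Completion.toComplL with hJ
  have hJc : ∀ x : D, J (x : Completion D) = ι x := fun x =>
    ContinuousLinearMap.extend_eq J₀ Completion.denseRange_coe
      (Completion.isUniformInducing_coe D) x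
  set T : E →L[ℂ] E := J ∘L ContinuousLinearMap.adjoint J
  refine ⟨T, ?_, fun y => ?_⟩
  · rw [ContinuousLinearMap.isSelfAdjoint_iff']
    simp [T, ContinuousLinearMap.adjoint_comp]
  · have : ContinuousLinearMap.adjoint J (ι y + L y) = (y : Completion D) := by
      refine ext_inner_left ℂ fun v => ?_
      refine Completion.induction_on v (isClosed_eq (by fun_prop) (by fun_prop)) fun x => ?_
      rw [ContinuousLinearMap.adjoint_inner_right, hJc, Completion.inner_coe, h]
    change J (ContinuousLinearMap.adjoint J (ι y + L y)) = ι y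
    rw [this, hJc]

theorem exists_isSelfAdjoint_of_symm {D E : Type*} [AddCommGroup D] [Module ℂ D]
    [NormedAddCommGroup E] [InnerProductSpace ℂ E] [CompleteSpace E]
    (ι L : D →ₗ[ℂ] E) (h : ∀ x y, inner ℂ (ι x) (L y) = inner ℂ (L x) (ι y))
    (hL : ∀ x, 0 ≤ (inner ℂ (ι x) (L x)).re) :
    ∃ T : E →L[ℂ] E, IsSelfAdjoint T ∧ ∀ x, T (ι x + L x) = ι x := by
  let core : PreInnerProductSpace.Core ℂ D :=
    { inner := fun x y => inner ℂ (ι x) (ι y + L y)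
      conj_inner_symm := fun x y => by
        simp only [inner_add_right, map_add, inner_conj_symm, h x y]
      re_inner_nonneg := fun x => by
        rw [inner_add_right, map_add]
        exact add_nonneg inner_self_nonneg (hL x)
      add_left := fun x y z => by rw [map_add, inner_add_left]
      smul_left := fun x y r => by rw [map_smul, inner_smul_left] }
  let : SeminormedAddCommGroup D := InnerProductSpace.Core.toSeminormedAddCommGroup (c := core)
  let : InnerProductSpace ℂ D := InnerProductSpace.ofCore core
  exact exists_isSelfAdjoint_of_form ι L (fun _ _ => rfl) hL

variable {δ : ℝ}

theorem cutoff_mul_eq (hδ : 0 < δ) (t : ℝ) :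
    t * (max 0 (|t| - δ) / max |t| δ * (t / max (t ^ 2) (δ ^ 2) - 1)) =
      (1 - t) * (max 0 (|t| - δ) / max |t| δ) := by
  rcases le_total |t| δ with h | h
  · rw [max_eq_left (by linarith)]
    simp
  · have h1 : max (t ^ 2) (δ ^ 2) = t ^ 2 :=
      max_eq_left (by rw [← sq_abs t]; exact pow_le_pow_left₀ hδ.le h 2)
    have h2 : t ≠ 0 := fun h0 => by rw [h0, abs_zero] at h; linarith
    rw [h1]
    field_simp

theorem abs_cutoff_le (hδ : 0 < δ) (t : ℝ) : |max 0 (|t| - δ) / max |t| δ| ≤ 1 := by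
  rw [abs_of_nonneg (div_nonneg (le_max_left _ _) (hδ.le.trans (le_max_right _ _)))]
  refine div_le_one_of_le₀ (max_le (hδ.le.trans (le_max_right _ _)) ?_)
    (hδ.le.trans (le_max_right _ _))
  exact le_trans (by linarith) (le_max_left _ _)

theorem abs_div_max_sq_le (hδ : 0 < δ) (t : ℝ) : |t / max (t ^ 2) (δ ^ 2)| ≤ δ⁻¹ := by
  have h0 : 0 < max (t ^ 2) (δ ^ 2) := lt_max_of_lt_right (by positivity)
  rw [abs_div, abs_of_pos h0, div_le_iff₀ h0, inv_mul_eq_div, le_div_iff₀ hδ]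
  rcases le_total |t| δ with h | h
  · exact le_trans (by nlinarith) (le_max_right _ _)
  · refine le_trans ?_ (le_max_left _ _)
    rw [← sq_abs t]
    nlinarith

theorem abs_sub_cutoff_mul_le (hδ : 0 < δ) (t : ℝ) :
    |t - max 0 (|t| - δ) / max |t| δ * t| ≤ δ := by
  rcases le_total |t| δ with h | h
  · rw [max_eq_left (by linarith)]
    simpa using h
  · rw [max_eq_right (by linarith), max_eq_left h]
    have h2 : 0 < |t| := hδ.trans_le h
    have : t - (|t| - δ) / |t| * t = δ * (t / |t|) := by field_simp; ring
    rw [this, abs_mul, abs_div, abs_abs, div_self h2.ne', mul_one, abs_of_pos hδ]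

/-- If a nonnegative symmetric operator annihilates `ι z` weakly against all of its
bandlimited vectors, then `ι z = 0`. -/
theorem eq_zero_of_bandlimited {D E : Type*} [AddCommGroup D] [Module ℂ D]
    [NormedAddCommGroup E] [InnerProductSpace ℂ E] [CompleteSpace E]
    (ι L : D →ₗ[ℂ] E) (h : ∀ x y, inner ℂ (ι x) (L y) = inner ℂ (L x) (ι y))
    (hL : ∀ x, 0 ≤ (inner ℂ (ι x) (L x)).re) (z : D)
    (hz : ∀ (Y : ℕ → E) (C Γ : ℝ), 0 ≤ C → 0 ≤ Γ → (∀ n, ‖Y n‖ ≤ C * Γ ^ n) →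
      (∀ n ψ, inner ℂ (Y n) (L ψ) = inner ℂ (Y (n + 1)) (ι ψ)) → inner ℂ (Y 0) (ι z) = 0) :
    ι z = 0 := by
  obtain ⟨T, hT, hTι⟩ := exists_isSelfAdjoint_of_symm ι L h hL
  suffices H : ∀ δ > 0, ‖ι z‖ ≤ δ * ‖ι z + L z‖ by
    have : Filter.Tendsto (fun δ : ℝ => δ * ‖ι z + L z‖) (𝓝[>] 0) (𝓝 (0 * ‖ι z + L z‖)) :=
      (Continuous.tendsto (by fun_prop) 0).mono_left nhdsWithin_le_nhds
    rw [zero_mul] at this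
    exact norm_le_zero_iff.1 (ge_of_tendsto this
      (Filter.eventually_of_mem self_mem_nhdsWithin fun δ hδ => H δ hδ))
  intro δ hδ
  set f : ℝ → ℝ := fun t => max 0 (|t| - δ) / max |t| δ with hf
  set k : ℝ → ℝ := fun t => t / max (t ^ 2) (δ ^ 2) with hk
  have hfc : Continuous f := by
    refine Continuous.div (by fun_prop) (by fun_prop) fun t => ?_
    exact (lt_max_of_lt_right hδ).ne'
  have hkc : Continuous k := by
    refine Continuous.div (by fun_prop) (by fun_prop) fun t => ?_
    exact (lt_max_of_lt_right (by positivity)).ne'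
  set g : ℕ → ℝ → ℝ := fun n t => f t * (k t - 1) ^ n with hg
  have hgc : ∀ n, Continuous (g n) := fun n => by fun_prop
  have hrec : ∀ n, T * cfc (g (n + 1)) T = (1 - T) * cfc (g n) T := fun n => by
    have e1 : (1 : E →L[ℂ] E) - T = cfc (fun t : ℝ => 1 - t) T := by
      rw [cfc_sub (fun _ => (1 : ℝ)) (fun t => t) T (by fun_prop) (by fun_prop),
            cfc_const_one ℝ T hT,
        cfc_id' ℝ T hT]
    rw [e1]
    nth_rewrite 1 [← cfc_id' ℝ T hT]
    rw [← cfc_mul (fun t => t) _ T (by fun_prop) (hgc _).continuousOn,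
      ← cfc_mul _ _ T (by fun_prop) (hgc _).continuousOn]
    refine cfc_congr fun t _ => ?_
    have := cutoff_mul_eq hδ t
    simp only [hg, pow_succ (k t - 1) n]
    simp only [hf, hk]
    linear_combination (t / max (t ^ 2) (δ ^ 2) - 1) ^ n * this
  have hsa : ∀ n, IsSelfAdjoint (cfc (g n) T) := fun n => cfc_predicate (g n) T
  have hmain : cfc (g 0) T (ι z) = 0 := by
    refine ext_inner_left ℂ fun Z => ?_
    rw [inner_zero_right]
    have hsym : inner ℂ Z (cfc (g 0) T (ι z)) = inner ℂ (cfc (g 0) T Z) (ι z) :=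
      ((hsa 0).isSymmetric Z (ι z)).symm
    rw [hsym]
    refine hz (fun n => cfc (g n) T Z) ‖Z‖ (δ⁻¹ + 1) (norm_nonneg _) (by positivity)
      (fun n => ?_) fun n ψ => ?_
    · refine (ContinuousLinearMap.le_opNorm _ _).trans ?_
      rw [mul_comm]
      refine mul_le_mul_of_nonneg_left (norm_cfc_le (by positivity) fun t _ => ?_) (norm_nonneg _)
      rw [Real.norm_eq_abs, abs_mul, abs_pow]
      refine (mul_le_mul (abs_cutoff_le hδ t) (pow_le_pow_left₀ (abs_nonneg _)
        ((abs_sub _ _).trans (add_le_add (abs_div_max_sq_le hδ t) (by simp))) n)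
        (by positivity) zero_le_one).trans_eq (one_mul _)
    · have h1 : L ψ = (1 - T) (ι ψ + L ψ) := by
        change L ψ = (ι ψ + L ψ) - T (ι ψ + L ψ)
        rw [hTι]
        abel
      have h2 : IsSelfAdjoint (1 - T) := (IsSelfAdjoint.one _).sub hT
      have h3 : inner ℂ (cfc (g (n + 1)) T Z) (ι ψ) =
          inner ℂ (cfc (g (n + 1)) T Z) (T (ι ψ + L ψ)) := by rw [hTι]
      rw [h3]
      nth_rewrite 1 [h1]
      have e1 := h2.isSymmetric (cfc (g n) T Z) (ι ψ + L ψ)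
      have e2 := hT.isSymmetric (cfc (g (n + 1)) T Z) (ι ψ + L ψ)
      refine e1.symm.trans (Eq.trans ?_ e2)
      have e3 := congrArg (fun S : E →L[ℂ] E => S Z) (hrec n)
      simp only [mul_apply_eq_comp] at e3
      change inner ℂ ((1 - T) (cfc (g n) T Z)) _ = inner ℂ (T (cfc (g (n + 1)) T Z)) _
      rw [e3]
  have hle : ‖T - cfc (g 0) T * T‖ ≤ δ := by
    have e1 : T - cfc (g 0) T * T = cfc (fun t : ℝ => t - g 0 t * t) T := by
      rw [cfc_sub (fun t : ℝ => t) (fun t => g 0 t * t) T (by fun_prop)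
        ((hgc 0).mul continuous_id).continuousOn, cfc_mul (g 0) (fun t => t) T
        (hgc 0).continuousOn (by fun_prop), cfc_id' ℝ T hT]
    rw [e1]
    refine norm_cfc_le hδ.le fun t _ => ?_
    have := abs_sub_cutoff_mul_le hδ t
    simpa [hg, hf] using this
  have hfin : ι z = (T - cfc (g 0) T * T) (ι z + L z) := by
    change ι z = T (ι z + L z) - cfc (g 0) T (T (ι z + L z))
    rw [hTι, hmain, sub_zero]
  calc ‖ι z‖ = ‖(T - cfc (g 0) T * T) (ι z + L z)‖ := by rw [← hfin]
    _ ≤ ‖T - cfc (g 0) T * T‖ * ‖ι z + L z‖ := ContinuousLinearMap.le_opNorm _ _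
    _ ≤ δ * ‖ι z + L z‖ := by gcongr

end SpectralCutoff

section Schrodinger

variable {n : ℕ} {U : Set (Eu n)} {h : Eu n → Matrix (Fin n) (Fin n) ℝ} {V : Eu n → ℝ}

/-- The real part of the Hermitian form of a positive definite matrix is nonnegative. -/
theorem re_quad_nonneg {P : Matrix (Fin n) (Fin n) ℝ} (hP : P.PosDef) (z : Fin n → ℂ) :
    0 ≤ ∑ j, ∑ k, P⁻¹ j k * (conj (z j) * z k).re := by
  have h1 := hP.inv.posSemidef.dotProduct_mulVec_nonneg (fun j => (z j).re)
  have h2 := hP.inv.posSemidef.dotProduct_mulVec_nonneg (fun j => (z j).im)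
  simp only [dotProduct, Matrix.mulVec, Pi.star_apply, star_trivial, Finset.mul_sum] at h1 h2
  refine (add_nonneg h1 h2).trans_eq ?_
  rw [← Finset.sum_add_distrib]
  refine Finset.sum_congr rfl fun j _ => ?_
  rw [← Finset.sum_add_distrib]
  refine Finset.sum_congr rfl fun k _ => ?_
  simp only [Complex.mul_re, Complex.conj_re, Complex.conj_im]
  ring

/-- The Schrödinger operator `-Δ + V`. -/
def schr (h : Eu n → Matrix (Fin n) (Fin n) ℝ) (V : Eu n → ℝ) (f : Eu n → ℂ) (x : Eu n) : ℂ :=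
  -lapC h f x + ((V x : ℝ) : ℂ) * f x

theorem lapC_add (hU : IsOpen U) (hs : ∀ i j, ContDiffOn ℝ ∞ (fun x => h x i j) U)
    (hp : ∀ x ∈ U, (h x).PosDef) {f g : Eu n → ℂ} (hf : ContDiffOn ℝ ∞ f U)
    (hg : ContDiffOn ℝ ∞ g U) {x : Eu n} (hx : x ∈ U) :
    lapC h (f + g) x = lapC h f x + lapC h g x := by
  have hd : ∀ {f : Eu n → ℂ}, ContDiffOn ℝ ∞ f U → ∀ y ∈ U, DifferentiableAt ℝ f y :=
    fun hf y hy => (hf.contDiffAt (hU.mem_nhds hy)).differentiableAt (by simp)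
  simp only [lapC]
  rw [← mul_add, ← Finset.sum_add_distrib]
  congr 1
  refine Finset.sum_congr rfl fun j _ => ?_
  rw [← pd_add (hd (contDiffOn_flux hU hs hp hf j) x hx)
    (hd (contDiffOn_flux hU hs hp hg j) x hx)]
  refine pd_congr_of_isOpen hU (fun y hy => ?_) j hx
  rw [← mul_add, ← Finset.sum_add_distrib]
  congr 1
  refine Finset.sum_congr rfl fun k _ => ?_
  rw [← mul_add, ← pd_add (hd hf y hy) (hd hg y hy)]
  rfl

theorem pd_const_mul {f : Eu n → ℂ} {x : Eu n} (hf : DifferentiableAt ℝ f x) (c : ℂ) (j : Fin n) :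
    pd j (fun y => c * f y) x = c * pd j f x := by
  rw [pd_mul (differentiableAt_const c) hf, pd_const, zero_mul, zero_add]

theorem lapC_const_mul (hU : IsOpen U) (hs : ∀ i j, ContDiffOn ℝ ∞ (fun x => h x i j) U)
    (hp : ∀ x ∈ U, (h x).PosDef) {f : Eu n → ℂ} (hf : ContDiffOn ℝ ∞ f U) (c : ℂ)
    {x : Eu n} (hx : x ∈ U) :
    lapC h (fun y => c * f y) x = c * lapC h f x := by
  have hd : ∀ {f : Eu n → ℂ}, ContDiffOn ℝ ∞ f U → ∀ y ∈ U, DifferentiableAt ℝ f y :=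
    fun hf y hy => (hf.contDiffAt (hU.mem_nhds hy)).differentiableAt (by simp)
  simp only [lapC]
  rw [mul_left_comm, Finset.mul_sum (a := c)]
  congr 1
  refine Finset.sum_congr rfl fun j _ => ?_
  rw [← pd_const_mul (hd (contDiffOn_flux hU hs hp hf j) x hx)]
  refine pd_congr_of_isOpen hU (fun y hy => ?_) j hx
  rw [mul_left_comm c, Finset.mul_sum (a := c)]
  congr 1
  refine Finset.sum_congr rfl fun k _ => ?_
  rw [pd_const_mul (hd hf y hy), mul_left_comm]

theorem lapC_eq_zero_of_notMem_tsupport {f : Eu n → ℂ} {x : Eu n} (hx : x ∉ tsupport f) :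
    lapC h f x = 0 := by
  have h0 : ∀ k, ∀ y, y ∉ tsupport f → pd k f y = 0 := fun k y hy =>
    pd_eq_zero (isClosed_tsupport f) (fun y hy => image_eq_zero_of_notMem_tsupport hy) k hy
  have h1 : ∀ j, pd j (fun y => ((sdet h y : ℝ) : ℂ) *
      ∑ k, (((h y)⁻¹ j k : ℝ) : ℂ) * pd k f y) x = 0 := fun j =>
    pd_eq_zero (isClosed_tsupport f) (fun y hy => by simp [h0 _ y hy]) j hx
  simp [lapC, h1]

/-- The space of smooth functions with compact support in `U`. -/
def testSpace (U : Set (Eu n)) : Submodule ℂ (Eu n → ℂ) where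
  carrier := {f | IsTest U f}
  zero_mem' := ⟨contDiff_const, HasCompactSupport.zero, by simp [tsupport]⟩
  add_mem' {f g} hf hg := ⟨hf.1.add hg.1, hf.2.1.add hg.2.1,
    (tsupport_add f g).trans (union_subset hf.2.2 hg.2.2)⟩
  smul_mem' c f hf := ⟨contDiff_const.smul hf.1, hf.2.1.smul_left (f := fun _ => c),
    (closure_mono (Function.support_const_smul_subset c f)).trans hf.2.2⟩

theorem memLp_of_compact {K : Set (Eu n)} {f : Eu n → ℂ} (hU : IsOpen U) (hK : IsCompact K)
    (hKU : K ⊆ U) (hf : ContinuousOn f U) (h0 : ∀ x ∈ U, x ∉ K → f x = 0) :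
    MemLp f 2 (volume.restrict U) := by
  rw [memLp_two_iff_integrable_sq_norm
    (integrableOn_of_compact hU hK hKU hf h0).aestronglyMeasurable]
  exact integrableOn_of_compact hU hK hKU (hf.norm.pow 2) fun x hx hxK => by simp [h0 x hx hxK]

theorem exists_linearMap_L2 (hU : IsOpen U) (T : (Eu n → ℂ) → Eu n → ℂ)
    (hc : ∀ f, IsTest U f → ContinuousOn (T f) U)
    (h0 : ∀ f, IsTest U f → ∀ x, x ∉ tsupport f → T f x = 0)
    (ha : ∀ f g, IsTest U f → IsTest U g → ∀ x ∈ U, T (f + g) x = T f x + T g x)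
    (hm : ∀ (c : ℂ) f, IsTest U f → ∀ x ∈ U, T (c • f) x = c * T f x) :
    ∃ Λ : testSpace U →ₗ[ℂ] Lp ℂ 2 ((volume : Measure (Eu n)).restrict U),
      ∀ f : testSpace U, Λ f =ᵐ[volume.restrict U] T f := by
  have hmem : ∀ f : testSpace U, MemLp (T f) 2 (volume.restrict U) := fun f =>
    memLp_of_compact hU f.2.2.1 f.2.2.2 (hc f f.2) fun x _ hx => h0 f f.2 x hx
  refine ⟨
    { toFun := fun f => (hmem f).toLp (T f)
      map_add' := fun f g => ?_
      map_smul' := fun c f => ?_ }, fun f => (hmem f).coeFn_toLp⟩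
  · rw [← MemLp.toLp_add]
    refine MemLp.toLp_congr _ _ ((ae_restrict_iff' hU.measurableSet).2 (.of_forall fun x hx => ?_))
    exact ha f g f.2 g.2 x hx
  · rw [RingHom.id_apply, ← MemLp.toLp_const_smul]
    refine MemLp.toLp_congr _ _ ((ae_restrict_iff' hU.measurableSet).2 (.of_forall fun x hx => ?_))
    exact hm c f f.2 x hx

theorem continuousOn_schr (hU : IsOpen U) (hs : ∀ i j, ContDiffOn ℝ ∞ (fun x => h x i j) U)
    (hp : ∀ x ∈ U, (h x).PosDef) (hV : ContinuousOn V U) {f : Eu n → ℂ} (hf : IsTest U f) :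
    ContinuousOn (schr h V f) U :=
  (contDiffOn_lapC hU hs hp hf.1.contDiffOn).continuousOn.neg.add
    ((Complex.continuous_ofReal.comp_continuousOn hV).mul hf.1.continuous.continuousOn)

theorem integral_conj_mul_schr (hU : IsOpen U) (hs : ∀ i j, ContDiffOn ℝ ∞ (fun x => h x i j) U)
    (hp : ∀ x ∈ U, (h x).PosDef) (hV : ContinuousOn V U) {f g : Eu n → ℂ} (hf : IsTest U f)
    (hg : IsTest U g) :
    ∫ x in U, conj (f x) * schr h V g x * ((sdet h x : ℝ) : ℂ) =
      ∫ x in U, ((∑ j, ∑ k, (((h x)⁻¹ j k : ℝ) : ℂ) * (conj (pd j f x) * pd k g x)) +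
        ((V x : ℝ) : ℂ) * (conj (f x) * g x)) * ((sdet h x : ℝ) : ℂ) := by
  have hf0 : ∀ x, x ∉ tsupport f → f x = 0 := fun x hx => image_eq_zero_of_notMem_tsupport hx
  have hdf0 : ∀ j x, x ∉ tsupport f → pd j f x = 0 :=
    fun j x hx => pd_eq_zero (isClosed_tsupport f) hf0 j hx
  have hfc : ContinuousOn (fun x => conj (f x)) U :=
    (contDiffOn_conj hf.1.contDiffOn).continuousOn
  have hsc : ContinuousOn (fun x => ((sdet h x : ℝ) : ℂ)) U :=
    (contDiffOn_ofReal (contDiffOn_sdet hs hp)).continuousOn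
  have hVc : ContinuousOn (fun x => ((V x : ℝ) : ℂ)) U :=
    Complex.continuous_ofReal.comp_continuousOn hV
  have i1 : IntegrableOn (fun x => conj (f x) * lapC h g x * ((sdet h x : ℝ) : ℂ)) U :=
    integrableOn_of_compact hU hf.2.1 hf.2.2 ((hfc.mul
      (contDiffOn_lapC hU hs hp hg.1.contDiffOn).continuousOn).mul hsc)
      (fun x _ hx => by simp [hf0 x hx])
  have i2 : IntegrableOn (fun x => ((V x : ℝ) : ℂ) * (conj (f x) * g x) * ((sdet h x : ℝ) : ℂ)) U :=
    integrableOn_of_compact hU hf.2.1 hf.2.2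
      ((hVc.mul (hfc.mul hg.1.continuous.continuousOn)).mul hsc)
      (fun x _ hx => by simp [hf0 x hx])
  have i3 : IntegrableOn (fun x => (∑ j, ∑ k, (((h x)⁻¹ j k : ℝ) : ℂ) *
      (conj (pd j f x) * pd k g x)) * ((sdet h x : ℝ) : ℂ)) U := by
    refine integrableOn_of_compact hU hf.2.1 hf.2.2 (ContinuousOn.mul ?_ hsc)
      (fun x _ hx => by simp [hdf0 _ x hx])
    refine ContDiffOn.continuousOn (𝕜 := ℝ) (n := ∞) (ContDiffOn.sum fun j _ =>
      ContDiffOn.sum fun k _ => (contDiffOn_ofReal (contDiffOn_inv_entry hs hp j k)).mul ?_)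
    exact (contDiffOn_conj (contDiffOn_pd hU hf.1.contDiffOn j)).mul
      (contDiffOn_pd hU hg.1.contDiffOn k)
  simp only [add_mul]
  rw [integral_add i3 i2, ← neg_eq_iff_eq_neg.2 (integral_conj_mul_lapC hU hs hp hf hg),
    ← integral_neg]
  refine Eq.trans ?_ (integral_add i1.neg i2)
  refine setIntegral_congr_fun hU.measurableSet fun x _ => ?_
  simp only [schr]
  ring

theorem integral_conj_mul_schr_symm (hU : IsOpen U)
    (hs : ∀ i j, ContDiffOn ℝ ∞ (fun x => h x i j) U)
    (hp : ∀ x ∈ U, (h x).PosDef) (hV : ContinuousOn V U) {f g : Eu n → ℂ} (hf : IsTest U f)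
    (hg : IsTest U g) :
    ∫ x in U, conj (f x) * schr h V g x * ((sdet h x : ℝ) : ℂ) =
      conj (∫ x in U, conj (g x) * schr h V f x * ((sdet h x : ℝ) : ℂ)) := by
  rw [integral_conj_mul_schr hU hs hp hV hf hg, integral_conj_mul_schr hU hs hp hV hg hf,
    ← integral_conj]
  refine setIntegral_congr_fun hU.measurableSet fun x hx => ?_
  have hsymm : ∀ j k, (h x)⁻¹ j k = (h x)⁻¹ k j := fun j k => by
    simpa using (hp x hx).inv.isHermitian.apply k j
  simp only [map_mul, map_add, map_sum, Complex.conj_ofReal, Complex.conj_conj]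
  rw [Finset.sum_comm, mul_comm (g x)]
  congr 2
  refine Finset.sum_congr rfl fun j _ => Finset.sum_congr rfl fun k _ => ?_
  rw [hsymm, mul_comm (pd j g x)]

theorem re_integral_conj_mul_schr_nonneg (hU : IsOpen U)
    (hs : ∀ i j, ContDiffOn ℝ ∞ (fun x => h x i j) U)
    (hp : ∀ x ∈ U, (h x).PosDef) (hV : ContinuousOn V U) (hV0 : ∀ x ∈ U, 0 ≤ V x)
    {f : Eu n → ℂ} (hf : IsTest U f) :
    0 ≤ (∫ x in U, conj (f x) * schr h V f x * ((sdet h x : ℝ) : ℂ)).re := by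
  have hr := integral_conj_mul_schr hU hs hp hV hf hf
  have hint : ∀ z : Eu n → ℂ, 0 ≤ ∫ x in U, (z x).re → 0 ≤ (∫ x in U, z x).re := fun z hz => by
    by_cases hi : IntegrableOn z U
    · have := Complex.reCLM.integral_comp_comm hi
      simp only [Complex.reCLM_apply] at this
      rwa [← this]
    · rw [integral_undef hi]; simp
  rw [hr]
  refine hint _ (setIntegral_nonneg hU.measurableSet fun x hx => ?_)
  rw [Complex.re_mul_ofReal]
  refine mul_nonneg ?_ (sdet_pos (hp x hx)).le
  simp only [Complex.add_re, Complex.re_sum, Complex.re_ofReal_mul]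
  refine add_nonneg (re_quad_nonneg (hp x hx) _) (mul_nonneg (hV0 x hx) ?_)
  rw [← Complex.normSq_eq_conj_mul_self, Complex.ofReal_re]
  exact Complex.normSq_nonneg _

/-- Distributional solutions of the spectral recursion which grow at most geometrically separate
test functions. -/
theorem eq_zero_of_weak_bandlimited (hU : IsOpen U)
    (hs : ∀ i j, ContDiffOn ℝ ∞ (fun x => h x i j) U)
    (hp : ∀ x ∈ U, (h x).PosDef) (hV : ContinuousOn V U) (hV0 : ∀ x ∈ U, 0 ≤ V x)
    {z : Eu n → ℂ} (hz : IsTest U z)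
    (H : ∀ (W : ℕ → Eu n → ℂ) (Γ : ℝ), 0 ≤ Γ →
      (∀ k K, IsCompact K → K ⊆ U → IntegrableOn (W k) K) →
      (∀ K, IsCompact K → K ⊆ U → ∃ C, 0 ≤ C ∧ ∀ k, ∫ x in K, ‖W k x‖ ≤ C * Γ ^ k) →
      (∀ k ψ, IsTest U ψ → ∫ x in U, W k x * schr h V ψ x = ∫ x in U, W (k + 1) x * ψ x) →
      ∫ x in U, W 0 x * z x = 0) : ∀ x, z x = 0 := by
  set s : Eu n → ℂ := fun x => ((√(sdet h x) : ℝ) : ℂ) with hsdef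
  have hss : ∀ x, s x * s x = ((sdet h x : ℝ) : ℂ) := fun x => by
    simp only [hsdef]
    rw [← Complex.ofReal_mul, Real.mul_self_sqrt (show 0 ≤ sdet h x from Real.sqrt_nonneg _)]
  have hsconj : ∀ x, conj (s x) = s x := fun x => Complex.conj_ofReal _
  have hsc : ContinuousOn s U :=
    Complex.continuous_ofReal.comp_continuousOn (contDiffOn_sdet hs hp).continuousOn.sqrt
  have hcd : ∀ {f : Eu n → ℂ}, IsTest U f → ContDiffOn ℝ ∞ f U := fun hf => hf.1.contDiffOn
  obtain ⟨ι, hι⟩ := exists_linearMap_L2 hU (fun f x => s x * f x)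
    (fun f hf => hsc.mul hf.1.continuous.continuousOn)
    (fun f _ x hx => by simp [image_eq_zero_of_notMem_tsupport hx])
    (fun f g _ _ x _ => by simp [mul_add]) (fun c f _ x _ => by simp [mul_left_comm])
  obtain ⟨L, hL⟩ := exists_linearMap_L2 hU (fun f x => s x * schr h V f x)
    (fun f hf => hsc.mul (continuousOn_schr hU hs hp hV hf))
    (fun f _ x hx => by
      simp [schr, image_eq_zero_of_notMem_tsupport hx, lapC_eq_zero_of_notMem_tsupport hx])
    (fun f g hf hg x hx => by
      simp only [schr, lapC_add hU hs hp (hcd hf) (hcd hg) hx, Pi.add_apply]; ring)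
    (fun c f hf x hx => by
      have := lapC_const_mul hU hs hp (hcd hf) c hx
      simp only [schr, Pi.smul_apply, smul_eq_mul]
      rw [show c • f = fun y => c * f y from rfl, this]; ring)
  have hιL : ∀ f g : testSpace U, inner ℂ (ι f) (L g) =
      ∫ x in U, conj (f.1 x) * schr h V g x * ((sdet h x : ℝ) : ℂ) := fun f g => by
    rw [L2.inner_def]
    refine integral_congr_ae ?_
    filter_upwards [hι f, hL g] with x h1 h2
    rw [h1, h2, RCLike.inner_apply, map_mul, hsconj, ← hss]
    ring
  have hιz := eq_zero_of_bandlimited ι L (fun f g => ?_) (fun f => ?_) ⟨z, hz⟩ ?_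
  · have h1 := hι ⟨z, hz⟩
    rw [hιz] at h1
    have h2 : z =ᵐ[volume.restrict U] fun _ => 0 := by
      filter_upwards [h1, Lp.coeFn_zero ℂ 2 (volume.restrict U),
        ae_restrict_mem hU.measurableSet] with x h3 h4 hx
      rw [h4] at h3
      have h5 : s x ≠ 0 := by
        simp only [hsdef]
        exact_mod_cast (Real.sqrt_pos.2 (sdet_pos (hp x hx))).ne'
      exact (mul_eq_zero.1 h3.symm).resolve_left h5
    have h3 := Measure.eqOn_open_of_ae_eq h2 hU hz.1.continuous.continuousOn continuousOn_const
    intro x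
    by_cases hx : x ∈ U
    · exact h3 hx
    · exact image_eq_zero_of_notMem_tsupport fun h' => hx (hz.2.2 h')
  · rw [hιL, ← inner_conj_symm, hιL]
    exact integral_conj_mul_schr_symm hU hs hp hV f.2 g.2
  · rw [hιL]
    exact re_integral_conj_mul_schr_nonneg hU hs hp hV hV0 f.2
  · intro Y C Γ hC hΓ hY hrec
    have hint : ∀ (k : ℕ) (T : Eu n → ℂ) (F : Lp ℂ 2 (volume.restrict U)),
        F =ᵐ[volume.restrict U] (fun x => s x * T x) →
        inner ℂ (Y k) F = ∫ x in U, (conj (Y k x) * s x) * T x := fun k T F hF => by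
      rw [L2.inner_def]
      refine integral_congr_ae ?_
      filter_upwards [hF] with x h1
      rw [h1, RCLike.inner_apply]
      ring
    have hYsq : ∀ k, Integrable (fun x => ‖Y k x‖ ^ 2) (volume.restrict U) := fun k =>
      (memLp_two_iff_integrable_sq_norm (Lp.memLp (Y k)).1).1 (Lp.memLp (Y k))
    have hYn : ∀ k, ∫ x in U, ‖Y k x‖ ^ 2 = ‖Y k‖ ^ 2 := fun k => by
      have h1 : inner ℂ (Y k) (Y k) = ((∫ x in U, ‖Y k x‖ ^ 2 : ℝ) : ℂ) := by
        rw [L2.inner_def, ← integral_complex_ofReal]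
        refine integral_congr_ae (.of_forall fun x => ?_)
        simp only [inner_self_eq_norm_sq_to_K]
        simp
      rw [inner_self_eq_norm_sq_to_K] at h1
      exact Complex.ofReal_injective (by rw [← h1]; push_cast; rfl)
    have hYi : ∀ k K, IsCompact K → K ⊆ U → IntegrableOn (Y k) K := fun k K hK hKU => by
      have : IsFiniteMeasure (volume.restrict K) := ⟨by simpa using hK.measure_lt_top⟩
      exact ((Lp.memLp (Y k)).mono_measure (Measure.restrict_mono hKU le_rfl)).integrable
        (by norm_num)
    have hYc : ∀ k K, IsCompact K → K ⊆ U →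
        IntegrableOn (fun x => conj (Y k x) * s x) K := fun k K hK hKU =>
      IntegrableOn.mul_continuousOn (by
        simpa [IntegrableOn] using
          Complex.conjCLE.toContinuousLinearMap.integrable_comp (hYi k K hK hKU))
        (hsc.mono hKU) hK
    rw [hint 0 z _ (hι _)]
    refine H (fun k x => conj (Y k x) * s x) (Γ + 1) (by positivity) hYc
      (fun K hK hKU => ?_) fun k ψ hψ => ?_
    · obtain ⟨M, hM⟩ := hK.exists_bound_of_continuousOn (hsc.mono hKU)
      have hM' : ∀ x ∈ K, ‖s x‖ ≤ max M 0 := fun x hx => (hM x hx).trans (le_max_left _ _)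
      refine ⟨max M 0 * ((C + 1) * (volume.real K + 1)), by positivity, fun k => ?_⟩
      set a : ℝ := (C + 1) * (Γ + 1) ^ k with ha
      have ha0 : 0 < a := by positivity
      have hYa : ‖Y k‖ ≤ a := (hY k).trans
        (mul_le_mul (by linarith) (pow_le_pow_left₀ hΓ (by linarith) k) (by positivity)
          (by positivity))
      have hYsqK : IntegrableOn (fun x => ‖Y k x‖ ^ 2) K :=
        (hYsq k).mono_measure (Measure.restrict_mono hKU le_rfl)
      have hcK : IntegrableOn (fun _ : Eu n => a) K :=
        integrableOn_const hK.measure_lt_top.ne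
      calc ∫ x in K, ‖conj (Y k x) * s x‖
          ≤ ∫ x in K, max M 0 * (a + ‖Y k x‖ ^ 2 / a) := by
            refine setIntegral_mono_on ?_ ?_ hK.measurableSet fun x hx => ?_
            · exact (hYc k K hK hKU).norm
            · exact (hcK.add (hYsqK.div_const a)).const_mul _
            · rw [norm_mul, RCLike.norm_conj, mul_comm]
              refine mul_le_mul (hM' x hx) ?_ (norm_nonneg _) (le_max_right _ _)
              have h1 : ‖Y k x‖ * a ≤ a * a + ‖Y k x‖ ^ 2 := by
                nlinarith [sq_nonneg (‖Y k x‖ - a), sq_nonneg (‖Y k x‖), sq_nonneg a]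
              calc ‖Y k x‖ = ‖Y k x‖ * a / a := by field_simp
                _ ≤ (a * a + ‖Y k x‖ ^ 2) / a := by gcongr
                _ = a + ‖Y k x‖ ^ 2 / a := by field_simp
        _ = max M 0 * (volume.real K * a + (∫ x in K, ‖Y k x‖ ^ 2) / a) := by
            rw [integral_const_mul, integral_add hcK (hYsqK.div_const a), setIntegral_const,
              integral_div, smul_eq_mul]
        _ ≤ max M 0 * (volume.real K * a + a) := by
            gcongr
            rw [div_le_iff₀ ha0]
            calc ∫ x in K, ‖Y k x‖ ^ 2 ≤ ∫ x in U, ‖Y k x‖ ^ 2 :=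
                  setIntegral_mono_set (hYsq k) (.of_forall fun x => by positivity)
                    hKU.eventuallyLE
              _ = ‖Y k‖ ^ 2 := hYn k
              _ ≤ a * a := by nlinarith [norm_nonneg (Y k)]
        _ = max M 0 * ((C + 1) * (volume.real K + 1)) * (Γ + 1) ^ k := by rw [ha]; ring
    · have h1 := hrec k ⟨ψ, hψ⟩
      rwa [hint k _ _ (hL _), hint (k + 1) _ _ (hι _)] at h1

end Schrodinger

section Picard

/-- Integration of a transport inequality along a curve on which `r` decreases at rate `q`. -/
theorem norm_le_of_transport {F F' : ℝ → ℂ} {r q : ℝ → ℝ} {a b A : ℝ} (m : ℕ) (hab : a ≤ b)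
    (hA : 0 ≤ A) (hF : ∀ s ∈ Icc a b, HasDerivAt F (F' s) s)
    (hr : ∀ s ∈ Icc a b, HasDerivAt r (-q s) s)
    (hb : ∀ s ∈ Icc a b, ‖F' s‖ ≤ q s * (A * (r s ^ m / m.factorial))) (hFb : F b = 0)
    (hrb : 0 ≤ r b) : ‖F a‖ ≤ A * (r a ^ (m + 1) / (m + 1).factorial) := by
  have hneg : ∀ x : ℝ, HasDerivAt (fun s : ℝ => -s) (-1) x := fun x => hasDerivAt_neg x
  have hm : ∀ x ∈ Icc (-b) (-a), -x ∈ Icc a b := fun x hx =>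
    ⟨by linarith [hx.2], by linarith [hx.1]⟩
  have h1 : ∀ x ∈ Icc (-b) (-a), HasDerivAt (fun s => F (-s)) (-F' (-x)) x := fun x hx => by
    have := (hF _ (hm x hx)).scomp x (hneg x)
    simpa [Function.comp_def] using this
  have h2 : ∀ x ∈ Icc (-b) (-a), HasDerivAt
      (fun s => A * (r (-s) ^ (m + 1) / (m + 1).factorial))
      (q (-x) * (A * (r (-x) ^ m / m.factorial))) x := fun x hx => by
    have h3 : HasDerivAt (fun s => r (-s)) (q (-x)) x := by
      have := (hr _ (hm x hx)).comp x (hneg x)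
      simpa [Function.comp_def] using this
    have h4 := ((h3.pow (m + 1)).div_const ((m + 1).factorial : ℝ)).const_mul A
    have e : q (-x) * (A * (r (-x) ^ m / m.factorial)) =
        A * (((m + 1 : ℕ) : ℝ) * r (-x) ^ (m + 1 - 1) * q (-x) / ((m + 1).factorial : ℝ)) := by
      rw [Nat.factorial_succ, Nat.add_sub_cancel]
      push_cast
      have : (m.factorial : ℝ) ≠ 0 := by positivity
      field_simp
    rw [e]
    exact h4
  have h := image_norm_le_of_norm_deriv_right_le_deriv_boundary' (f := fun s => F (-s))
    (fun x hx => (h1 x hx).continuousAt.continuousWithinAt)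
    (fun x hx => (h1 x ⟨hx.1, hx.2.le⟩).hasDerivWithinAt)
    (B := fun s => A * (r (-s) ^ (m + 1) / (m + 1).factorial))
    (by simp only [neg_neg, hFb, norm_zero]; positivity)
    (fun x hx => (h2 x hx).continuousAt.continuousWithinAt)
    (fun x hx => (h2 x ⟨hx.1, hx.2.le⟩).hasDerivWithinAt)
    (fun x hx => by simpa using hb _ (hm x ⟨hx.1, hx.2.le⟩))
    (right_mem_Icc.2 (by linarith : -b ≤ -a))
  simpa using h

/-- Uniqueness in the lateral Cauchy problem for a chain of `1+1` dimensional wave equations,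
written in characteristic form. -/
theorem lateral_picard {φ σ : ℝ → ℝ} (hφ : ∀ t, 0 < φ t) (hσ : ∀ t, HasDerivAt σ (φ t)⁻¹ t)
    {t₁ t₂ ε μ C Γ : ℝ} (hε : 0 < ε) (hμ : 0 ≤ μ) (hC : 0 ≤ C) (hΓ : 0 ≤ Γ)
    {p G G' : ℕ → ℝ → ℝ → ℂ}
    (h0 : ∀ n, ∀ t ∈ Icc t₁ t₂, ∀ r, ‖p n t r‖ ≤ C * Γ ^ n)
    (hp0 : ∀ n, ∀ t ∈ Icc t₁ t₂, ∀ r ≤ ε, p n t r = 0)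
    (hG0 : ∀ n, ∀ t ∈ Icc t₁ t₂, G n t ε = 0) (hG0' : ∀ n, ∀ t ∈ Icc t₁ t₂, G' n t ε = 0)
    (hr : ∀ n, ∀ t ∈ Icc t₁ t₂, ∀ r, 0 < r →
      HasDerivAt (p n t) ((1 / 2 : ℂ) * (G n t r + G' n t r)) r)
    (hG : ∀ n, ∀ t ∈ Icc t₁ t₂, ∀ c, 0 < c - σ t → HasDerivAt (fun s => G n s (c - σ s))
      (-(((φ t)⁻¹ : ℝ) : ℂ) * (((μ : ℝ) : ℂ) * p n t (c - σ t) +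
        ((Real.exp (-((c - σ t) / 2)) : ℝ) : ℂ) * p (n + 1) t (c - σ t))) t)
    (hG' : ∀ n, ∀ t ∈ Icc t₁ t₂, ∀ c, 0 < c + σ t → HasDerivAt (fun s => G' n s (c + σ s))
      ((((φ t)⁻¹ : ℝ) : ℂ) * (((μ : ℝ) : ℂ) * p n t (c + σ t) +
        ((Real.exp (-((c + σ t) / 2)) : ℝ) : ℂ) * p (n + 1) t (c + σ t))) t)
    (n : ℕ) {t r : ℝ} (ht : t ∈ Icc t₁ t₂) (h1 : r ≤ σ t - σ t₁) (h2 : r ≤ σ t₂ - σ t) :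
    p n t r = 0 := by
  have hmono : Monotone σ := monotone_of_deriv_nonneg (fun t => (hσ t).differentiableAt)
    fun t => by rw [(hσ t).deriv]; exact (inv_pos.2 (hφ t)).le
  have hσc : Continuous σ := continuous_iff_continuousAt.2 fun t => (hσ t).continuousAt
  have key : ∀ k : ℕ, ∀ n : ℕ, ∀ t ∈ Icc t₁ t₂, ∀ r, ε ≤ r → r ≤ σ t - σ t₁ → r ≤ σ t₂ - σ t →
      ‖p n t r‖ ≤ C * Γ ^ n * (μ + Γ) ^ k * (r ^ (2 * k) / (2 * k).factorial) := by
    intro k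
    induction k with
    | zero => intro n t ht r _ _ _; simpa using h0 n t ht r
    | succ k ih =>
      intro n
      set Λ : ℝ := C * Γ ^ n * (μ + Γ) ^ (k + 1) with hΛ
      have hΛ0 : 0 ≤ Λ := by positivity
      have src : ∀ s ∈ Icc t₁ t₂, ∀ r, ε ≤ r → r ≤ σ s - σ t₁ → r ≤ σ t₂ - σ s →
          ‖((μ : ℝ) : ℂ) * p n s r + ((Real.exp (-(r / 2)) : ℝ) : ℂ) * p (n + 1) s r‖ ≤
            Λ * (r ^ (2 * k) / (2 * k).factorial) := by
        intro s hs r hr1 hr2 hr3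
        have e1 := ih n s hs r hr1 hr2 hr3
        have e2 := ih (n + 1) s hs r hr1 hr2 hr3
        have e3 : Real.exp (-(r / 2)) ≤ 1 := Real.exp_le_one_iff.2 (by linarith)
        calc _ ≤ ‖((μ : ℝ) : ℂ) * p n s r‖ + ‖((Real.exp (-(r / 2)) : ℝ) : ℂ) * p (n + 1) s r‖ :=
              norm_add_le _ _
          _ = μ * ‖p n s r‖ + Real.exp (-(r / 2)) * ‖p (n + 1) s r‖ := by
              rw [norm_mul, norm_mul, Complex.norm_real, Complex.norm_real, Real.norm_of_nonneg hμ,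
                Real.norm_of_nonneg (Real.exp_pos _).le]
          _ ≤ μ * (C * Γ ^ n * (μ + Γ) ^ k * (r ^ (2 * k) / (2 * k).factorial)) +
              1 * (C * Γ ^ (n + 1) * (μ + Γ) ^ k * (r ^ (2 * k) / (2 * k).factorial)) := by
              gcongr
          _ = Λ * (r ^ (2 * k) / (2 * k).factorial) := by rw [hΛ]; ring
      have bG : ∀ t ∈ Icc t₁ t₂, ∀ r, ε ≤ r → r ≤ σ t - σ t₁ → r ≤ σ t₂ - σ t →
          ‖G n t r‖ ≤ Λ * (r ^ (2 * k + 1) / (2 * k + 1).factorial) := by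
        intro t ht r hr1 hr2 hr3
        obtain ⟨T, hT, hTε⟩ := intermediate_value_Icc' ht.2
          (f := fun s => r + σ t - σ s) (by fun_prop)
          (show ε ∈ Icc (r + σ t - σ t₂) (r + σ t - σ t) from ⟨by linarith, by linarith⟩)
        simp only at hTε
        have hsub : ∀ s ∈ Icc t T, s ∈ Icc t₁ t₂ := fun s hs =>
          ⟨ht.1.trans hs.1, hs.2.trans hT.2⟩
        have hrs : ∀ s ∈ Icc t T, ε ≤ r + σ t - σ s ∧ r + σ t - σ s ≤ r := fun s hs =>
          ⟨by linarith [hmono hs.2], by linarith [hmono hs.1]⟩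
        have := norm_le_of_transport (F := fun s => G n s (r + σ t - σ s))
          (r := fun s => r + σ t - σ s) (q := fun s => (φ s)⁻¹) (2 * k) hT.1 hΛ0
          (fun s hs => hG n s (hsub s hs) (r + σ t) (by linarith [(hrs s hs).1]))
          (fun s hs => (hσ s).const_sub (r + σ t)) (fun s hs => ?_) ?_ ?_
        · simpa using this
        · rw [norm_mul, norm_neg, Complex.norm_real,
            Real.norm_of_nonneg (inv_pos.2 (hφ s)).le]
          have h3 := hmono hs.1
          exact mul_le_mul_of_nonneg_left (src s (hsub s hs) _ (hrs s hs).1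
            (by linarith [(hrs s hs).2]) (by linarith)) (inv_pos.2 (hφ s)).le
        · simp only [hTε]; exact hG0 n T (hsub T ⟨hT.1, le_rfl⟩)
        · simp only [hTε]; exact hε.le
      have bG' : ∀ t ∈ Icc t₁ t₂, ∀ r, ε ≤ r → r ≤ σ t - σ t₁ → r ≤ σ t₂ - σ t →
          ‖G' n t r‖ ≤ Λ * (r ^ (2 * k + 1) / (2 * k + 1).factorial) := by
        intro t ht r hr1 hr2 hr3
        obtain ⟨T, hT, hTε⟩ := intermediate_value_Icc ht.1
          (f := fun s => r - σ t + σ s) (by fun_prop)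
          (show ε ∈ Icc (r - σ t + σ t₁) (r - σ t + σ t) from ⟨by linarith, by linarith⟩)
        simp only at hTε
        have hsub : ∀ s ∈ Icc (-t) (-T), -s ∈ Icc t₁ t₂ := fun s hs =>
          ⟨hT.1.trans (by linarith [hs.2]), le_trans (by linarith [hs.1]) ht.2⟩
        have hrs : ∀ s ∈ Icc (-t) (-T), ε ≤ r - σ t + σ (-s) ∧ r - σ t + σ (-s) ≤ r :=
          fun s hs => ⟨by linarith [hmono (show T ≤ -s by linarith [hs.2])],
            by linarith [hmono (show -s ≤ t by linarith [hs.1])]⟩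
        have := norm_le_of_transport (F := fun s => G' n (-s) (r - σ t + σ (-s)))
          (r := fun s => r - σ t + σ (-s)) (q := fun s => (φ (-s))⁻¹) (2 * k)
          (neg_le_neg hT.2) hΛ0
          (fun s hs => (hG' n (-s) (hsub s hs) (r - σ t) (by linarith [(hrs s hs).1])).scomp s
            (hasDerivAt_neg s))
          (fun s hs => ?_) (fun s hs => ?_) ?_ ?_
        · simpa using this
        · have := ((hσ (-s)).comp s (hasDerivAt_neg s)).const_add (r - σ t)
          simpa [Function.comp_def] using this
        · rw [norm_smul, norm_mul, norm_neg, norm_one, one_mul, Complex.norm_real,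
            Real.norm_of_nonneg (inv_pos.2 (hφ _)).le]
          have h3 := hmono (show -s ≤ t by linarith [hs.1])
          exact mul_le_mul_of_nonneg_left (src (-s) (hsub s hs) _ (hrs s hs).1
            (by linarith) (by linarith [(hrs s hs).2])) (inv_pos.2 (hφ _)).le
        · simp only [neg_neg, hTε]; exact hG0' n T ⟨hT.1, hT.2.trans ht.2⟩
        · simp only [neg_neg, hTε]; exact hε.le
      intro t ht r hr1 hr2 hr3
      have hB : ∀ x : ℝ, HasDerivAt (fun x => Λ * (x ^ (2 * (k + 1)) / (2 * (k + 1)).factorial))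
          (Λ * (x ^ (2 * k + 1) / (2 * k + 1).factorial)) x := fun x => by
        have h4 := ((hasDerivAt_pow (2 * (k + 1)) x).div_const
          ((2 * (k + 1)).factorial : ℝ)).const_mul Λ
        have e : Λ * (x ^ (2 * k + 1) / (2 * k + 1).factorial) =
            Λ * (((2 * (k + 1) : ℕ) : ℝ) * x ^ (2 * (k + 1) - 1) /
              ((2 * (k + 1)).factorial : ℝ)) := by
          rw [show 2 * (k + 1) = 2 * k + 1 + 1 by ring, Nat.factorial_succ (2 * k + 1),
            Nat.add_sub_cancel]
          push_cast
          have : ((2 * k + 1).factorial : ℝ) ≠ 0 := by positivity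
          field_simp
        rw [e]
        exact h4
      refine image_norm_le_of_norm_deriv_right_le_deriv_boundary (f := p n t) (a := ε) (b := r)
        (fun x hx => (hr n t ht x (hε.trans_le hx.1)).continuousAt.continuousWithinAt)
        (fun x hx => (hr n t ht x (hε.trans_le hx.1)).hasDerivWithinAt) ?_ hB ?_ ⟨hr1, le_rfl⟩
      · rw [hp0 n t ht ε le_rfl, norm_zero]; positivity
      · intro x hx
        have e1 := bG t ht x hx.1 (by linarith [hx.2]) (by linarith [hx.2])
        have e2 := bG' t ht x hx.1 (by linarith [hx.2]) (by linarith [hx.2])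
        rw [norm_mul]
        have e3 : ‖(1 / 2 : ℂ)‖ = 1 / 2 := by norm_num
        rw [e3]
        linarith [norm_add_le (G n t x) (G' n t x)]
  rcases le_total r ε with hrε | hrε
  · exact hp0 n t ht r hrε
  · rw [← norm_eq_zero]
    refine le_antisymm (ge_of_tendsto' (x := Filter.atTop) (f := fun k : ℕ =>
      C * Γ ^ n * ((√(μ + Γ) * r) ^ (2 * k) / (2 * k).factorial)) ?_ fun k => ?_) (norm_nonneg _)
    · have h3 := (FloorSemiring.tendsto_pow_div_factorial_atTop (√(μ + Γ) * r)).comp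
        (Filter.tendsto_id.const_mul_atTop' (show 0 < 2 by norm_num))
      simpa using h3.const_mul (C * Γ ^ n)
    · refine (key k n t ht r hrε h1 h2).trans_eq ?_
      rw [mul_pow, pow_mul (√(μ + Γ)), Real.sq_sqrt (by positivity)]
      ring

end Picard

section Characteristics

variable {Ω : Set (Eu 2)}

theorem pd_sub {n : ℕ} {F : Type*} [NormedAddCommGroup F] [NormedSpace ℝ F] {f g : Eu n → F}
    {x : Eu n} (hf : DifferentiableAt ℝ f x) (hg : DifferentiableAt ℝ g x) (j : Fin n) :
    pd j (fun y => f y - g y) x = pd j f x - pd j g x := by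
  simp only [pd]
  rw [fderiv_fun_sub hf hg]
  rfl

theorem JSmooth.hasDerivAt_curve (hΩ : IsOpen Ω) {g : ℝ → Eu 3 → ℂ} (hg : JSmooth (Mset Ω) g)
    {ρ : ℝ → ℝ} {ρ' t : ℝ} (hρ : HasDerivAt ρ ρ' t) (h0 : 0 < ρ t) {y : Eu 2} (hy : y ∈ Ω) :
    HasDerivAt (fun s => g s (emb (ρ s) y))
      (deriv (fun s => g s (emb (ρ t) y)) t + ((ρ' : ℝ) : ℂ) * pd 0 (g t) (emb (ρ t) y)) t := by
  have hU := isOpen_Mset hΩ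
  have hx : emb (ρ t) y ∈ Mset Ω := emb_mem_Mset.2 ⟨h0, hy⟩
  have h1 := hg.hasFDerivAt hU t hx
  have h2 : HasDerivAt (fun s => emb s y) (EuclideanSpace.single 0 1) (ρ t) := by
    simpa [pd] using hasDerivAt_comp_emb (f := fun x : Eu 3 => x) (r := ρ t) (y := y)
      differentiableAt_id
  have h3 : HasDerivAt (fun s => (s, emb (ρ s) y)) ((1 : ℝ), ρ' • EuclideanSpace.single 0 1) t :=
    (hasDerivAt_id t).prodMk (h2.scomp t hρ)
  have h4 := h1.comp_hasDerivAt t h3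
  have e : deriv (fun s => g s (emb (ρ t) y)) t + ((ρ' : ℝ) : ℂ) * pd 0 (g t) (emb (ρ t) y) =
      fderiv ℝ (fun p : ℝ × Eu 3 => g p.1 p.2) (t, emb (ρ t) y)
        ((1 : ℝ), ρ' • EuclideanSpace.single 0 1) := by
    rw [(hg.hasDerivAt hU t hx).deriv, hg.pd_eq hU t hx, ← Complex.real_smul, ← map_smul,
      ← map_add]
    simp
  rw [e]
  exact h4

theorem JSmooth.continuousOn_curve {g : ℝ → Eu 3 → ℂ} (hg : JSmooth (Mset Ω) g)
    {ρ : ℝ → ℝ} (hρ : Continuous ρ) {J : Set ℝ} (hJ : ∀ s ∈ J, 0 < ρ s) {K : Set (Eu 2)}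
    (hK : K ⊆ Ω) : ContinuousOn (fun p : ℝ × Eu 2 => g p.1 (emb (ρ p.1) p.2)) (J ×ˢ K) := by
  have h1 : Continuous fun p : ℝ × Eu 2 => (p.1, emb (ρ p.1) p.2) :=
    continuous_fst.prodMk (contDiff_emb.continuous.comp
      ((hρ.comp continuous_fst).prodMk continuous_snd))
  exact (ContDiffOn.continuousOn hg).comp h1.continuousOn fun p hp =>
    ⟨mem_univ _, emb_mem_Mset.2 ⟨hJ _ hp.1, hK hp.2⟩⟩

theorem JSmooth.hasDerivAt_integral_curve (hΩ : IsOpen Ω) {g : ℝ → Eu 3 → ℂ}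
    (hg : JSmooth (Mset Ω) g) {K : Set (Eu 2)} (hK : IsCompact K) (hKΩ : K ⊆ Ω) {W : Eu 2 → ℂ}
    (hW : IntegrableOn W K) {ρ ρ' : ℝ → ℝ} (hρ : ∀ s, HasDerivAt ρ (ρ' s) s)
    (hρ' : Continuous ρ') {t : ℝ} (h0 : 0 < ρ t) :
    HasDerivAt (fun s => ∫ y in K, g s (emb (ρ s) y) * W y)
      (∫ y in K, (deriv (fun s => g s (emb (ρ t) y)) t +
        ((ρ' t : ℝ) : ℂ) * pd 0 (g t) (emb (ρ t) y)) * W y) t := by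
  have hU := isOpen_Mset hΩ
  have hρc : Continuous ρ := continuous_iff_continuousAt.2 fun s => (hρ s).continuousAt
  obtain ⟨δ, hδ, hδ'⟩ : ∃ δ > 0, ∀ s ∈ Icc (t - δ) (t + δ), 0 < ρ s := by
    obtain ⟨δ, hδ, h⟩ := Metric.eventually_nhds_iff_ball.1
      (hρc.continuousAt.eventually (lt_mem_nhds h0))
    refine ⟨δ / 2, by positivity, fun s hs => h s ?_⟩
    rw [Metric.mem_ball, Real.dist_eq, abs_lt]
    exact ⟨by linarith [hs.1], by linarith [hs.2]⟩
  refine hasDerivAt_setIntegral_compact (𝕜 := ℂ) (t₀ := t)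
    (f := fun s y => g s (emb (ρ s) y))
    (f' := fun s y => deriv (fun s' => g s' (emb (ρ s) y)) s +
      ((ρ' s : ℝ) : ℂ) * pd 0 (g s) (emb (ρ s) y)) hK hW hδ
    (fun s hs y hy => hg.hasDerivAt_curve hΩ (hρ s) (hδ' s hs) (hKΩ hy))
    (fun s hs => ?_) ?_
  · exact (hg.continuousOn_curve hρc hδ' hKΩ).comp (f := fun y => (s, y)) (by fun_prop)
      fun y hy => ⟨hs, hy⟩
  · exact ((hg.timeDeriv hU).continuousOn_curve hρc hδ' hKΩ).add
      (((Complex.continuous_ofReal.comp hρ').comp continuous_fst).continuousOn.mul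
        ((hg.spaceDeriv hU 0).continuousOn_curve hρc hδ' hKΩ))

theorem JSmooth.const {n : ℕ} {U : Set (Eu n)} {f : Eu n → ℂ} (hf : ContDiffOn ℝ ∞ f U) :
    JSmooth U fun _ : ℝ => f :=
  hf.comp contDiff_snd.contDiffOn fun _ hp => hp.2

theorem JSmooth.add {n : ℕ} {U : Set (Eu n)} {f g : ℝ → Eu n → ℂ} (hf : JSmooth U f)
    (hg : JSmooth U g) : JSmooth U fun t x => f t x + g t x :=
  ContDiffOn.add hf hg

theorem JSmooth.sub {n : ℕ} {U : Set (Eu n)} {f g : ℝ → Eu n → ℂ} (hf : JSmooth U f)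
    (hg : JSmooth U g) : JSmooth U fun t x => f t x - g t x :=
  ContDiffOn.sub hf hg

/-- A compactly supported solution of the wave equation on the wrapped product vanishes in the
domain of dependence of the boundary component `x 0 = 0`. -/
theorem wave_eq_zero (hΩ : IsOpen Ω) {β : Eu 2 → Matrix (Fin 2) (Fin 2) ℝ}
    (hβs : ∀ i j, ContDiffOn ℝ ∞ (fun y => β y i j) Ω) (hβp : ∀ y ∈ Ω, (β y).PosDef)
    {V : Eu 2 → ℝ} (hV : ContinuousOn V Ω) (hV0 : ∀ y ∈ Ω, 0 ≤ V y)
    {φ σ : ℝ → ℝ} (hφc : Continuous φ) (hφ : ∀ t, 0 < φ t)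
    (hσ : ∀ t, HasDerivAt σ (φ t)⁻¹ t) {μ : ℝ} (hμ : 0 ≤ μ) {v q : ℝ → Eu 3 → ℂ}
    (hv : JSmooth (Mset Ω) v) (hq : JSmooth (Mset Ω) q)
    (hvt : ∀ t, ∀ x ∈ Mset Ω, HasDerivAt (fun s => v s x) ((((φ t)⁻¹ : ℝ) : ℂ) * q t x) t)
    (hqt : ∀ t, ∀ x ∈ Mset Ω, HasDerivAt (fun s => q s x) ((((φ t)⁻¹ : ℝ) : ℂ) *
      (pd 0 (pd 0 (v t)) x - ((μ : ℝ) : ℂ) * v t x -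
        ((Real.exp (-(x 0 / 2)) : ℝ) : ℂ) * schr β V (fun y => v t (emb (x 0) y)) (pr32 x))) t)
    {t₁ t₂ : ℝ} {K : Set (Eu 3)} (hK : IsCompact K) (hKU : K ⊆ Mset Ω)
    (hvK : ∀ t ∈ Icc t₁ t₂, ∀ x, x ∉ K → v t x = 0)
    (hqK : ∀ t ∈ Icc t₁ t₂, ∀ x, x ∉ K → q t x = 0)
    {t : ℝ} (ht : t ∈ Icc t₁ t₂) {x : Eu 3} (hx : x ∈ Mset Ω) (h1 : x 0 ≤ σ t - σ t₁)
    (h2 : x 0 ≤ σ t₂ - σ t) : v t x = 0 := by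
  have hU := isOpen_Mset hΩ
  set K₂ := pr32 '' K with hK₂
  have hK₂c : IsCompact K₂ := hK.image continuous_pr32
  have hK₂Ω : K₂ ⊆ Ω := by
    rintro _ ⟨x, hx, rfl⟩
    exact (hKU hx).2
  have hemb : ∀ r y, y ∉ K₂ → emb r y ∉ K := fun r y hy h => hy ⟨_, h, pr32_emb r y⟩
  have hmem : ∀ {r y}, 0 < r → y ∈ Ω → emb r y ∈ Mset Ω := fun hr hy => emb_mem_Mset.2 ⟨hr, hy⟩
  have htest : ∀ t ∈ Icc t₁ t₂, ∀ r, 0 < r → IsTest Ω fun y => v t (emb r y) :=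
    fun t ht r hr => IsTest.of_eq_zero hΩ hK₂c hK₂Ω
      ((hv.slice t).comp (contDiff_emb.comp (contDiff_prodMk_right r)).contDiffOn
        fun y hy => hmem hr hy)
      fun y hy => hvK t ht _ (hemb r y hy)
  obtain ⟨ε, hε, hεK⟩ : ∃ ε > 0, ∀ x ∈ K, ε < x 0 := by
    rcases K.eq_empty_or_nonempty with h | h
    · exact ⟨1, one_pos, by simp [h]⟩
    · obtain ⟨x₀, hx₀, hmin⟩ := hK.exists_isMinOn h
        (f := fun x : Eu 3 => x 0) contDiff_coord.continuous.continuousOn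
      exact ⟨x₀ 0 / 2, half_pos (hKU hx₀).1, fun x hx =>
        (half_lt_self (hKU hx₀).1).trans_le (hmin hx)⟩
  have hnK : ∀ {r y}, r ≤ ε → emb r y ∉ K := fun hr h => by
    have := hεK _ h
    rw [emb_zero] at this
    linarith
  obtain ⟨N, hN⟩ := (isCompact_Icc.prod hK).exists_bound_of_continuousOn
    (hv.continuousOn (S := Icc t₁ t₂ ×ˢ K) fun p hp => ⟨mem_univ _, hKU hp.2⟩)
  have hN' : ∀ t ∈ Icc t₁ t₂, ∀ x, ‖v t x‖ ≤ max N 0 := fun t ht x => by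
    by_cases hx : x ∈ K
    · exact (hN (t, x) ⟨ht, hx⟩).trans (le_max_left _ _)
    · rw [hvK t ht x hx, norm_zero]; exact le_max_right _ _
  have hz := eq_zero_of_weak_bandlimited hΩ hβs hβp hV hV0 (htest t ht (x 0) hx.1) ?_
  · simpa using hz (pr32 x)
  intro W Γ hΓ hWi hWb hWr
  obtain ⟨C, hC, hWC⟩ := hWb K₂ hK₂c hK₂Ω
  have hWK := fun n => hWi n K₂ hK₂c hK₂Ω
  have hΩK : ∀ t ∈ Icc t₁ t₂, ∀ n r, ∫ y in Ω, W n y * v t (emb r y) =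
      ∫ y in K₂, v t (emb r y) * W n y := fun t ht n r => by
    rw [setIntegral_eq_compact hΩ hK₂Ω fun y _ hy => by rw [hvK t ht _ (hemb r y hy), mul_zero]]
    simp only [mul_comm]
  have hg1 : JSmooth (Mset Ω) fun t x => pd 0 (v t) x + q t x := (hv.spaceDeriv hU 0).add hq
  have hg2 : JSmooth (Mset Ω) fun t x => pd 0 (v t) x - q t x := (hv.spaceDeriv hU 0).sub hq
  have hint : ∀ {g : Eu 3 → ℂ}, ContinuousOn g (Mset Ω) → ∀ n, ∀ r, 0 < r →
      IntegrableOn (fun y => g (emb r y) * W n y) K₂ := fun hg n r hr =>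
    (hWK n).continuousOn_mul (hg.comp
      (contDiff_emb.continuous.comp (Continuous.prodMk_right r)).continuousOn
      fun y hy => hmem hr (hK₂Ω hy)) hK₂c
  have hσc : Continuous fun s => (φ s)⁻¹ := hφc.inv₀ fun s => (hφ s).ne'
  have hpdv : ∀ t ∈ Icc t₁ t₂, ∀ x, x ∉ K → pd 0 (v t) x = 0 := fun t ht x hx =>
    pd_eq_zero hK.isClosed (hvK t ht) 0 hx
  have hdpd : ∀ t, ∀ x ∈ Mset Ω, HasDerivAt (fun s => pd 0 (v s) x)
      ((((φ t)⁻¹ : ℝ) : ℂ) * pd 0 (q t) x) t := fun t x hx => by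
    have e : (((φ t)⁻¹ : ℝ) : ℂ) * pd 0 (q t) x = deriv (fun s => pd 0 (v s) x) t := by
      rw [hv.timeDeriv_pd hU t hx, pd_congr_of_isOpen hU (fun y hy => (hvt t y hy).deriv) 0 hx,
        pd_const_mul]
      exact ((hq.slice t).contDiffAt (hU.mem_nhds hx)).differentiableAt (by simp)
    rw [e]
    exact ((hv.spaceDeriv hU 0).hasDerivAt hU t hx).differentiableAt.hasDerivAt
  have hdiff : ∀ {f : ℝ → Eu 3 → ℂ}, JSmooth (Mset Ω) f → ∀ t, ∀ x ∈ Mset Ω,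
      DifferentiableAt ℝ (f t) x := fun hf t x hx =>
    ((hf.slice t).contDiffAt (hU.mem_nhds hx)).differentiableAt (by simp)
  have hsrc : ∀ n, ∀ t ∈ Icc t₁ t₂, ∀ r, 0 < r →
      ∫ y in K₂, (((μ : ℝ) : ℂ) * v t (emb r y) + ((Real.exp (-(r / 2)) : ℝ) : ℂ) *
        schr β V (fun y => v t (emb r y)) y) * W n y =
      ((μ : ℝ) : ℂ) * (∫ y in K₂, v t (emb r y) * W n y) +
        ((Real.exp (-(r / 2)) : ℝ) : ℂ) * ∫ y in K₂, v t (emb r y) * W (n + 1) y := by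
    intro n t ht r hr
    have i1 := hint (hv.slice t).continuousOn n r hr
    have i2 : IntegrableOn (fun y => schr β V (fun y => v t (emb r y)) y * W n y) K₂ :=
      (hWK n).continuousOn_mul ((continuousOn_schr hΩ hβs hβp hV (htest t ht r hr)).mono hK₂Ω) hK₂c
    rw [← hΩK t ht (n + 1), ← hWr n _ (htest t ht r hr), setIntegral_eq_compact hΩ hK₂Ω,
      ← integral_const_mul, ← integral_const_mul, ← integral_add (i1.const_mul _)]
    · refine integral_congr_ae (.of_forall fun y => ?_)
      simp only
      ring
    · exact (i2.const_mul _).congr (.of_forall fun y => by simp only; ring)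
    · intro y _ hy
      have h0 : ∀ y, y ∉ K₂ → v t (emb r y) = 0 := fun y hy => hvK t ht _ (hemb r y hy)
      have h3 : y ∉ tsupport fun y => v t (emb r y) :=
        fun h => hy (tsupport_subset_of_eq_zero hK₂c.isClosed h0 h)
      simp [schr, h0 y hy, lapC_eq_zero_of_notMem_tsupport h3]
  rw [hΩK t ht]
  refine lateral_picard hφ hσ hε hμ (mul_nonneg (le_max_right N 0) hC) hΓ
    (p := fun n t r => ∫ y in K₂, v t (emb r y) * W n y)
    (G := fun n t r => ∫ y in K₂, (pd 0 (v t) (emb r y) + q t (emb r y)) * W n y)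
    (G' := fun n t r => ∫ y in K₂, (pd 0 (v t) (emb r y) - q t (emb r y)) * W n y)
    ?_ ?_ ?_ ?_ ?_ ?_ ?_ 0 ht h1 h2
  · intro n t ht r
    calc ‖∫ y in K₂, v t (emb r y) * W n y‖ ≤ ∫ y in K₂, max N 0 * ‖W n y‖ :=
          norm_integral_le_of_norm_le ((hWK n).norm.const_mul _) (.of_forall fun y => by
            rw [norm_mul]
            exact mul_le_mul_of_nonneg_right (hN' t ht _) (norm_nonneg _))
      _ ≤ max N 0 * (C * Γ ^ n) := by
          rw [integral_const_mul]
          exact mul_le_mul_of_nonneg_left (hWC n) (le_max_right _ _)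
      _ = _ := by ring
  · intro n t ht r hr
    simp [hvK t ht _ (hnK hr)]
  · intro n t ht
    simp [hpdv t ht _ (hnK le_rfl), hqK t ht _ (hnK le_rfl)]
  · intro n t ht
    simp [hpdv t ht _ (hnK le_rfl), hqK t ht _ (hnK le_rfl)]
  · intro n t ht r hr
    have h3 := (JSmooth.const (hv.slice t)).hasDerivAt_integral_curve hΩ hK₂c hK₂Ω (hWK n)
      (ρ := fun s => s) (ρ' := fun _ => 1) (fun s => hasDerivAt_id s) continuous_const (t := r) hr
    have e : (1 / 2 : ℂ) * ((∫ y in K₂, (pd 0 (v t) (emb r y) + q t (emb r y)) * W n y) +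
        ∫ y in K₂, (pd 0 (v t) (emb r y) - q t (emb r y)) * W n y) =
        ∫ y in K₂, (deriv (fun _ : ℝ => v t (emb r y)) r +
          ((1 : ℝ) : ℂ) * pd 0 (v t) (emb r y)) * W n y := by
      rw [← integral_add (hint (hg1.slice t).continuousOn n r hr)
        (hint (hg2.slice t).continuousOn n r hr), ← integral_const_mul]
      refine integral_congr_ae (.of_forall fun y => ?_)
      simp only [deriv_const, Complex.ofReal_one]
      ring
    rw [e]
    exact h3
  · intro n t ht c hc
    have h3 := hg1.hasDerivAt_integral_curve hΩ hK₂c hK₂Ω (hWK n)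
      (ρ := fun s => c - σ s) (ρ' := fun s => -(φ s)⁻¹) (fun s => (hσ s).const_sub c)
      hσc.neg (t := t) hc
    rw [← hsrc n t ht _ hc, ← integral_const_mul]
    refine h3.congr_deriv (setIntegral_congr_fun hK₂c.measurableSet fun y hy => ?_)
    have hm := hmem hc (hK₂Ω hy)
    have e1 := ((hdpd t _ hm).add (hqt t _ hm)).deriv
    have e2 := pd_add (hdiff (hv.spaceDeriv hU 0) t _ hm) (hdiff hq t _ hm) 0
    simp only [emb_zero, pr32_emb] at e1
    erw [e1, e2]
    push_cast
    ring
  · intro n t ht c hc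
    have h3 := hg2.hasDerivAt_integral_curve hΩ hK₂c hK₂Ω (hWK n)
      (ρ := fun s => c + σ s) (ρ' := fun s => (φ s)⁻¹) (fun s => (hσ s).const_add c)
      hσc (t := t) hc
    rw [← hsrc n t ht _ hc, ← integral_const_mul]
    refine h3.congr_deriv (setIntegral_congr_fun hK₂c.measurableSet fun y hy => ?_)
    have hm := hmem hc (hK₂Ω hy)
    have e1 := ((hdpd t _ hm).sub (hqt t _ hm)).deriv
    have e2 := pd_sub (hdiff (hv.spaceDeriv hU 0) t _ hm) (hdiff hq t _ hm) 0
    simp only [emb_zero, pr32_emb] at e1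
    erw [e1, e2]
    push_cast
    ring

end Characteristics

section UniqueContinuation

variable {Ω : Set (Eu 2)} {β : Eu 2 → Matrix (Fin 2) (Fin 2) ℝ}
  {h : Eu 3 → Matrix (Fin 3) (Fin 3) ℝ}

theorem continuousOn_Rscal {n : ℕ} {U : Set (Eu n)} {b : Eu n → Matrix (Fin n) (Fin n) ℝ}
    (hU : IsOpen U) (hs : ∀ i j, ContDiffOn ℝ ∞ (fun x => b x i j) U)
    (hp : ∀ x ∈ U, (b x).PosDef) : ContinuousOn (Rscal b) U := by
  have hc := fun i j k => contDiffOn_Chr hU hs hp i j k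
  have hc0 := fun i j k => (hc i j k).continuousOn
  have hd := fun i j k l => (contDiffOn_pd hU (hc i j k) l).continuousOn
  refine continuousOn_finsetSum _ fun j _ => continuousOn_finsetSum _ fun k _ =>
    (contDiffOn_inv_entry hs hp j k).continuousOn.mul (((ContinuousOn.sub ?_ ?_).add ?_).sub ?_)
  · exact continuousOn_finsetSum _ fun i _ => hd _ _ _ _
  · exact continuousOn_finsetSum _ fun i _ => hd _ _ _ _
  · exact continuousOn_finsetSum _ fun i _ => continuousOn_finsetSum _ fun l _ =>
      (hc0 _ _ _).mul (hc0 _ _ _)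
  · exact continuousOn_finsetSum _ fun i _ => continuousOn_finsetSum _ fun l _ =>
      (hc0 _ _ _).mul (hc0 _ _ _)

/-- The square of the Dirac operator in the coordinates of the wrapped product. -/
theorem WrapMetric.sq_eq (hw : WrapMetric Ω β (fun r => Real.exp (r / 2)) h) (hΩ : IsOpen Ω)
    (hβs : ∀ i j, ContDiffOn ℝ ∞ (fun y => β y i j) Ω) (hβp : ∀ y ∈ Ω, (β y).PosDef)
    (hβt : ∀ y ∈ Ω, (β y).IsSymm) (hp : ∀ x, (h x).PosDef) {m : ℝ} {f : Eu 3 → ℂ}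
    (hf : ContDiffOn ℝ ∞ f (Mset Ω)) {x : Eu 3} (hx : x ∈ Mset Ω) :
    -(((Real.exp (1 / 4 * x 0) : ℝ) : ℂ) * ((m : ℂ) ^ 2 * f x - lapC h f x +
      ((Rscal h x / 4 : ℝ) : ℂ) * f x)) =
    pd 0 (pd 0 fun y => ((Real.exp (1 / 4 * y 0) : ℝ) : ℂ) * f y) x -
      ((m ^ 2 - 1 / 32 : ℝ) : ℂ) * (((Real.exp (1 / 4 * x 0) : ℝ) : ℂ) * f x) -
      ((Real.exp (-(x 0 / 2)) : ℝ) : ℂ) * schr β (fun y => Rscal β y / 4)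
        (fun y => ((Real.exp (1 / 4 * x 0) : ℝ) : ℂ) * f (emb (x 0) y)) (pr32 x) := by
  have hM := isOpen_Mset hΩ
  have hd : ∀ {g : Eu 3 → ℂ}, ContDiffOn ℝ ∞ g (Mset Ω) → ∀ z ∈ Mset Ω, DifferentiableAt ℝ g z :=
    fun hg z hz => (hg.contDiffAt (hM.mem_nhds hz)).differentiableAt (by simp)
  have hE : ∀ z : Eu 3, DifferentiableAt ℝ (fun y : Eu 3 => Real.exp (1 / 4 * y 0)) z := fun z =>
    ((contDiff_const.mul contDiff_coord).exp).contDiffAt.differentiableAt (by simp)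
  have hEC : ∀ z : Eu 3,
      DifferentiableAt ℝ (fun y : Eu 3 => ((Real.exp (1 / 4 * y 0) : ℝ) : ℂ)) z := fun z =>
    Complex.ofRealCLM.differentiableAt.comp z (hE z)
  have hpE : ∀ z : Eu 3, pd 0 (fun y : Eu 3 => ((Real.exp (1 / 4 * y 0) : ℝ) : ℂ)) z =
      1 / 4 * ((Real.exp (1 / 4 * z 0) : ℝ) : ℂ) := fun z => by
    rw [pd_ofReal (hE z), pd_zero_comp_coord (hasDerivAt_exp_mul (1 / 4) (z 0))]
    push_cast
    ring
  have h1 : ∀ z ∈ Mset Ω, pd 0 (fun y => ((Real.exp (1 / 4 * y 0) : ℝ) : ℂ) * f y) z =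
      ((Real.exp (1 / 4 * z 0) : ℝ) : ℂ) * (1 / 4 * f z + pd 0 f z) := fun z hz => by
    rw [pd_mul (hEC z) (hd hf z hz), hpE]
    ring
  have hf1 := contDiffOn_pd hM hf 0
  have h2 : pd 0 (pd 0 fun y => ((Real.exp (1 / 4 * y 0) : ℝ) : ℂ) * f y) x =
      ((Real.exp (1 / 4 * x 0) : ℝ) : ℂ) *
        (1 / 16 * f x + 1 / 2 * pd 0 f x + pd 0 (pd 0 f) x) := by
    rw [pd_congr_of_isOpen hM h1 0 hx,
      pd_mul (g := fun y => 1 / 4 * f y + pd 0 f y) (hEC x)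
        (((hd hf x hx).const_mul _).add (hd hf1 x hx)), hpE,
      pd_add ((hd hf x hx).const_mul _) (hd hf1 x hx), pd_const_mul (hd hf x hx)]
    ring
  have hsl : ContDiffOn ℝ ∞ (fun y => f (emb (x 0) y)) Ω :=
    hf.comp (contDiff_emb.comp (contDiff_prodMk_right (x 0))).contDiffOn
      fun y hy => emb_mem_Mset.2 ⟨hx.1, hy⟩
  rw [h2, schr, lapC_const_mul hΩ hβs hβp hsl _ hx.2, hw.lapC_eq hΩ hβs hβp hp hf hx,
    hw.rscal_eq hΩ hβs hβp hβt hx, emb_pr32, Real.exp_neg]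
  push_cast
  ring

/-- A solution of the Dirac equation vanishes in the domain of dependence of the boundary component
`x 0 = 0`. -/
theorem DSol.eq_zero_of_dependence {w : Eu 3 → ℝ} {φ σ : ℝ → ℝ}
    {A : Fin 3 → Eu 3 → Fin 4 → Fin 4 → ℂ} {B : Eu 3 → Fin 4 → Fin 4 → ℂ}
    {u : ℝ → Eu 3 → Fin 4 → ℂ} (S : DSol (Mset Ω) w φ A B u)
    (hw : WrapMetric Ω β (fun r => Real.exp (r / 2)) h) (hΩ : IsOpen Ω)
    (hβs : ∀ i j, ContDiffOn ℝ ∞ (fun y => β y i j) Ω) (hβp : ∀ y ∈ Ω, (β y).PosDef)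
    (hβt : ∀ y ∈ Ω, (β y).IsSymm) (hβR : ∀ y ∈ Ω, 0 ≤ Rscal β y) (hp : ∀ x, (h x).PosDef)
    {m : ℝ} (hm : 3 / 32 < m ^ 2)
    (hsq : ∀ f : Eu 3 → Fin 4 → ℂ, ContDiff ℝ ∞ f → ∀ x ∈ Mset Ω, ∀ i : Fin 4,
      Hop A B (Hop A B f) x i = (m : ℂ) ^ 2 * f x i - lapC h (fun y => f y i) x
        + ((Rscal h x / 4 : ℝ) : ℂ) * f x i)
    (hσ : ∀ t, HasDerivAt σ (φ t)⁻¹ t) {t₁ t₂ t : ℝ} (ht : t ∈ Icc t₁ t₂) {x : Eu 3}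
    (hx : x ∈ Mset Ω) (h1 : x 0 ≤ σ t - σ t₁) (h2 : x 0 ≤ σ t₂ - σ t) : u t x = 0 := by
  obtain ⟨K, hK, hKU, hK0⟩ := S.exists_support t₁ t₂
  have hE : ∀ {g : ℝ → Eu 3 → ℂ}, JSmooth (Mset Ω) g → ∀ c : ℂ,
      JSmooth (Mset Ω) fun t x => c * ((Real.exp (1 / 4 * x 0) : ℝ) : ℂ) * g t x := by
    intro g hg c
    have h3 : ContDiffOn ℝ ∞ (fun x : Eu 3 => c * ((Real.exp (1 / 4 * x 0) : ℝ) : ℂ)) (Mset Ω) :=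
      contDiffOn_const.mul (contDiffOn_ofReal
        ((contDiff_const.mul contDiff_coord).exp.contDiffOn))
    exact (JSmooth.const h3).mul hg
  funext c
  have hzero := wave_eq_zero hΩ hβs hβp (V := fun y => Rscal β y / 4)
    ((continuousOn_Rscal hΩ hβs hβp).div_const 4)
    (fun y hy => div_nonneg (hβR y hy) (by norm_num)) S.contφ S.posφ hσ (μ := m ^ 2 - 1 / 32)
    (by linarith) (v := fun t x => 1 * ((Real.exp (1 / 4 * x 0) : ℝ) : ℂ) * u t x c)
    (q := fun t x => -Complex.I * ((Real.exp (1 / 4 * x 0) : ℝ) : ℂ) * Hop A B (u t) x c)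
    (hE (S.smooth.apply c) 1) (hE (S.hop.smooth.apply c) (-Complex.I)) ?_ ?_ hK hKU
    (fun t ht x hx => by simp [hK0 t ht x hx])
    (fun t ht x hx => by simp [Hop_eq_zero hK.isClosed (hK0 t ht) hx]) ht hx h1 h2
  · simpa [Real.exp_ne_zero] using hzero
  · intro t x hx
    refine ((S.hasDerivAt t hx c).const_mul _).congr_deriv ?_
    push_cast
    ring
  · intro t x hx
    refine ((S.hop.hasDerivAt t hx c).const_mul _).congr_deriv ?_
    have h3 := hw.sq_eq (m := m) hΩ hβs hβp hβt hp
      (contDiffOn_pi.1 (S.isTest t).1.contDiffOn c) hx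
    simp only [one_mul, emb_zero]
    rw [← h3, hsq _ (S.isTest t).1 x hx c]
    push_cast
    linear_combination (((φ t : ℝ) : ℂ)⁻¹ * Complex.exp (1 / 4 * x 0) * ((m : ℂ) ^ 2 * u t x c -
      lapC h (fun y => u t y c) x + ((Rscal h x : ℝ) : ℂ) / 4 * u t x c)) * Complex.I_sq

end UniqueContinuation

section Energy

/-- The squared gradient of a scalar function with respect to the metric `h`. -/
def gradSq {n : ℕ} (h : Eu n → Matrix (Fin n) (Fin n) ℝ) (f : Eu n → ℂ) (x : Eu n) : ℝ :=
  ∑ j, ∑ k, (h x)⁻¹ j k * (conj (pd j f x) * pd k f x).re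

theorem gradhSq_eq (h : Eu 3 → Matrix (Fin 3) (Fin 3) ℝ) (u : Eu 3 → Fin 4 → ℂ) (x : Eu 3) :
    gradhSq h u x = ∑ c, gradSq h (fun y => u y c) x := by
  simp only [gradhSq, gradSq]
  rw [Finset.sum_comm (t := Finset.univ (α := Fin 3))]
  simp only [Finset.mul_sum]
  rw [Finset.sum_congr rfl fun i _ => Finset.sum_comm, Finset.sum_comm]
  refine Finset.sum_congr rfl fun c _ => ?_
  rw [Finset.sum_comm]

theorem continuousOn_gradSq {n : ℕ} {U : Set (Eu n)} {h : Eu n → Matrix (Fin n) (Fin n) ℝ}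
    (hU : IsOpen U) (hs : ∀ i j, ContDiffOn ℝ ∞ (fun x => h x i j) U)
    (hp : ∀ x ∈ U, (h x).PosDef) {f : Eu n → ℂ} (hf : ContDiffOn ℝ ∞ f U) :
    ContinuousOn (gradSq h f) U :=
  continuousOn_finsetSum _ fun j _ => continuousOn_finsetSum _ fun k _ =>
    (contDiffOn_inv_entry hs hp j k).continuousOn.mul (Complex.continuous_re.comp_continuousOn
      ((Complex.continuous_conj.comp_continuousOn (contDiffOn_pd hU hf j).continuousOn).mul
        (contDiffOn_pd hU hf k).continuousOn))

theorem gradSq_eq_zero {n : ℕ} {h : Eu n → Matrix (Fin n) (Fin n) ℝ} {K : Set (Eu n)}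
    (hK : IsClosed K) {f : Eu n → ℂ} (h0 : ∀ x, x ∉ K → f x = 0) {x : Eu n} (hx : x ∉ K) :
    gradSq h f x = 0 := by
  simp [gradSq, pd_eq_zero hK h0 _ hx]

theorem integrableOn_gradSq {n : ℕ} {U : Set (Eu n)} {h : Eu n → Matrix (Fin n) (Fin n) ℝ}
    (hU : IsOpen U) (hs : ∀ i j, ContDiffOn ℝ ∞ (fun x => h x i j) U)
    (hp : ∀ x ∈ U, (h x).PosDef) {f : Eu n → ℂ} (hf : IsTest U f) :
    IntegrableOn (fun x => gradSq h f x * sdet h x) U :=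
  integrableOn_of_compact hU hf.2.1 hf.2.2
    ((continuousOn_gradSq hU hs hp hf.1.contDiffOn).mul (contDiffOn_sdet hs hp).continuousOn)
    fun x _ hx => by
      rw [gradSq_eq_zero (isClosed_tsupport f)
        (fun _ h => image_eq_zero_of_notMem_tsupport h) hx, zero_mul]

variable {Ω : Set (Eu 2)} {β : Eu 2 → Matrix (Fin 2) (Fin 2) ℝ}
  {h : Eu 3 → Matrix (Fin 3) (Fin 3) ℝ}

theorem WrapMetric.norm_pd_zero_sq_le (hw : WrapMetric Ω β (fun r => Real.exp (r / 2)) h)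
    (hβp : ∀ y ∈ Ω, (β y).PosDef) (f : Eu 3 → ℂ) {x : Eu 3} (hx : x ∈ Mset Ω) :
    ‖pd 0 f x‖ ^ 2 ≤ gradSq h f x := by
  have h1 := re_quad_nonneg (hβp _ hx.2) fun i => pd i.succ f x
  have h2 : gradSq h f x = ‖pd 0 f x‖ ^ 2 + (Real.exp (x 0 / 2))⁻¹ *
      ∑ j : Fin 2, ∑ k : Fin 2, (β (pr32 x))⁻¹ j k *
        (conj (pd j.succ f x) * pd k.succ f x).re := by
    simp only [gradSq, hw.inv_eq hβp hx]
    rw [Fin.sum_univ_succ]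
    simp only [Fin.sum_univ_succ (n := 2), wrapM_zero_zero, wrapM_zero_succ, wrapM_succ_zero,
      wrapM_succ_succ, zero_mul, Finset.sum_const_zero, add_zero, zero_add, one_mul]
    congr 1
    · rw [← Complex.normSq_eq_norm_sq, ← Complex.normSq_eq_conj_mul_self, Complex.ofReal_re]
    · simp only [Finset.mul_sum, mul_assoc]
  rw [h2]
  exact le_add_of_nonneg_right (mul_nonneg (by positivity) h1)

/-- Hardy's inequality for the exponential weight. -/
theorem WrapMetric.hardy (hw : WrapMetric Ω β (fun r => Real.exp (r / 2)) h) (hΩ : IsOpen Ω)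
    (hβs : ∀ i j, ContDiffOn ℝ ∞ (fun y => β y i j) Ω) (hβp : ∀ y ∈ Ω, (β y).PosDef)
    (hp : ∀ x, (h x).PosDef) {f : Eu 3 → ℂ} (hf : IsTest (Mset Ω) f) :
    ∫ x in Mset Ω, ‖f x‖ ^ 2 * sdet h x ≤ 16 * ∫ x in Mset Ω, gradSq h f x * sdet h x := by
  have hM := isOpen_Mset hΩ
  have hws := contDiffOn_sdet (hw.contDiffOn hβs) fun x _ => hp x
  have h0 : ∀ x, x ∉ tsupport f → f x = 0 := fun _ h => image_eq_zero_of_notMem_tsupport h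
  set F : Eu 3 → ℂ := fun x => conj (f x) * f x * ((sdet h x : ℝ) : ℂ) with hF
  have hFt : IsTest (Mset Ω) F := IsTest.of_eq_zero hM hf.2.1 hf.2.2
    (((contDiffOn_conj hf.1.contDiffOn).mul hf.1.contDiffOn).mul (contDiffOn_ofReal hws))
    fun x hx => by simp [hF, h0 x hx]
  have hFp : ∀ x ∈ Mset Ω, pd 0 F x = (conj (pd 0 f x) * f x + conj (f x) * pd 0 f x +
      1 / 2 * (conj (f x) * f x)) * ((sdet h x : ℝ) : ℂ) := by
    intro x hx
    have hfd : DifferentiableAt ℝ f x := (hf.1.differentiable (by simp)).differentiableAt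
    have hwd : DifferentiableAt ℝ (sdet h) x :=
      (hws.contDiffAt (hM.mem_nhds hx)).differentiableAt (by simp)
    have hsd : DifferentiableAt ℝ (sdet β) (pr32 x) :=
      ((contDiffOn_sdet hβs hβp).contDiffAt (hΩ.mem_nhds hx.2)).differentiableAt (by simp)
    have hwp : pd 0 (sdet h) x = 1 / 2 * sdet h x := by
      rw [pd_congr_of_isOpen hM (fun y hy => hw.sdet_eq hy) 0 hx,
        pd_mul (contDiff_exp_coord.contDiffAt.differentiableAt (by simp))
          (differentiableAt_comp_pr32 hsd), pd_zero_comp_pr32 hsd,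
        pd_zero_comp_coord (hasDerivAt_exp_half (x 0)), hw.sdet_eq hx]
      ring
    rw [hF, pd_mul (f := fun x => conj (f x) * f x) (g := fun x => ((sdet h x : ℝ) : ℂ))
      ((differentiableAt_conj hfd).mul hfd) (Complex.ofRealCLM.differentiableAt.comp x hwd),
      pd_mul (differentiableAt_conj hfd) hfd, pd_conj hfd, pd_ofReal hwd, hwp]
    push_cast
    ring
  have hF0 : ∫ x in Mset Ω, pd 0 F x = 0 := by
    rw [setIntegral_eq_integral_of_forall_compl_eq_zero, integral_pd_eq_zero hM hFt]
    exact fun x hx => pd_eq_zero (isClosed_tsupport F)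
      (fun _ h => image_eq_zero_of_notMem_tsupport h) 0 fun h => hx (hFt.2.2 h)
  have hpt := hFt.pd hM 0
  have hFi : IntegrableOn (pd 0 F) (Mset Ω) :=
    (hpt.1.continuous.integrable_of_hasCompactSupport hpt.2.1).integrableOn
  have hFr : ∫ x in Mset Ω, (pd 0 F x).re = 0 := by
    have := integral_re hFi
    simp only [RCLike.re_eq_complex_re] at this
    rw [this, hF0, Complex.zero_re]
  have hi : IntegrableOn (fun x => ‖f x‖ ^ 2 * sdet h x) (Mset Ω) :=
    integrableOn_of_compact hM hf.2.1 hf.2.2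
      ((hf.1.continuous.continuousOn.norm.pow 2).mul hws.continuousOn)
      fun x _ hx => by simp [h0 x hx]
  have hg := integrableOn_gradSq hM (hw.contDiffOn hβs) (fun x _ => hp x) hf
  have key : ∫ x in Mset Ω, (‖f x‖ ^ 2 * sdet h x + -4 * (pd 0 F x).re) ≤
      ∫ x in Mset Ω, 16 * (gradSq h f x * sdet h x) := by
    refine setIntegral_mono_on (hi.add (hFi.re.const_mul (-4))) (hg.const_mul 16)
      hM.measurableSet fun x hx => ?_
    have h1 := hw.norm_pd_zero_sq_le hβp f hx
    have h2 : (pd 0 F x).re = (2 * (conj (f x) * pd 0 f x).re + 1 / 2 * ‖f x‖ ^ 2) *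
        sdet h x := by
      rw [hFp x hx, Complex.re_mul_ofReal, ← Complex.normSq_eq_norm_sq,
        ← Complex.normSq_eq_conj_mul_self]
      congr 1
      simp
      ring
    have h3 : ‖f x‖ ^ 2 + -4 * (2 * (conj (f x) * pd 0 f x).re + 1 / 2 * ‖f x‖ ^ 2) ≤
        16 * ‖pd 0 f x‖ ^ 2 := by
      rw [← Complex.normSq_eq_norm_sq, ← Complex.normSq_eq_norm_sq, Complex.normSq_apply,
        Complex.normSq_apply, Complex.mul_re, Complex.conj_re, Complex.conj_im]
      nlinarith [sq_nonneg (4 * (pd 0 f x).re + (f x).re), sq_nonneg (4 * (pd 0 f x).im + (f x).im)]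
    rw [h2]
    nlinarith [sdet_pos (hp x)]
  have hFi4 : IntegrableOn (fun x => -4 * (pd 0 F x).re) (Mset Ω) := hFi.re.const_mul (-4)
  rwa [integral_add hi hFi4, integral_const_mul, integral_const_mul, hFr, mul_zero, add_zero] at key

/-- The energy identity for the Dirac operator controls the gradient. -/
theorem WrapMetric.integral_gradhSq_le (hw : WrapMetric Ω β (fun r => Real.exp (r / 2)) h)
    (hΩ : IsOpen Ω) (hβs : ∀ i j, ContDiffOn ℝ ∞ (fun y => β y i j) Ω)
    (hβp : ∀ y ∈ Ω, (β y).PosDef) (hβt : ∀ y ∈ Ω, (β y).IsSymm)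
    (hβR : ∀ y ∈ Ω, 0 ≤ Rscal β y) (hp : ∀ x, (h x).PosDef) {φ : ℝ → ℝ}
    {A : Fin 3 → Eu 3 → Fin 4 → Fin 4 → ℂ} {B : Eu 3 → Fin 4 → Fin 4 → ℂ}
    {u : ℝ → Eu 3 → Fin 4 → ℂ} (S : DSol (Mset Ω) (sdet h) φ A B u)
    {m : ℝ} (hm : 3 / 32 < m ^ 2)
    (hsq : ∀ f : Eu 3 → Fin 4 → ℂ, ContDiff ℝ ∞ f → ∀ x ∈ Mset Ω, ∀ i : Fin 4,
      Hop A B (Hop A B f) x i = (m : ℂ) ^ 2 * f x i - lapC h (fun y => f y i) x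
        + ((Rscal h x / 4 : ℝ) : ℂ) * f x i) {f : Eu 3 → Fin 4 → ℂ} (hf : IsTest (Mset Ω) f) :
    ∑ c, ∫ x in Mset Ω, gradSq h (fun y => f y c) x * sdet h x ≤
      ∫ x in Mset Ω, nsq (Hop A B f x) * sdet h x := by
  have hM := isOpen_Mset hΩ
  have hs := hw.contDiffOn hβs
  have hws := contDiffOn_sdet hs fun x _ => hp x
  have hfc : ∀ c, IsTest (Mset Ω) fun y => f y c := fun c =>
    IsTest.of_eq_zero hM hf.2.1 hf.2.2 (contDiffOn_pi.1 hf.1.contDiffOn c) fun x hx => by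
      rw [image_eq_zero_of_notMem_tsupport hx, Pi.zero_apply]
  have hfc0 : ∀ c x, x ∉ tsupport (fun y => f y c) → f x c = 0 := fun c x hx =>
    image_eq_zero_of_notMem_tsupport (f := fun y => f y c) hx
  have hHf : IsTest (Mset Ω) (Hop A B f) := hf.Hop hM S.smoothA S.smoothB
  set V : Eu 3 → ℝ := fun x => m ^ 2 + Rscal h x / 4 with hV
  have hVc : ContinuousOn V (Mset Ω) :=
    continuousOn_const.add ((continuousOn_Rscal hM hs fun x _ => hp x).div_const 4)
  have hV0 : ∀ x ∈ Mset Ω, 0 ≤ V x := fun x hx => by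
    simp only [hV]
    rw [hw.rscal_eq hΩ hβs hβp hβt hx]
    have := mul_nonneg (inv_nonneg.2 (Real.exp_pos (x 0 / 2)).le) (hβR _ hx.2)
    linarith
  have e1 : ∀ x ∈ Mset Ω, (∑ i, conj (f x i) * Hop A B (Hop A B f) x i) * ((sdet h x : ℝ) : ℂ) =
      ∑ i, conj (f x i) * schr h V (fun y => f y i) x * ((sdet h x : ℝ) : ℂ) := fun x hx => by
    rw [Finset.sum_mul]
    refine Finset.sum_congr rfl fun i _ => ?_
    rw [hsq f hf.1 x hx i, schr, hV]
    push_cast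
    ring
  have hi1 : ∀ i, IntegrableOn
      (fun x => conj (f x i) * schr h V (fun y => f y i) x * ((sdet h x : ℝ) : ℂ)) (Mset Ω) :=
    fun i => integrableOn_of_compact hM (hfc i).2.1 (hfc i).2.2
      (((Complex.continuous_conj.comp_continuousOn (hfc i).1.continuous.continuousOn).mul
        (continuousOn_schr hM hs (fun x _ => hp x) hVc (hfc i))).mul
        (contDiffOn_ofReal hws).continuousOn) fun x _ hx => by
      rw [hfc0 i x hx]
      simp
  have hi2 : ∀ i, IntegrableOn
      (fun x => V x * ‖f x i‖ ^ 2 * sdet h x) (Mset Ω) :=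
    fun i => integrableOn_of_compact hM (hfc i).2.1 (hfc i).2.2
      ((hVc.mul ((hfc i).1.continuous.continuousOn.norm.pow 2)).mul hws.continuousOn)
      fun x _ hx => by
      rw [hfc0 i x hx]
      simp
  have hgi := fun i => integrableOn_gradSq hM hs (fun x _ => hp x) (hfc i)
  have e2 : ((∫ x in Mset Ω, nsq (Hop A B f x) * sdet h x : ℝ) : ℂ) =
      ∑ i, ∫ x in Mset Ω, conj (f x i) * schr h V (fun y => f y i) x * ((sdet h x : ℝ) : ℂ) := by
    rw [← integral_finsetSum _ fun i _ => hi1 i, ← setIntegral_congr_fun hM.measurableSet e1,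
      ← S.symm f _ hf hHf, ← integral_complex_ofReal]
    refine integral_congr_ae (.of_forall fun x => ?_)
    simp only [nsq]
    push_cast
    congr 1
    exact Finset.sum_congr rfl fun i _ => (Complex.conj_mul' _).symm
  have e3 : ∀ i, (∫ x in Mset Ω, conj (f x i) * schr h V (fun y => f y i) x *
      ((sdet h x : ℝ) : ℂ)).re = ∫ x in Mset Ω, (gradSq h (fun y => f y i) x * sdet h x +
        V x * ‖f x i‖ ^ 2 * sdet h x) := by
    intro i
    have hpc := fun j => (contDiffOn_pd hM (hfc i).1.contDiffOn j).continuousOn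
    have hG : IntegrableOn (fun x => ((∑ j, ∑ k, (((h x)⁻¹ j k : ℝ) : ℂ) *
        (conj (pd j (fun y => f y i) x) * pd k (fun y => f y i) x)) +
        ((V x : ℝ) : ℂ) * (conj (f x i) * f x i)) * ((sdet h x : ℝ) : ℂ)) (Mset Ω) := by
      refine integrableOn_of_compact hM (hfc i).2.1 (hfc i).2.2 ((ContinuousOn.add ?_ ?_).mul
        (contDiffOn_ofReal hws).continuousOn) fun x _ hx => ?_
      · exact continuousOn_finsetSum _ fun j _ => continuousOn_finsetSum _ fun k _ =>
          (contDiffOn_ofReal (contDiffOn_inv_entry hs (fun x _ => hp x) j k)).continuousOn.mul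
            ((Complex.continuous_conj.comp_continuousOn (hpc j)).mul (hpc k))
      · exact (Complex.continuous_ofReal.comp_continuousOn hVc).mul
          ((Complex.continuous_conj.comp_continuousOn (hfc i).1.continuous.continuousOn).mul
            (hfc i).1.continuous.continuousOn)
      · simp [pd_eq_zero (isClosed_tsupport _) (hfc0 i) _ hx, hfc0 i x hx]
    have h1 := Complex.reCLM.integral_comp_comm hG
    simp only [Complex.reCLM_apply] at h1
    rw [integral_conj_mul_schr hM hs (fun x _ => hp x) hVc (hfc i) (hfc i), ← h1]
    refine integral_congr_ae (.of_forall fun x => ?_)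
    simp only [Complex.re_mul_ofReal, Complex.add_re, Complex.re_sum, Complex.re_ofReal_mul,
      gradSq, ← Complex.normSq_eq_norm_sq, ← Complex.normSq_eq_conj_mul_self, Complex.ofReal_re]
    ring
  replace e2 := congrArg Complex.re e2
  rw [Complex.ofReal_re, Complex.re_sum, Finset.sum_congr rfl fun i _ => e3 i] at e2
  rw [e2]
  refine Finset.sum_le_sum fun i _ => ?_
  rw [integral_add (hgi i) (hi2 i)]
  refine le_add_of_nonneg_right (setIntegral_nonneg hM.measurableSet fun x hx => ?_)
  exact mul_nonneg (mul_nonneg (hV0 x hx) (sq_nonneg _)) (sdet_pos (hp x)).le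

end Energy

section LocalSmoothing

variable {Ω : Set (Eu 2)} {β : Eu 2 → Matrix (Fin 2) (Fin 2) ℝ}
  {h : Eu 3 → Matrix (Fin 3) (Fin 3) ℝ}

theorem one_add_sq_rpow_le {a ρ r : ℝ} (ha : 0 ≤ a) (hρ : 0 ≤ ρ) (hr : ρ ≤ r) :
    (1 + r ^ 2) ^ (-a) ≤ (1 + ρ ^ 2) ^ (-a) :=
  Real.rpow_le_rpow_of_nonpos (by positivity) (by gcongr) (by linarith)

/-- The weighted space integral for a function vanishing for `x 0 ≤ ρ`. -/
theorem WrapMetric.weighted_le (hw : WrapMetric Ω β (fun r => Real.exp (r / 2)) h)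
    (hΩ : IsOpen Ω) (hβs : ∀ i j, ContDiffOn ℝ ∞ (fun y => β y i j) Ω)
    (hβp : ∀ y ∈ Ω, (β y).PosDef) (hp : ∀ x, (h x).PosDef) {f : Eu 3 → Fin 4 → ℂ}
    (hf : IsTest (Mset Ω) f) {E a b ρ : ℝ} (ha : 0 ≤ a) (hb : 0 ≤ b) (hρ : 0 ≤ ρ)
    (h0 : ∀ x ∈ Mset Ω, x 0 ≤ ρ → f x = 0)
    (hE : ∑ c, ∫ x in Mset Ω, gradSq h (fun y => f y c) x * sdet h x ≤ E) :
    ∫ x in Mset Ω, ((1 + (x 0) ^ 2) ^ (-a) * (∑ c, ‖f x c‖ ^ 2)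
      + (1 + (x 0) ^ 2) ^ (-b) * gradhSq h f x) * sdet h x ≤
      (16 * (1 + ρ ^ 2) ^ (-a) + (1 + ρ ^ 2) ^ (-b)) * E := by
  have hM := isOpen_Mset hΩ
  have hs := hw.contDiffOn hβs
  have hws := contDiffOn_sdet hs fun x _ => hp x
  have hfc : ∀ c, IsTest (Mset Ω) fun y => f y c := fun c =>
    IsTest.of_eq_zero hM hf.2.1 hf.2.2 (contDiffOn_pi.1 hf.1.contDiffOn c) fun x hx => by
      rw [image_eq_zero_of_notMem_tsupport hx, Pi.zero_apply]
  have hg := fun c => integrableOn_gradSq hM hs (fun x _ => hp x) (hfc c)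
  have hi : ∀ c, IntegrableOn (fun x => ‖f x c‖ ^ 2 * sdet h x) (Mset Ω) := fun c =>
    integrableOn_of_compact hM hf.2.1 hf.2.2
      (((hfc c).1.continuous.continuousOn.norm.pow 2).mul hws.continuousOn)
      fun x _ hx => by simp [image_eq_zero_of_notMem_tsupport hx]
  have hgn : ∀ c x, 0 ≤ gradSq h (fun y => f y c) x := fun c x => re_quad_nonneg (hp x) _
  have hg0 : ∀ c, ∀ x ∈ Mset Ω, x 0 < ρ → gradSq h (fun y => f y c) x = 0 := fun c x hx hxρ => by
    have hN : (fun y => f y c) =ᶠ[𝓝 x] fun _ => 0 := by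
      filter_upwards [hM.mem_nhds hx,
        contDiff_coord.continuous.continuousAt.eventually_lt_const hxρ] with y hy hyρ
      rw [h0 y hy hyρ.le, Pi.zero_apply]
    simp [gradSq, pd_congr hN, pd_const]
  have hterm : ∀ c, IntegrableOn (fun x => (1 + ρ ^ 2) ^ (-a) * (‖f x c‖ ^ 2 * sdet h x) +
      (1 + ρ ^ 2) ^ (-b) * (gradSq h (fun y => f y c) x * sdet h x)) (Mset Ω) := fun c =>
    ((hi c).const_mul _).add ((hg c).const_mul _)
  have hsum : IntegrableOn (fun x => ∑ c, ((1 + ρ ^ 2) ^ (-a) * (‖f x c‖ ^ 2 * sdet h x) +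
      (1 + ρ ^ 2) ^ (-b) * (gradSq h (fun y => f y c) x * sdet h x))) (Mset Ω) :=
    integrable_finsetSum _ fun c _ => hterm c
  have hle : ∫ x in Mset Ω, ((1 + (x 0) ^ 2) ^ (-a) * (∑ c, ‖f x c‖ ^ 2)
      + (1 + (x 0) ^ 2) ^ (-b) * gradhSq h f x) * sdet h x ≤
      ∫ x in Mset Ω, ∑ c, ((1 + ρ ^ 2) ^ (-a) * (‖f x c‖ ^ 2 * sdet h x) +
        (1 + ρ ^ 2) ^ (-b) * (gradSq h (fun y => f y c) x * sdet h x)) := by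
    refine integral_mono_of_nonneg (.of_forall fun x => ?_) hsum ?_
    · simp only [gradhSq_eq]
      exact mul_nonneg (add_nonneg (mul_nonneg (by positivity)
        (Finset.sum_nonneg fun _ _ => sq_nonneg _)) (mul_nonneg (by positivity)
        (Finset.sum_nonneg fun c _ => hgn c x))) (sdet_pos (hp x)).le
    · filter_upwards [ae_restrict_mem hM.measurableSet] with x hx
      rw [gradhSq_eq, Finset.mul_sum, Finset.mul_sum, ← Finset.sum_add_distrib, Finset.sum_mul]
      refine Finset.sum_le_sum fun c _ => ?_
      rw [← mul_assoc, ← mul_assoc, ← add_mul]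
      refine mul_le_mul_of_nonneg_right ?_ (sdet_pos (hp x)).le
      rcases lt_or_ge (x 0) ρ with hxρ | hxρ
      · rw [hg0 c x hx hxρ, h0 x hx hxρ.le]
        simp
      · exact add_le_add
          (mul_le_mul_of_nonneg_right (one_add_sq_rpow_le ha hρ hxρ) (sq_nonneg _))
          (mul_le_mul_of_nonneg_right (one_add_sq_rpow_le hb hρ hxρ) (hgn c x))
  refine hle.trans ?_
  rw [integral_finsetSum _ fun c _ => hterm c]
  have hH := fun c => hw.hardy hΩ hβs hβp hp (hfc c)
  calc _ = ∑ c, ((1 + ρ ^ 2) ^ (-a) * (∫ x in Mset Ω, ‖f x c‖ ^ 2 * sdet h x) +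
        (1 + ρ ^ 2) ^ (-b) * ∫ x in Mset Ω, gradSq h (fun y => f y c) x * sdet h x) := by
        refine Finset.sum_congr rfl fun c _ => ?_
        rw [integral_add ((hi c).const_mul _) ((hg c).const_mul _), integral_const_mul,
          integral_const_mul]
    _ ≤ ∑ c, ((1 + ρ ^ 2) ^ (-a) *
          (16 * ∫ x in Mset Ω, gradSq h (fun y => f y c) x * sdet h x) +
        (1 + ρ ^ 2) ^ (-b) * ∫ x in Mset Ω, gradSq h (fun y => f y c) x * sdet h x) := by
        gcongr with c
        exact hH c
    _ = (16 * (1 + ρ ^ 2) ^ (-a) + (1 + ρ ^ 2) ^ (-b)) *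
        ∑ c, ∫ x in Mset Ω, gradSq h (fun y => f y c) x * sdet h x := by
        rw [Finset.mul_sum]
        exact Finset.sum_congr rfl fun c _ => by ring
    _ ≤ _ := mul_le_mul_of_nonneg_left hE (by positivity)

theorem integrable_one_add_sq_rpow {a : ℝ} (ha : 1 / 2 < a) :
    Integrable fun x : ℝ => (1 + x ^ 2) ^ (-a) := by
  have h1 := integrable_rpow_neg_one_add_norm_sq (E := ℝ) (μ := volume) (r := 2 * a)
    (by simp; linarith)
  refine h1.congr (.of_forall fun x => ?_)
  simp only [Real.norm_eq_abs, sq_abs]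
  congr 1
  ring

theorem continuous_one_add_sq_rpow (a : ℝ) : Continuous fun x : ℝ => (1 + x ^ 2) ^ (-a) :=
  (continuous_const.add (continuous_pow 2)).rpow_const fun x =>
    Or.inl (by positivity : (0 : ℝ) < 1 + x ^ 2).ne.symm

/-- A weight integrated along a monotone change of time. -/
theorem intervalIntegral_weight_le {a : ℝ} (ha : 1 / 2 < a) {ρ ρ' : ℝ → ℝ}
    (hρ : ∀ t, HasDerivAt ρ (ρ' t) t) (hρc : Continuous ρ') {s t : ℝ} (hst : ρ s ≤ ρ t) :
    ∫ x in s..t, (1 + ρ x ^ 2) ^ (-a) * ρ' x ≤ ∫ x : ℝ, (1 + x ^ 2) ^ (-a) := by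
  have h1 := intervalIntegral.integral_comp_mul_deriv (a := s) (b := t) (fun x _ => hρ x)
    hρc.continuousOn (continuous_one_add_sq_rpow a)
  simp only [Function.comp_def] at h1
  rw [h1, intervalIntegral.integral_of_le hst]
  exact setIntegral_le_integral (integrable_one_add_sq_rpow ha)
    (.of_forall fun x => by positivity)

/-- Integration in time of a quantity which is controlled by the distance to the end points. -/
theorem integral_time_le {φ σ G : ℝ → ℝ} (hφc : Continuous φ) (hφ : ∀ t, 0 < φ t)
    (hσ : ∀ t, HasDerivAt σ (φ t)⁻¹ t) {E a b : ℝ} (ha : 1 / 2 < a) (hb : 1 / 2 < b)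
    (hE : 0 ≤ E) (hG : ∀ t₁ t₂, ∀ t ∈ Icc t₁ t₂, ∀ ρ, 0 ≤ ρ → ρ ≤ σ t - σ t₁ → ρ ≤ σ t₂ - σ t →
      G t ≤ (16 * (1 + ρ ^ 2) ^ (-a) + (1 + ρ ^ 2) ^ (-b)) * E) :
    ∫ t, (φ t)⁻¹ * G t ≤ (32 * (∫ x : ℝ, (1 + x ^ 2) ^ (-a)) +
      2 * ∫ x : ℝ, (1 + x ^ 2) ^ (-b)) * E := by
  have hJ : ∀ a : ℝ, 0 ≤ ∫ x : ℝ, (1 + x ^ 2) ^ (-a) := fun a =>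
    integral_nonneg fun x => by positivity
  by_cases hi : Integrable fun t => (φ t)⁻¹ * G t
  swap
  · rw [integral_undef hi]
    have := hJ a
    have := hJ b
    positivity
  have hφi : Continuous fun t => (φ t)⁻¹ := hφc.inv₀ fun t => (hφ t).ne'
  have hmono : Monotone σ := monotone_of_hasDerivAt_nonneg hσ fun t => (inv_pos.2 (hφ t)).le
  have hσc : Continuous σ := continuous_iff_continuousAt.2 fun t => (hσ t).continuousAt
  refine le_of_tendsto' (intervalIntegral_tendsto_integral hi
    (Filter.tendsto_neg_atTop_atBot.comp tendsto_natCast_atTop_atTop)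
    tendsto_natCast_atTop_atTop) fun n => ?_
  simp only [Function.comp_apply]
  set s : ℝ := -(n : ℝ) with hs
  set e : ℝ := (n : ℝ) with he
  have hse : s ≤ e := neg_le_self (Nat.cast_nonneg n)
  have hl : ∀ t, HasDerivAt (fun t => σ t - σ s) (φ t)⁻¹ t := fun t => (hσ t).sub_const _
  have hr : ∀ t, HasDerivAt (fun t => σ t - σ e) (φ t)⁻¹ t := fun t => (hσ t).sub_const _
  have hcl : ∀ c a : ℝ, Continuous fun t => (1 + (σ t - σ c) ^ 2) ^ (-a) * (φ t)⁻¹ := fun c a =>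
    ((continuous_one_add_sq_rpow a).comp (hσc.sub continuous_const)).mul hφi
  have hlse : σ s ≤ σ e := hmono hse
  have b1 := fun {a : ℝ} (ha : 1 / 2 < a) => intervalIntegral_weight_le ha hl hφi (s := s) (t := e)
    (by linarith)
  have b2 := fun {a : ℝ} (ha : 1 / 2 < a) => intervalIntegral_weight_le ha hr hφi (s := s) (t := e)
    (by linarith)
  have hii : ∀ c a : ℝ, IntervalIntegrable (fun t => (1 + (σ t - σ c) ^ 2) ^ (-a) * (φ t)⁻¹)
      volume s e :=
    fun c a => (hcl c a).intervalIntegrable _ _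
  calc ∫ t in s..e, (φ t)⁻¹ * G t
      ≤ ∫ t in s..e, E * ((16 * ((1 + (σ t - σ s) ^ 2) ^ (-a) * (φ t)⁻¹) +
          16 * ((1 + (σ t - σ e) ^ 2) ^ (-a) * (φ t)⁻¹)) +
          ((1 + (σ t - σ s) ^ 2) ^ (-b) * (φ t)⁻¹ +
            (1 + (σ t - σ e) ^ 2) ^ (-b) * (φ t)⁻¹)) := by
        refine intervalIntegral.integral_mono_on hse hi.intervalIntegrable
          ((((((hcl s a).const_mul 16).add ((hcl e a).const_mul 16)).add
            ((hcl s b).add (hcl e b))).const_mul E).intervalIntegrable _ _) fun t ht => ?_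
        have hp := inv_pos.2 (hφ t)
        have hst := hmono ht.1
        have hte := hmono ht.2
        have key : G t ≤ ((16 * (1 + (σ t - σ s) ^ 2) ^ (-a) + 16 * (1 + (σ t - σ e) ^ 2) ^ (-a)) +
            ((1 + (σ t - σ s) ^ 2) ^ (-b) + (1 + (σ t - σ e) ^ 2) ^ (-b))) * E := by
          have p1 : ∀ c a : ℝ, 0 ≤ (1 + (σ t - σ c) ^ 2) ^ (-a) := fun c a => by positivity
          rcases le_total (σ t - σ s) (σ e - σ t) with h1 | h1
          · refine (hG s e t ht _ (by linarith) le_rfl h1).trans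
              (mul_le_mul_of_nonneg_right ?_ hE)
            linarith [p1 e a, p1 e b]
          · have h2 := hG s e t ht _ (by linarith) h1 le_rfl
            rw [← neg_sub (σ t), neg_sq] at h2
            refine h2.trans (mul_le_mul_of_nonneg_right ?_ hE)
            linarith [p1 s a, p1 s b]
        refine (mul_le_mul_of_nonneg_left key hp.le).trans_eq ?_
        ring
    _ = E * ((16 * (∫ t in s..e, (1 + (σ t - σ s) ^ 2) ^ (-a) * (φ t)⁻¹) +
          16 * ∫ t in s..e, (1 + (σ t - σ e) ^ 2) ^ (-a) * (φ t)⁻¹) +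
          ((∫ t in s..e, (1 + (σ t - σ s) ^ 2) ^ (-b) * (φ t)⁻¹) +
            ∫ t in s..e, (1 + (σ t - σ e) ^ 2) ^ (-b) * (φ t)⁻¹)) := by
        rw [intervalIntegral.integral_const_mul, intervalIntegral.integral_add
          (((hii s a).const_mul 16).add ((hii e a).const_mul 16)) ((hii s b).add (hii e b)),
          intervalIntegral.integral_add ((hii s a).const_mul 16) ((hii e a).const_mul 16),
          intervalIntegral.integral_add (hii s b) (hii e b),
          intervalIntegral.integral_const_mul, intervalIntegral.integral_const_mul]
    _ ≤ _ := by
        rw [mul_comm _ E]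
        refine mul_le_mul_of_nonneg_left ?_ hE
        linarith [b1 ha, b1 hb, b2 ha, b2 hb]

end LocalSmoothing
/-- **Local smoothing for the Dirac equation on hyperbolic-type wrapped products**
(`d(r) = e^{r/2}`, `R_β ≥ 0`, `m² > 3/32`). -/
theorem stmt2 :
    ∀ η₁ : ℝ, 0 < η₁ → ∀ η₂ : ℝ, 0 < η₂ → ∃ C > (0 : ℝ),
      ∀ Ω : Set (Eu 2), IsOpen Ω →
      ∀ β : Eu 2 → Matrix (Fin 2) (Fin 2) ℝ,
        (∀ i j : Fin 2, ContDiffOn ℝ (⊤ : ℕ∞) (fun y => β y i j) Ω) →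
        (∀ y ∈ Ω, (β y).IsSymm) → (∀ y ∈ Ω, (β y).PosDef) →
        (∀ y ∈ Ω, 0 ≤ Rscal β y) →
      ∀ h : Eu 3 → Matrix (Fin 3) (Fin 3) ℝ,
        (∀ x, (h x).IsSymm) → (∀ x, (h x).PosDef) →
        WrapMetric Ω β (fun r => Real.exp (r / 2)) h →
      ∀ m : ℝ, 0 ≤ m → 3 / 32 < m ^ 2 →
      ∀ φ : ℝ → ℝ, ContDiff ℝ (⊤ : ℕ∞) φ → (∀ t, 0 < φ t) →
      ∀ (A : Fin 3 → Eu 3 → Fin 4 → Fin 4 → ℂ) (B : Eu 3 → Fin 4 → Fin 4 → ℂ),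
        (∀ j i k, ContDiffOn ℝ (⊤ : ℕ∞) (fun x => A j x i k) (Mset Ω)) →
        (∀ i k, ContDiffOn ℝ (⊤ : ℕ∞) (fun x => B x i k) (Mset Ω)) →
        (∀ f g : Eu 3 → Fin 4 → ℂ, ContDiff ℝ (⊤ : ℕ∞) f → ContDiff ℝ (⊤ : ℕ∞) g →
          HasCompactSupport f → HasCompactSupport g →
          tsupport f ⊆ Mset Ω → tsupport g ⊆ Mset Ω →
          innM Ω h (Hop A B f) g = innM Ω h f (Hop A B g)) →
        (∀ f : Eu 3 → Fin 4 → ℂ, ContDiff ℝ (⊤ : ℕ∞) f → ∀ x ∈ Mset Ω, ∀ i : Fin 4,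
          Hop A B (Hop A B f) x i
            = ((m : ℂ) ^ 2) * f x i - lapC h (fun y => f y i) x
              + ((Rscal h x / 4 : ℝ) : ℂ) * f x i) →
      ∀ (u : ℝ → Eu 3 → Fin 4 → ℂ) (u₀ : Eu 3 → Fin 4 → ℂ),
        ContDiffOn ℝ (⊤ : ℕ∞) (fun p : ℝ × Eu 3 => u p.1 p.2)
          ((Set.univ : Set ℝ) ×ˢ Mset Ω) →
        (∀ t, HasCompactSupport (u t) ∧ tsupport (u t) ⊆ Mset Ω) →
        (∀ t : ℝ, ∀ x ∈ Mset Ω, ∀ c : Fin 4,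
          Complex.I * ((φ t : ℝ) : ℂ) * deriv (fun s => u s x c) t = Hop A B (u t) x c) →
        (∀ x ∈ Mset Ω, u 0 x = u₀ x) →
        (∫ t : ℝ, (φ t)⁻¹ *
            ∫ x in Mset Ω,
              ((1 + (x 0) ^ 2) ^ (-(1 + η₁)) * (∑ c, ‖u t x c‖ ^ 2)
                + (1 + (x 0) ^ 2) ^ (-(1 / 2 + η₂)) * gradhSq h (u t) x) * sdet h x)
          ≤ C * ∫ x in Mset Ω, (∑ c, ‖Hop A B u₀ x c‖ ^ 2) * sdet h x := by
  intro η₁ hη₁ η₂ hη₂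
  have hJ : ∀ a : ℝ, 0 ≤ ∫ x : ℝ, (1 + x ^ 2) ^ (-a) := fun a =>
    integral_nonneg fun x => by positivity
  have hJ1 := hJ (1 + η₁)
  have hJ2 := hJ (1 / 2 + η₂)
  refine ⟨32 * (∫ x : ℝ, (1 + x ^ 2) ^ (-(1 + η₁))) +
    2 * (∫ x : ℝ, (1 + x ^ 2) ^ (-(1 / 2 + η₂))) + 1, by positivity, ?_⟩
  intro Ω hΩ β hβs hβt hβp hβR h _ hp hw m _ hm φ hφs hφ A B hA hB hsymm hsq u u₀ hu hsupp heq hu0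
  have hM := isOpen_Mset hΩ
  have S : DSol (Mset Ω) (sdet h) φ A B u :=
    { isOpen := hM
      contw := (contDiffOn_sdet (hw.contDiffOn hβs) fun x _ => hp x).continuousOn
      posw := fun x _ => sdet_pos (hp x)
      contφ := hφs.continuous
      posφ := hφ
      smoothA := hA
      smoothB := hB
      symm := fun f g hf hg => hsymm f g hf.1 hg.1 hf.2.1 hg.2.1 hf.2.2 hg.2.2
      smooth := hu
      supp := hsupp
      eqn := heq }
  set E : ℝ := ∫ x in Mset Ω, (∑ c, ‖Hop A B u₀ x c‖ ^ 2) * sdet h x with hE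
  have hE0 : 0 ≤ E := setIntegral_nonneg hM.measurableSet fun x _ =>
    mul_nonneg (nsq_nonneg _) (sdet_pos (hp x)).le
  have hEt : ∀ t, ∫ x in Mset Ω, nsq (Hop A B (u t) x) * sdet h x = E := fun t => by
    rw [S.hop.charge_const 0 t, hE]
    refine setIntegral_congr_fun hM.measurableSet fun x hx => ?_
    simp only [nsq, Hop, hu0 x hx, pd_congr_of_isOpen hM hu0 _ hx]
  have hφi : Continuous fun t => (φ t)⁻¹ := hφs.continuous.inv₀ fun t => (hφ t).ne'
  have hσ : ∀ t, HasDerivAt (fun t => ∫ s in (0 : ℝ)..t, (φ s)⁻¹) (φ t)⁻¹ t := fun t =>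
    (hφi.integral_hasStrictDerivAt 0 t).hasDerivAt
  refine (integral_time_le hφs.continuous hφ hσ (a := 1 + η₁) (b := 1 / 2 + η₂) (by linarith)
    (by linarith) hE0 fun t₁ t₂ t ht ρ hρ h1 h2 => ?_).trans
    (mul_le_mul_of_nonneg_right (by linarith) hE0)
  refine hw.weighted_le hΩ hβs hβp hp (S.isTest t) (by linarith) (by linarith) hρ
    (fun x hx hxρ => S.eq_zero_of_dependence hw hΩ hβs hβp hβt hβR hp hm hsq hσ ht hx
      (hxρ.trans h1) (hxρ.trans h2)) ?_
  rw [← hEt t]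
  exact hw.integral_gradhSq_le hΩ hβs hβp hβt hβR hp S hm hsq (S.isTest t)
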